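/- arXiv:2303.14808 — 2 statements merged into one kernel-verified Lean document; each statement's English description precedes it below -/
import Mathlib

section
/- Let μ be a compactly supported symmetric Borel probability measure on ℝ whose absolutely continuous part (with respect to Lebesgue measure) is nonzero, let B = inf{|λ| : λ ∈ supp μ}, and let F be a continuous centered stationary Gaussian process with spectral measure μ. Then for every ε > 0 there exists c > 0 such that for all T ≥ 1, P( N_F(T) ≤ (B/π)·T + ε·T ) ≥ exp(−c·T). -/
open MeasureTheory ProbabilityTheory Set ENNReal NNReal

/-- The covariance kernel of a spectral measure: `k(t) = ∫ cos (λ t) dμ(λ)`. -/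
noncomputable def covKernel (μ : Measure ℝ) (t : ℝ) : ℝ := ∫ l, Real.cos (l * t) ∂μ

/-- `F` is a continuous centered stationary Gaussian process on `(Ω, P)` with spectral
measure `μ`: sample paths are continuous and every finite linear combination
`∑ cᵢ F_{tᵢ}` is a centered real Gaussian with variance `∑ᵢⱼ cᵢ cⱼ k(tᵢ - tⱼ)`. -/
def IsSGP {Ω : Type*} [MeasurableSpace Ω] (P : Measure Ω) (μ : Measure ℝ)
    (F : ℝ → Ω → ℝ) : Prop :=
  (∀ ω, Continuous fun t => F t ω) ∧
  ∀ (n : ℕ) (t : Fin n → ℝ) (c : Fin n → ℝ),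
    P.map (fun ω => ∑ i, c i * F (t i) ω) =
      gaussianReal 0 (∑ i, ∑ j, c i * c j * covKernel μ (t i - t j)).toNNReal

/-- The zero count `N_F(T)` as an extended natural number. -/
noncomputable def zeroCount {Ω : Type*} (F : ℝ → Ω → ℝ) (T : ℝ) (ω : Ω) : ℕ∞ :=
  {t ∈ Set.Icc (0:ℝ) T | F t ω = 0}.encard

/-- The topological support of a Borel measure on ℝ. -/
def msupport (μ : Measure ℝ) : Set ℝ := {x : ℝ | ∀ U ∈ nhds x, 0 < μ U}

section Crossings

/-- The number of adjacent pairs in a finite real sequence whose product is nonpositive. -/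
noncomputable def signChanges {M : ℕ} (x : Fin (M + 1) → ℝ) : ℕ :=
  (Finset.univ.filter fun i : Fin M => x i.castSucc * x i.succ ≤ 0).card

/-- The `i`-th point of the uniform grid dividing `[0, T]` into `M` cells. -/
noncomputable def gridPoint (T : ℝ) (M : ℕ) (i : Fin (M + 1)) : ℝ := i * T / M

lemma exists_adjacent_mul_nonpos (y : ℕ → ℝ) {i j : ℕ} (hij : i ≤ j) (h : y i * y j < 0) :
    ∃ k, i ≤ k ∧ k < j ∧ y k * y (k + 1) ≤ 0 := by
  by_contra! hk
  have key : ∀ k, i ≤ k → k ≤ j → 0 < y i * y k := by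
    intro k hik
    induction k, hik using Nat.le_induction with
    | base =>
      intro _
      have : y i ≠ 0 := by rintro h0; simp [h0] at h
      exact mul_self_pos.2 this
    | succ k hik ih =>
      intro hkj
      have h1 := ih (by omega)
      have h2 := hk k hik (by omega)
      have h3 : 0 < (y i * y (k + 1)) * (y k) ^ 2 := by nlinarith [mul_pos h1 h2]
      exact pos_of_mul_pos_left h3 (sq_nonneg _)
  exact absurd (key j hij le_rfl) (not_lt.2 h.le)

lemma eventually_exists_gridPoint_mem {T p : ℝ} (hT : 0 < T) (hp0 : 0 < p) (hpT : p < T)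
    {U : Set ℝ} (hU : U ∈ nhds p) :
    ∀ᶠ M : ℕ in Filter.atTop, ∃ i : ℕ, i ≤ M ∧ (i * T / M : ℝ) ∈ U := by
  obtain ⟨ρ, hρ, hball⟩ := Metric.mem_nhds_iff.1 hU
  filter_upwards [Filter.eventually_gt_atTop (max 0 ⌈T / ρ⌉₊)] with M hM
  have hM0 : (0 : ℝ) < M := by exact_mod_cast (le_max_left _ _).trans_lt hM
  have hMρ : T / ρ < M := by
    refine (Nat.le_ceil _).trans_lt ?_
    exact_mod_cast (le_max_right _ _).trans_lt hM
  have hfl : (⌊p * M / T⌋₊ : ℝ) ≤ p * M / T := Nat.floor_le (by positivity)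
  have hfl' : p * M / T < ⌊p * M / T⌋₊ + 1 := Nat.lt_floor_add_one _
  refine ⟨⌊p * M / T⌋₊, ?_, hball ?_⟩
  · have : p * M / T ≤ M := by
      rw [div_le_iff₀ hT]; nlinarith
    exact_mod_cast hfl.trans this
  · rw [div_lt_iff₀ hρ] at hMρ
    rw [le_div_iff₀ hT] at hfl
    rw [div_lt_iff₀ hT] at hfl'
    rw [Metric.mem_ball, Real.dist_eq, abs_lt]
    constructor
    · have : p - ρ < (⌊p * M / T⌋₊ : ℝ) * T / M := by rw [lt_div_iff₀ hM0]; nlinarith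
      linarith
    · have : (⌊p * M / T⌋₊ : ℝ) * T / M ≤ p := by rw [div_le_iff₀ hM0]; nlinarith
      linarith

lemma eventually_exists_adjacent_near {f : ℝ → ℝ} (hf : Continuous f) {T z r p q : ℝ} (hT : 0 < T)
    (hz0 : 0 ≤ z - r) (hzT : z + r ≤ T) (hp : p ∈ Metric.ball z r) (hq : q ∈ Metric.ball z r)
    (hfp : 0 < f p) (hfq : f q < 0) :
    ∀ᶠ M : ℕ in Filter.atTop, ∃ k : Fin M, gridPoint T M k.castSucc ∈ Metric.ball z r ∧
      f (gridPoint T M k.castSucc) * f (gridPoint T M k.succ) ≤ 0 := by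
  have hp' := hp
  have hq' := hq
  rw [Metric.mem_ball, Real.dist_eq, abs_lt] at hp' hq'
  have hUp : Metric.ball z r ∩ {x | 0 < f x} ∈ nhds p :=
    Filter.inter_mem (Metric.isOpen_ball.mem_nhds hp)
      ((isOpen_lt continuous_const hf).mem_nhds hfp)
  have hUq : Metric.ball z r ∩ {x | f x < 0} ∈ nhds q :=
    Filter.inter_mem (Metric.isOpen_ball.mem_nhds hq)
      ((isOpen_lt hf continuous_const).mem_nhds hfq)
  filter_upwards [eventually_exists_gridPoint_mem hT (by linarith) (by linarith) hUp,
    eventually_exists_gridPoint_mem hT (by linarith) (by linarith) hUq,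
    Filter.eventually_gt_atTop 0] with M ⟨i, hiM, hib, hif⟩ ⟨j, hjM, hjb, hjf⟩ hM
  have hM0 : (0 : ℝ) < M := by exact_mod_cast hM
  simp only [Set.mem_ofPred_eq] at hif hjf
  have main : ∀ a b : ℕ, a ≤ b → b ≤ M → (a * T / M : ℝ) ∈ Metric.ball z r →
      (b * T / M : ℝ) ∈ Metric.ball z r → f (a * T / M) * f (b * T / M) < 0 →
      ∃ k : Fin M, gridPoint T M k.castSucc ∈ Metric.ball z r ∧
        f (gridPoint T M k.castSucc) * f (gridPoint T M k.succ) ≤ 0 := by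
    intro a b hab hbM ha hb hlt
    obtain ⟨k, hak, hkb, hk⟩ :=
      exists_adjacent_mul_nonpos (fun n : ℕ => f (n * T / M)) hab hlt
    refine ⟨⟨k, by omega⟩, ?_, by simpa [gridPoint] using hk⟩
    have h1 : (a * T / M : ℝ) ≤ k * T / M := by gcongr
    have h2 : (k * T / M : ℝ) ≤ b * T / M := by gcongr
    rw [Metric.mem_ball, Real.dist_eq, abs_lt] at ha hb ⊢
    simp only [gridPoint, Fin.val_castSucc]
    exact ⟨by linarith, by linarith⟩
  rcases le_total i j with h | h
  · exact main i j h hjM hib hjb (mul_neg_of_pos_of_neg hif hjf)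
  · exact main j i h hiM hjb hib (mul_neg_of_neg_of_pos hjf hif)

/-- `f` takes both strict signs in every neighbourhood of `z`. -/
def CrossesAt (f : ℝ → ℝ) (z : ℝ) : Prop :=
  ∀ r > 0, (∃ p ∈ Metric.ball z r, 0 < f p) ∧ ∃ q ∈ Metric.ball z r, f q < 0

lemma eventually_card_le_signChanges {f : ℝ → ℝ} (hf : Continuous f) {T : ℝ} (hT : 0 < T)
    (Z : Finset ℝ) (hZ : ∀ z ∈ Z, z ∈ Set.Ioo 0 T) (hcross : ∀ z ∈ Z, CrossesAt f z) :
    ∀ᶠ M : ℕ in Filter.atTop, Z.card ≤ signChanges fun i => f (gridPoint T M i) := by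
  obtain ⟨r, hr, hr0, hsep⟩ : ∃ r > 0, (∀ z ∈ Z, 0 ≤ z - r ∧ z + r ≤ T) ∧
      ∀ z ∈ Z, ∀ w ∈ Z, z ≠ w → 2 * r ≤ |z - w| := by
    have e1 : ∀ᶠ r : ℝ in nhdsWithin 0 (Set.Ioi 0), ∀ z ∈ Z, 0 ≤ z - r ∧ z + r ≤ T := by
      rw [Filter.eventually_all_finset]
      intro z hz
      filter_upwards [Ioo_mem_nhdsGT (lt_min (hZ z hz).1 (sub_pos.2 (hZ z hz).2))] with r hr
      have := hr.2
      rw [lt_min_iff] at this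
      exact ⟨by linarith, by linarith⟩
    have e2 : ∀ᶠ r : ℝ in nhdsWithin 0 (Set.Ioi 0), ∀ z ∈ Z, ∀ w ∈ Z, z ≠ w →
        2 * r ≤ |z - w| := by
      rw [Filter.eventually_all_finset]
      intro z hz
      rw [Filter.eventually_all_finset]
      intro w hw
      by_cases hzw : z = w
      · simp [hzw]
      · filter_upwards [Ioo_mem_nhdsGT (half_pos (abs_pos.2 (sub_ne_zero.2 hzw)))] with r hr _
        linarith [hr.2]
    obtain ⟨r, h1, h2, h3⟩ := (e1.and (e2.and self_mem_nhdsWithin)).exists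
    exact ⟨r, h3, h1, h2⟩
  have ev : ∀ᶠ M : ℕ in Filter.atTop, ∀ z ∈ Z, ∃ k : Fin M,
      gridPoint T M k.castSucc ∈ Metric.ball z r ∧
      f (gridPoint T M k.castSucc) * f (gridPoint T M k.succ) ≤ 0 := by
    rw [Filter.eventually_all_finset]
    intro z hz
    obtain ⟨⟨p, hp, hfp⟩, q, hq, hfq⟩ := hcross z hz r hr
    exact eventually_exists_adjacent_near hf hT (hr0 z hz).1 (hr0 z hz).2 hp hq hfp hfq
  filter_upwards [ev] with M hM
  choose! k hk1 hk2 using fun z : Z => hM z z.2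
  rw [signChanges, ← Fintype.card_coe, ← Finset.card_univ]
  refine Finset.card_le_card_of_injOn k (fun z _ => by simpa using hk2 z) fun z _ w _ hzw => ?_
  by_contra hne
  have h1 := hk1 z
  have h2 := hk1 w
  rw [← hzw] at h2
  rw [Metric.mem_ball, Real.dist_eq] at h1 h2
  have h3 := hsep z z.2 w w.2 (fun h => hne (Subtype.ext h))
  have h4 := abs_sub_le (z : ℝ) (gridPoint T M (k z).castSucc) w
  rw [abs_sub_comm (z : ℝ) (gridPoint T M (k z).castSucc)] at h4
  linarith

lemma exists_encard_zeros_le {f : ℝ → ℝ} (hf : Continuous f) {T C : ℝ} (hT : 0 < T)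
    (h0 : f 0 ≠ 0) (hfT : f T ≠ 0) (hcross : ∀ z ∈ Set.Ioo 0 T, f z = 0 → CrossesAt f z)
    (hfreq : ∃ᶠ M : ℕ in Filter.atTop, (signChanges fun i => f (gridPoint T M i) : ℝ) ≤ C) :
    ∃ n : ℕ, {t ∈ Set.Icc (0 : ℝ) T | f t = 0}.encard = n ∧ (n : ℝ) ≤ C := by
  have hfin : ∀ Z : Finset ℝ, (Z : Set ℝ) ⊆ {t ∈ Set.Icc (0 : ℝ) T | f t = 0} →
      (Z.card : ℝ) ≤ C := by
    intro Z hZ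
    have hIoo : ∀ z ∈ Z, z ∈ Set.Ioo 0 T := by
      intro z hz
      obtain ⟨⟨h1, h2⟩, h3⟩ := hZ hz
      refine ⟨lt_of_le_of_ne h1 ?_, lt_of_le_of_ne h2 ?_⟩
      · rintro rfl; exact h0 h3
      · rintro rfl; exact hfT h3
    obtain ⟨M, h1, h2⟩ := (hfreq.and_eventually (eventually_card_le_signChanges hf hT Z hIoo
      fun z hz => hcross z (hIoo z hz) (hZ hz).2)).exists
    exact le_trans (by exact_mod_cast h2) h1
  have hfinite : {t ∈ Set.Icc (0 : ℝ) T | f t = 0}.Finite := by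
    by_contra hinf
    obtain ⟨Z, hZ, hcard⟩ := Set.Infinite.exists_subset_card_eq hinf (⌊C⌋₊ + 1)
    have := hfin Z hZ
    rw [hcard] at this
    push_cast at this
    linarith [Nat.lt_floor_add_one C]
  refine ⟨hfinite.toFinset.card, ?_, hfin _ (by simp)⟩
  rw [← Set.encard_coe_eq_coe_finsetCard, hfinite.coe_toFinset]

end Crossings

section Tangency

variable {Ω : Type*} [MeasurableSpace Ω] {P : Measure Ω} {μ : Measure ℝ} {F : ℝ → Ω → ℝ}

lemma covKernel_zero [IsProbabilityMeasure μ] : covKernel μ 0 = 1 := by simp [covKernel]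

lemma covKernel_neg (t : ℝ) : covKernel μ (-t) = covKernel μ t := by simp [covKernel]

lemma continuous_covKernel [IsFiniteMeasure μ] : Continuous (covKernel μ) := by
  refine continuous_of_dominated (bound := fun _ => 1) (fun t => ?_) (fun t => ?_)
    (integrable_const _) (Filter.Eventually.of_forall fun l => by fun_prop)
  · exact Continuous.aestronglyMeasurable (by fun_prop)
  · exact Filter.Eventually.of_forall fun l => Real.abs_cos_le_one _

namespace IsSGP

lemma neg (hF : IsSGP P μ F) : IsSGP P μ (-F) := by
  refine ⟨fun ω => (hF.1 ω).neg, fun n t c => ?_⟩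
  have := hF.2 n t (-c)
  simpa using! this

lemma map_sum (hF : IsSGP P μ F) {ι : Type*} [Fintype ι] (t c : ι → ℝ) :
    P.map (fun ω => ∑ i, c i * F (t i) ω) =
      gaussianReal 0 (∑ i, ∑ j, c i * c j * covKernel μ (t i - t j)).toNNReal := by
  let e := Fintype.equivFin ι
  have := hF.2 _ (t ∘ e.symm) (c ∘ e.symm)
  simp only [Function.comp_apply] at this
  simp_rw [fun ω => e.symm.sum_comp (fun i => c i * F (t i) ω)] at this
  rw [this, ← e.symm.sum_comp]
  simp_rw [← e.symm.sum_comp (fun j => c _ * c j * covKernel μ (t _ - t j))]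

lemma map_eval [IsProbabilityMeasure μ] (hF : IsSGP P μ F) (t : ℝ) :
    P.map (F t) = gaussianReal 0 1 := by
  simpa [covKernel_zero] using hF.map_sum (fun _ : Unit => t) (fun _ => 1)

lemma aemeasurable [IsProbabilityMeasure μ] (hF : IsSGP P μ F) (t : ℝ) : AEMeasurable (F t) P := by
  apply AEMeasurable.of_map_ne_zero
  rw [hF.map_eval]
  exact IsProbabilityMeasure.ne_zero _

lemma ae_ne_zero [IsProbabilityMeasure μ] (hF : IsSGP P μ F) (t : ℝ) : ∀ᵐ ω ∂P, F t ω ≠ 0 := by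
  have h : (P.map (F t)) {0} = 0 := by
    rw [hF.map_eval]
    have := nullSingletonClass_gaussianReal (μ := 0) (v := 1) one_ne_zero
    exact measure_singleton 0
  rw [Measure.map_apply_of_aemeasurable (hF.aemeasurable t) (measurableSet_singleton 0)] at h
  exact measure_eq_zero_iff_ae_notMem.1 h

lemma isGaussianProcess [IsProbabilityMeasure μ] (hF : IsSGP P μ F) : IsGaussianProcess F P where
  hasGaussianLaw I := by
    constructor
    refine isGaussian_of_map_eq_gaussianReal fun L => ⟨0, (∑ i : I, ∑ j : I, L (Pi.single i 1) * L (Pi.single j 1) *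
      covKernel μ ((i : ℝ) - j)).toNNReal, ?_⟩
    rw [AEMeasurable.map_map_of_aemeasurable (by fun_prop)
      (show AEMeasurable (fun ω => I.restrict fun x => F x ω) P from
        aemeasurable_pi_lambda _ fun i : I => hF.aemeasurable i)]
    rw [← hF.map_sum (fun i : I => (i : ℝ)) (fun i => L (Pi.single i 1))]
    congr 1
    ext ω
    classical
    simp only [Function.comp_apply]
    conv_lhs => rw [← L.sum_comp_single]
    refine Finset.sum_congr rfl fun i _ => ?_
    have : (ContinuousLinearMap.single ℝ (fun _ : I => ℝ) i) (F i ω) = F i ω • Pi.single i 1 := by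
      ext j; by_cases h : j = i
      · subst h; simp
      · simp [h]
    simp only [ContinuousLinearMap.comp_apply, Finset.restrict_def]
    rw [this, map_smul, smul_eq_mul, mul_comm]

lemma memLp_two [IsProbabilityMeasure μ] (hF : IsSGP P μ F) (t : ℝ) : MemLp (F t) 2 P :=
  (hF.isGaussianProcess.hasGaussianLaw_eval t).memLp_two

lemma variance_eval [IsProbabilityMeasure μ] (hF : IsSGP P μ F) (t : ℝ) : Var[F t; P] = 1 := by
  have h := variance_id_gaussianReal (μ := 0) (v := 1)
  rw [← hF.map_eval t, variance_map (by fun_prop) (hF.aemeasurable t)] at h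
  simpa using h

lemma abs_covKernel_le [IsProbabilityMeasure μ] (t : ℝ) : |covKernel μ t| ≤ 1 := by
  have := norm_integral_le_of_norm_le_const (μ := μ) (C := 1)
    (f := fun l => Real.cos (l * t)) (Filter.Eventually.of_forall fun l => Real.abs_cos_le_one _)
  simpa [covKernel] using this

variable [IsProbabilityMeasure P] [IsProbabilityMeasure μ]

lemma covariance_eval (hF : IsSGP P μ F) (s t : ℝ) : cov[F s, F t; P] = covKernel μ (t - s) := by
  have h1 := hF.map_sum ![s, t] (fun _ => 1)
  have h2 : Var[fun ω => F s ω + F t ω; P] = 2 + 2 * covKernel μ (t - s) := by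
    have h := variance_id_gaussianReal (μ := 0) (v := (2 + 2 * covKernel μ (t - s)).toNNReal)
    have e : gaussianReal 0 (2 + 2 * covKernel μ (t - s)).toNNReal =
        P.map (fun ω => F s ω + F t ω) := by
      simp only [Fin.sum_univ_two, Matrix.cons_val_zero, Matrix.cons_val_one, sub_self,
        covKernel_zero, one_mul] at h1
      rw [h1, ← neg_sub t s, covKernel_neg]
      congr 2; ring
    rw [e, variance_map (by fun_prop)
      (show AEMeasurable (fun ω => F s ω + F t ω) P from
        (hF.aemeasurable s).add (hF.aemeasurable t))] at h
    simp only [Function.id_comp] at h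
    rw [h, Real.coe_toNNReal]
    linarith [(abs_le.1 (abs_covKernel_le (μ := μ) (t - s))).1]
  rw [variance_fun_add (hF.memLp_two s) (hF.memLp_two t), hF.variance_eval, hF.variance_eval] at h2
  linarith

lemma indepFun_residual (hF : IsSGP P μ F) (s : ℝ) {ι : Type*} (d : ι → ℝ) :
    IndepFun (F s) (fun ω i => F (d i) ω - covKernel μ (d i - s) * F s ω) P := by
  have hG : IsGaussianProcess (Sum.elim (fun _ : Unit => F s)
      (fun i ω => F (d i) ω - covKernel μ (d i - s) * F s ω)) P := by
    refine hF.isGaussianProcess.of_isGaussianProcess fun x => ?_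
    rcases x with _ | i
    · exact ⟨{s}, ContinuousLinearMap.proj ⟨s, by simp⟩, fun ω => by simp⟩
    · exact ⟨{d i, s}, ContinuousLinearMap.proj ⟨d i, by simp⟩ -
        covKernel μ (d i - s) • ContinuousLinearMap.proj ⟨s, by simp⟩, fun ω => by simp⟩
  have := hG.indepFun_of_covariance_eq_zero (fun _ => hF.aemeasurable s)
    (fun i => (hF.aemeasurable _).sub ((hF.aemeasurable s).const_mul _)) (fun _ i => by
      rw [covariance_fun_sub_right (hF.memLp_two s) (hF.memLp_two _)
        ((hF.memLp_two s).const_mul _), covariance_const_mul_right, hF.covariance_eval,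
        hF.covariance_eval, sub_self, covKernel_zero, mul_one, sub_self])
  exact this.comp (measurable_pi_apply ()) measurable_id

end IsSGP

lemma ProbabilityTheory.IndepFun.ae_ne {Ω : Type*} [MeasurableSpace Ω] {P : Measure Ω}
    [IsProbabilityMeasure P] {X Y : Ω → ℝ} (h : IndepFun X Y P) (hX : AEMeasurable X P)
    (hY : AEMeasurable Y P) [NullSingletonClass (P.map X)] : ∀ᵐ ω ∂P, X ω ≠ Y ω := by
  have hprod := (indepFun_iff_map_prod_eq_prod_map_map hX hY).1 h
  have hdiag : (P.map fun ω => (X ω, Y ω)) {p : ℝ × ℝ | p.1 = p.2} = 0 := by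
    have := Measure.isProbabilityMeasure_map (μ := P) hX
    have := Measure.isProbabilityMeasure_map (μ := P) hY
    rw [hprod, Measure.prod_apply_symm (measurableSet_eq_fun measurable_fst measurable_snd)]
    simp [Set.preimage]
  rw [Measure.map_apply_of_aemeasurable (hX.prodMk hY)
    (measurableSet_eq_fun measurable_fst measurable_snd)] at hdiag
  exact measure_eq_zero_iff_ae_notMem.1 hdiag

/-- If `f ≤ 0` on `[s, t]` with a zero there, and `a ≥ 1/2`, then `x` is determined by the
values of `f - a x` along a dense sequence. -/
lemma eq_iInf_of_nonpos_of_zero {s t x : ℝ} {f a : ℝ → ℝ} (hf : Continuous f)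
    (ha : ∀ u ∈ Set.Icc s t, 1 / 2 ≤ a u) (hneg : ∀ u ∈ Set.Icc s t, f u ≤ 0)
    {z : ℝ} (hz : z ∈ Set.Icc s t) (hfz : f z = 0) [Nonempty (Set.Icc s t)] :
    x = ⨅ n, -(f (TopologicalSpace.denseSeq (Set.Icc s t) n) -
      a (TopologicalSpace.denseSeq (Set.Icc s t) n) * x) /
        a (TopologicalSpace.denseSeq (Set.Icc s t) n) := by
  set d := TopologicalSpace.denseSeq (Set.Icc s t)
  have key : ∀ n, -(f (d n) - a (d n) * x) / a (d n) = x - f (d n) / a (d n) := by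
    intro n
    have := ha _ (d n).2
    have : a (d n) ≠ 0 := by linarith
    field_simp; ring
  simp_rw [key]
  have hle : ∀ n, x ≤ x - f (d n) / a (d n) := fun n => by
    have h1 := ha _ (d n).2
    have h2 := hneg _ (d n).2
    have : f (d n) / a (d n) ≤ 0 := div_nonpos_of_nonpos_of_nonneg h2 (by linarith)
    linarith
  refine le_antisymm (le_ciInf hle) (le_of_forall_pos_lt_add fun ε hε => ?_)
  have hopen : IsOpen {u : Set.Icc s t | -(ε / 2) < f u} :=
    isOpen_lt continuous_const (hf.comp continuous_subtype_val)
  obtain ⟨n, hn⟩ := (TopologicalSpace.denseRange_denseSeq (Set.Icc s t)).exists_mem_open hopen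
    ⟨⟨z, hz⟩, by simp [hfz, hε]⟩
  refine (ciInf_le ⟨x, ?_⟩ n).trans_lt ?_
  · rintro _ ⟨m, rfl⟩; exact hle m
  · have h1 := ha _ (d n).2
    have hn' : -(ε / 2) < f (d n) := hn
    have : -ε < f (d n) / a (d n) := by
      rw [lt_div_iff₀ (by linarith)]; nlinarith
    linarith

namespace IsSGP

variable [IsProbabilityMeasure P] [IsProbabilityMeasure μ]

lemma ae_not_tangent (hF : IsSGP P μ F) {s t : ℝ}
    (hk : ∀ u ∈ Set.Icc s t, 1 / 2 ≤ covKernel μ (u - s)) :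
    ∀ᵐ ω ∂P, (∀ u ∈ Set.Icc s t, F u ω ≤ 0) → ∀ z ∈ Set.Icc s t, F z ω ≠ 0 := by
  rcases (Set.Icc s t).eq_empty_or_nonempty with h | h
  · simp [h]
  have : Nonempty (Set.Icc s t) := h.to_subtype
  set d := TopologicalSpace.denseSeq (Set.Icc s t)
  let φ : (ℕ → ℝ) → ℝ := fun y => ⨅ n, -(y n) / covKernel μ (d n - s)
  have hφ : Measurable φ := Measurable.iInf fun n => by fun_prop
  have hind := (hF.indepFun_residual s (fun n => (d n : ℝ))).comp measurable_id hφ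
  have : NullSingletonClass (P.map (id ∘ F s)) := by
    rw [Function.id_comp, hF.map_eval]
    exact nullSingletonClass_gaussianReal one_ne_zero
  have hY : AEMeasurable (φ ∘ fun ω n => F (d n) ω - covKernel μ (d n - s) * F s ω) P :=
    hφ.comp_aemeasurable (aemeasurable_pi_lambda _ fun n =>
      (hF.aemeasurable _).sub ((hF.aemeasurable s).const_mul _))
  filter_upwards [hind.ae_ne (hF.aemeasurable s) hY] with ω hω hneg z hz hFz
  exact hω (eq_iInf_of_nonpos_of_zero (x := F s ω) (a := fun u => covKernel μ (u - s))
    (hF.1 ω) hk hneg hz hFz)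

lemma ae_crossesAt (hF : IsSGP P μ F) :
    ∀ᵐ ω ∂P, ∀ z, F z ω = 0 → CrossesAt (fun t => F t ω) z := by
  obtain ⟨δ, hδ, hk⟩ : ∃ δ > 0, ∀ x : ℝ, |x| < δ → 1 / 2 ≤ covKernel μ x := by
    have h : ∀ᶠ x in nhds (0 : ℝ), 1 / 2 < covKernel μ x :=
      continuous_covKernel.continuousAt.eventually_const_lt (by rw [covKernel_zero]; norm_num)
    obtain ⟨δ, hδ, h⟩ := Metric.eventually_nhds_iff.1 h
    exact ⟨δ, hδ, fun x hx => (h (by simpa using hx)).le⟩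
  have hall : ∀ G : ℝ → Ω → ℝ, IsSGP P μ G → ∀ᵐ ω ∂P, ∀ a b : ℚ, (b : ℝ) - a < δ →
      (∀ u ∈ Set.Icc (a : ℝ) b, G u ω ≤ 0) → ∀ z ∈ Set.Icc (a : ℝ) b, G z ω ≠ 0 := by
    intro G hG
    rw [ae_all_iff]; intro a
    rw [ae_all_iff]; intro b
    by_cases hab : (b : ℝ) - a < δ
    · filter_upwards [hG.ae_not_tangent (s := a) (t := b) fun u hu => hk _ (by
        rw [abs_of_nonneg (by linarith [hu.1])]; linarith [hu.2])] with ω hω _ using hω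
    · exact Filter.Eventually.of_forall fun ω h => absurd h hab
  have hpos : ∀ G : ℝ → Ω → ℝ, IsSGP P μ G → ∀ᵐ ω ∂P, ∀ z, G z ω = 0 → ∀ r > 0,
      ∃ p ∈ Metric.ball z r, 0 < G p ω := by
    intro G hG
    filter_upwards [hall G hG] with ω hω z hz r hr
    by_contra! hcon
    obtain ⟨a, ha1, ha2⟩ := exists_rat_btwn (show z - min r (δ / 2) < z by simp [hr, hδ])
    obtain ⟨b, hb1, hb2⟩ := exists_rat_btwn (show z < z + min r (δ / 2) by simp [hr, hδ])
    have h1 := min_le_left r (δ / 2)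
    have h2 := min_le_right r (δ / 2)
    refine hω a b (by linarith) (fun u hu => hcon u ?_) z ⟨ha2.le, hb1.le⟩ hz
    rw [Metric.mem_ball, Real.dist_eq, abs_lt]
    exact ⟨by linarith [hu.1], by linarith [hu.2]⟩
  filter_upwards [hpos F hF, hpos (-F) hF.neg] with ω h1 h2 z hz r hr
  refine ⟨h1 z hz r hr, ?_⟩
  obtain ⟨p, hp, h⟩ := h2 z (by simp [hz]) r hr
  exact ⟨p, hp, by simpa using h⟩

end IsSGP

end Tangency

section Contraction

lemma smul_pi_le_pi {ι : Type*} [Fintype ι] {α : ι → Type*} [∀ i, MeasurableSpace (α i)]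
    {μ ν : ∀ i, Measure (α i)} [∀ i, SigmaFinite (μ i)] {c : ℝ≥0∞} (h : ∀ i, c • μ i ≤ ν i) :
    c ^ Fintype.card ι • Measure.pi μ ≤ Measure.pi ν := by
  refine Measure.le_iff.2 fun s hs => ?_
  rw [Measure.pi_def ν, toMeasure_apply _ _ hs]
  have key : (c ^ Fintype.card ι • Measure.pi μ).toOuterMeasure ≤
      OuterMeasure.pi fun i => (ν i).toOuterMeasure := by
    refine OuterMeasure.le_pi.2 fun t _ => ?_
    change (c ^ Fintype.card ι • Measure.pi μ) (Set.pi univ t) ≤ ∏ i, ν i (t i)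
    rw [Measure.smul_apply, Measure.pi_pi, smul_eq_mul, ← Finset.card_univ, ← Finset.prod_const,
      ← Finset.prod_mul_distrib]
    exact Finset.prod_le_prod' fun i _ => h i (t i)
  exact key s

lemma smul_map_mul_gaussianReal_le {η : ℝ} (h0 : 0 < η) (h1 : η ≤ 1) :
    ENNReal.ofReal η • (gaussianReal 0 1).map (fun x => η * x) ≤ gaussianReal 0 1 := by
  have hv : (NNReal.mk (η ^ 2) (sq_nonneg η) * 1 : ℝ≥0) ≠ 0 := by
    rw [mul_one]
    intro h
    have := congrArg NNReal.toReal h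
    simp at this
    exact h0.ne' this
  rw [gaussianReal_map_const_mul, mul_zero, gaussianReal_of_var_ne_zero _ hv,
    gaussianReal_of_var_ne_zero _ one_ne_zero, ← withDensity_smul _ (measurable_gaussianPDF _ _)]
  refine withDensity_mono (Filter.Eventually.of_forall fun x => ?_)
  rw [Pi.smul_apply, smul_eq_mul, gaussianPDF, gaussianPDF, ← ENNReal.ofReal_mul h0.le]
  refine ENNReal.ofReal_le_ofReal ?_
  simp only [gaussianPDFReal, sub_zero, mul_one, NNReal.coe_one, NNReal.coe_mk]
  rw [Real.sqrt_mul (by positivity), Real.sqrt_sq h0.le, mul_inv, ← mul_assoc]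
  rw [mul_comm η, mul_assoc _ _ η, inv_mul_cancel₀ h0.ne', mul_one]
  refine mul_le_mul_of_nonneg_left (Real.exp_le_exp.2 ?_) (by positivity)
  rw [neg_div, neg_div, neg_le_neg_iff]
  refine div_le_div_of_nonneg_left (sq_nonneg x) (by positivity) ?_
  nlinarith

variable {E : Type*} [NormedAddCommGroup E] [InnerProductSpace ℝ E] [FiniteDimensional ℝ E]
  [MeasurableSpace E] [BorelSpace E]

lemma smul_map_smul_stdGaussian_le {η : ℝ} (h0 : 0 < η) (h1 : η ≤ 1) :
    ENNReal.ofReal η ^ Module.finrank ℝ E • (stdGaussian E).map (fun x => η • x) ≤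
      stdGaussian E := by
  have hpi : (Measure.pi fun _ : Fin (Module.finrank ℝ E) => gaussianReal 0 1).map
      (fun x i => η * x i) =
        Measure.pi fun _ => (gaussianReal 0 1).map (fun x => η * x) := by
    refine (Measure.pi_map_pi (f := fun _ x => η * x) fun i => ?_)
    fun_prop
  have hle := smul_pi_le_pi (ι := Fin (Module.finrank ℝ E))
    (fun _ => smul_map_mul_gaussianReal_le h0 h1)
  rw [Fintype.card_fin, ← hpi] at hle
  have := Measure.map_mono hle (f := fun x => ∑ i, x i • stdOrthonormalBasis ℝ E i) (by fun_prop)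
  rw [Measure.map_smul, Measure.map_map (by fun_prop) (by fun_prop)] at this
  refine le_trans (le_of_eq ?_) this
  rw [stdGaussian, Measure.map_map (by fun_prop) (by fun_prop)]
  congr 2
  ext x
  simp [Finset.smul_sum, mul_smul]

lemma stdGaussian_eq_map_prod (S : Submodule ℝ E) :
    stdGaussian E = ((stdGaussian S).prod (stdGaussian E)).map
      (fun p => (p.1 : E) + (p.2 - S.starProjection p.2)) := by
  have hm : Measurable fun p : S × E => (p.1 : E) + (p.2 - S.starProjection p.2) := by fun_prop
  have := Measure.isProbabilityMeasure_map (μ := (stdGaussian S).prod (stdGaussian E))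
    hm.aemeasurable
  refine Measure.ext_of_charFun ?_
  ext t
  rw [charFun_stdGaussian, charFun_apply, integral_map hm.aemeasurable
    (Measurable.aestronglyMeasurable (by fun_prop))]
  have hin : ∀ p : S × E, inner ℝ ((p.1 : E) + (p.2 - S.starProjection p.2)) t =
      inner ℝ p.1 (S.orthogonalProjectionOnto t) + inner ℝ p.2 (t - S.starProjection t) := by
    intro p
    rw [inner_add_left, inner_sub_left, inner_sub_right]
    congr 1
    · rw [Submodule.coe_inner, ← Submodule.starProjection_apply,
        ← S.inner_starProjection_left_eq_right, S.starProjection_mem_subspace_eq_self]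
    · rw [S.inner_starProjection_left_eq_right]
  simp_rw [hin, Complex.ofReal_add, add_mul, Complex.exp_add]
  rw [integral_prod_mul (fun x : S => Complex.exp (inner ℝ x (S.orthogonalProjectionOnto t) * Complex.I))
    (fun y : E => Complex.exp (inner ℝ y (t - S.starProjection t) * Complex.I)),
    ← charFun_apply, ← charFun_apply, charFun_stdGaussian, charFun_stdGaussian, ← Complex.exp_add]
  congr 1
  have : ‖t‖ ^ 2 = ‖S.orthogonalProjectionOnto t‖ ^ 2 + ‖t - S.starProjection t‖ ^ 2 := by
    rw [Submodule.norm_sq_eq_add_norm_sq_starProjection t S, S.starProjection_orthogonal_val,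
      Submodule.starProjection_apply, Submodule.coe_norm]
  rw [← Complex.ofReal_pow, this]
  push_cast; ring

/-- Contracting a standard Gaussian vector by `η` along a subspace of dimension `n` yields a law
dominated by `η ^ (-n)` times the standard Gaussian. -/
lemma smul_map_contract_stdGaussian_le (S : Submodule ℝ E) {η : ℝ} (h0 : 0 < η) (h1 : η ≤ 1) :
    ENNReal.ofReal η ^ Module.finrank ℝ S • (stdGaussian E).map
      (fun x => x - S.starProjection x + η • S.starProjection x) ≤ stdGaussian E := by
  have hm : Measurable fun p : S × E => (p.1 : E) + (p.2 - S.starProjection p.2) := by fun_prop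
  have hle := Measure.map_mono (Measure.prod_mono
    (smul_map_smul_stdGaussian_le (E := S) h0 h1) (le_refl (stdGaussian E))) hm
  rw [← stdGaussian_eq_map_prod] at hle
  refine le_trans (le_of_eq ?_) hle
  nth_rw 1 [stdGaussian_eq_map_prod S]
  rw [Measure.prod_smul_left, Measure.map_smul]
  congr 1
  have hprod := Measure.map_prod_map (stdGaussian S) (stdGaussian E) (f := fun x => η • x)
    (by fun_prop) measurable_id
  rw [Measure.map_id] at hprod
  rw [hprod, Measure.map_map (by fun_prop) hm, Measure.map_map hm (by fun_prop)]
  congr 1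
  ext p
  have h2 : S.starProjection (p.2 - S.starProjection p.2) = 0 := by
    rw [map_sub, S.starProjection_eq_self_iff.2 (S.starProjection_apply_mem _), sub_self]
  simp [h2, S.starProjection_mem_subspace_eq_self]
  abel

end Contraction

section TwoPoint

lemma integral_abs_gaussianReal : ∫ y, |y| ∂gaussianReal 0 1 = √(2 / Real.pi) := by
  rw [integral_gaussianReal_eq_integral_smul one_ne_zero]
  let f : ℝ → ℝ := fun x =>
    (√(2 * Real.pi))⁻¹ * (x ^ (1 : ℝ) * Real.exp (-(1 / 2) * x ^ (2 : ℝ)))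
  have h : ∀ y : ℝ, gaussianPDFReal 0 1 y • |y| = f |y| := by
    intro y
    simp only [f, gaussianPDFReal, sub_zero, NNReal.coe_one, mul_one, smul_eq_mul, Real.rpow_one,
      Real.rpow_two, sq_abs]
    rw [show -y ^ 2 / 2 = -(1 / 2) * y ^ 2 by ring]
    ring
  simp_rw [h]
  rw [integral_comp_abs (f := f), integral_const_mul,
    integral_rpow_mul_exp_neg_mul_rpow (by norm_num) (by norm_num) (by norm_num)]
  norm_num
  have h2 : √2 * √2 = 2 := Real.mul_self_sqrt (by norm_num)
  have := Real.sqrt_pos.2 Real.pi_pos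
  field_simp
  nlinarith

lemma integrable_abs_gaussianReal : Integrable (fun y : ℝ => |y|) (gaussianReal 0 1) :=
  (IsGaussian.integrable_id (μ := gaussianReal 0 1)).abs

lemma gaussianReal_le_volume (s : Set ℝ) :
    gaussianReal 0 1 s ≤ ENNReal.ofReal (√(2 * Real.pi))⁻¹ * volume s := by
  rw [gaussianReal_apply _ one_ne_zero, ← setLIntegral_const]
  refine setLIntegral_mono measurable_const fun x _ => ENNReal.ofReal_le_ofReal ?_
  simp only [gaussianPDFReal, sub_zero, NNReal.coe_one, mul_one]
  refine mul_le_of_le_one_right (by positivity) (Real.exp_le_one_iff.2 ?_)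
  have := sq_nonneg x
  linarith

lemma gaussian_prod_sector_le {c : ℝ} (hc : 0 ≤ c) :
    ((gaussianReal 0 1).prod (gaussianReal 0 1)) {p : ℝ × ℝ | p.1 * (p.1 + c * p.2) ≤ 0} ≤
      ENNReal.ofReal (c / Real.pi) := by
  have hs : MeasurableSet {p : ℝ × ℝ | p.1 * (p.1 + c * p.2) ≤ 0} :=
    measurableSet_le (by fun_prop) measurable_const
  rw [Measure.prod_apply_symm hs]
  have hy : ∀ y : ℝ, gaussianReal 0 1 ((fun x => (x, y)) ⁻¹' {p : ℝ × ℝ | p.1 * (p.1 + c * p.2) ≤ 0})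
      ≤ ENNReal.ofReal ((√(2 * Real.pi))⁻¹ * c * |y|) := by
    intro y
    have hsub : (fun x => (x, y)) ⁻¹' {p : ℝ × ℝ | p.1 * (p.1 + c * p.2) ≤ 0} ⊆
        Set.uIcc 0 (-(c * y)) := by
      intro x hx
      have hx' : x * (x + c * y) ≤ 0 := hx
      rw [Set.mem_uIcc]
      rcases mul_nonpos_iff.1 hx' with h | h
      · left; exact ⟨h.1, by linarith⟩
      · right; exact ⟨by linarith, h.1⟩
    refine (measure_mono hsub).trans ((gaussianReal_le_volume _).trans_eq ?_)
    rw [Real.volume_interval, ← ENNReal.ofReal_mul (by positivity), sub_zero, abs_neg, abs_mul,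
      abs_of_nonneg hc, mul_assoc]
  refine (lintegral_mono hy).trans_eq ?_
  rw [← ofReal_integral_eq_lintegral_ofReal (integrable_abs_gaussianReal.const_mul _)
    (Filter.Eventually.of_forall fun y => by positivity), integral_const_mul,
    integral_abs_gaussianReal]
  congr 1
  rw [Real.sqrt_div (by norm_num), Real.sqrt_mul (by norm_num)]
  have h2 := Real.mul_self_sqrt Real.pi_pos.le
  have h3 : √2 ≠ 0 := by simp
  have := Real.sqrt_pos.2 Real.pi_pos
  have := Real.pi_pos
  field_simp
  nlinarith

variable {E : Type*} [NormedAddCommGroup E] [InnerProductSpace ℝ E] [FiniteDimensional ℝ E]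
  [MeasurableSpace E] [BorelSpace E]

lemma map_inner_stdGaussian_eq {a b : E} {σ α β : ℝ} (hσ : ‖a‖ ^ 2 = σ ^ 2)
    (hα : inner ℝ a b = σ * α) (hβ : ‖b‖ ^ 2 = α ^ 2 + β ^ 2) :
    (stdGaussian E).map (fun x => (inner ℝ x a, inner ℝ x b)) =
      ((gaussianReal 0 1).prod (gaussianReal 0 1)).map
        (fun p => (σ * p.1, α * p.1 + β * p.2)) := by
  have hm : Measurable (fun x : E => (inner ℝ x a, inner ℝ x b)) := by fun_prop
  have hm' : Measurable (fun p : ℝ × ℝ => (σ * p.1, α * p.1 + β * p.2)) := by fun_prop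
  have := Measure.isProbabilityMeasure_map (μ := stdGaussian E) hm.aemeasurable
  have := Measure.isProbabilityMeasure_map
    (μ := (gaussianReal 0 1).prod (gaussianReal 0 1)) hm'.aemeasurable
  refine Measure.ext_of_charFunDual ?_
  ext L
  have hL : ∀ x y : ℝ, L (x, y) = x * L (1, 0) + y * L (0, 1) := by
    intro x y
    rw [← smul_eq_mul, ← smul_eq_mul, ← map_smul, ← map_smul, ← map_add]
    simp
  set p := L (1, 0)
  set q := L (0, 1)
  rw [charFunDual_apply, charFunDual_apply, integral_map hm.aemeasurable
    (Measurable.aestronglyMeasurable (by fun_prop)), integral_map hm'.aemeasurable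
    (Measurable.aestronglyMeasurable (by fun_prop))]
  have h1 : ∀ x : E, L (inner ℝ x a, inner ℝ x b) = inner ℝ x (p • a + q • b) := by
    intro x
    rw [hL, inner_add_right, real_inner_smul_right, real_inner_smul_right]; ring
  have h2 : ∀ x : ℝ × ℝ, ((L (σ * x.1, α * x.1 + β * x.2) : ℝ) : ℂ) * Complex.I =
      ((p * σ + q * α : ℝ) : ℂ) * x.1 * Complex.I + ((q * β : ℝ) : ℂ) * x.2 * Complex.I := by
    intro x
    rw [hL]; push_cast; ring
  simp_rw [h1, h2, Complex.exp_add]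
  rw [integral_prod_mul (fun x : ℝ => Complex.exp (((p * σ + q * α : ℝ) : ℂ) * x * Complex.I))
    (fun x : ℝ => Complex.exp (((q * β : ℝ) : ℂ) * x * Complex.I)), ← charFun_apply,
    ← charFun_apply_real, ← charFun_apply_real, charFun_gaussianReal, charFun_gaussianReal,
    charFun_stdGaussian, ← Complex.exp_add]
  congr 1
  have hn : ‖p • a + q • b‖ ^ 2 = (p * σ + q * α) ^ 2 + (q * β) ^ 2 := by
    rw [norm_add_sq_real, norm_smul, norm_smul, real_inner_smul_left, real_inner_smul_right, hα,
      mul_pow, mul_pow, hσ, hβ, Real.norm_eq_abs, Real.norm_eq_abs, sq_abs, sq_abs]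
    ring
  rw [← Complex.ofReal_pow, hn]
  push_cast
  ring

/-- The probability that two Gaussian variables with nearby covariance vectors have opposite
signs. -/
lemma stdGaussian_mul_nonpos_le {a b : E} (h : ‖a - b‖ < ‖a‖) :
    stdGaussian E {x | inner ℝ x a * inner ℝ x b ≤ 0} ≤
      ENNReal.ofReal (‖a - b‖ / (Real.pi * (‖a‖ - ‖a - b‖))) := by
  have ha : 0 < ‖a‖ := (norm_nonneg _).trans_lt h
  set α := inner ℝ a b / ‖a‖ with hα
  have hαa : inner ℝ a b = ‖a‖ * α := by rw [hα]; field_simp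
  have hα0 : ‖a‖ - ‖a - b‖ ≤ α := by
    rw [hα, le_div_iff₀ ha]
    have h1 : inner ℝ a b = ‖a‖ ^ 2 - inner ℝ a (a - b) := by
      rw [inner_sub_right, real_inner_self_eq_norm_sq]; ring
    have h2 := real_inner_le_norm a (a - b)
    nlinarith
  have hsub := norm_sub_sq_real a b
  have hαb : α ^ 2 ≤ ‖b‖ ^ 2 := by
    have h1 := abs_real_inner_le_norm a b
    rw [hαa, abs_mul, abs_norm] at h1
    rw [← sq_abs]
    exact pow_le_pow_left₀ (abs_nonneg _) (le_of_mul_le_mul_left h1 ha) 2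
  set β := √(‖b‖ ^ 2 - α ^ 2) with hβ
  have hβ2 : β ^ 2 = ‖b‖ ^ 2 - α ^ 2 := Real.sq_sqrt (by linarith)
  have hβle : β ≤ ‖a - b‖ := by
    refine Real.sqrt_le_iff.2 ⟨norm_nonneg _, ?_⟩
    rw [hsub, hαa]; nlinarith [sq_nonneg (‖a‖ - α)]
  have hαpos : 0 < α := by linarith
  have hβ0 : 0 ≤ β := Real.sqrt_nonneg _
  have hlaw := map_inner_stdGaussian_eq (a := a) (b := b) (σ := ‖a‖) (α := α) (β := β) rfl hαa
    (by linarith)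
  have hs : MeasurableSet {p : ℝ × ℝ | p.1 * p.2 ≤ 0} :=
    measurableSet_le (by fun_prop) measurable_const
  have hev := congrArg (fun ν : Measure (ℝ × ℝ) => ν {p : ℝ × ℝ | p.1 * p.2 ≤ 0}) hlaw
  rw [Measure.map_apply (by fun_prop) hs, Measure.map_apply (by fun_prop) hs] at hev
  change stdGaussian E {x | inner ℝ x a * inner ℝ x b ≤ 0} = _ at hev
  rw [hev]
  have hset : (fun p : ℝ × ℝ => (‖a‖ * p.1, α * p.1 + β * p.2)) ⁻¹' {p | p.1 * p.2 ≤ 0} =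
      {p : ℝ × ℝ | p.1 * (p.1 + β / α * p.2) ≤ 0} := by
    ext p
    change ‖a‖ * p.1 * (α * p.1 + β * p.2) ≤ 0 ↔ p.1 * (p.1 + β / α * p.2) ≤ 0
    have : ‖a‖ * p.1 * (α * p.1 + β * p.2) = ‖a‖ * α * (p.1 * (p.1 + β / α * p.2)) := by
      field_simp
    rw [this]
    exact ⟨fun h => by by_contra! h'; exact absurd h (not_le.2 (by positivity)),
      fun h => mul_nonpos_of_nonneg_of_nonpos (by positivity) h⟩
  rw [hset]
  refine (gaussian_prod_sector_le (by positivity)).trans (ENNReal.ofReal_le_ofReal ?_)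
  rw [div_div, mul_comm α]
  have : 0 < ‖a‖ - ‖a - b‖ := by linarith
  have := Real.pi_pos
  gcongr

end TwoPoint

section GaussianSignChanges

lemma measurable_signChanges {M : ℕ} :
    Measurable fun x : Fin (M + 1) → ℝ => (signChanges x : ℝ) := by
  simp only [signChanges, Finset.card_filter]
  push_cast
  refine Finset.measurable_sum _ fun i _ => ?_
  exact Measurable.ite (measurableSet_le (by fun_prop) measurable_const) measurable_const
    measurable_const

/-- Markov's inequality for the number of sign changes. -/
lemma one_sub_le_measure_signChanges {Ω : Type*} [MeasurableSpace Ω] {P : Measure Ω}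
    [IsProbabilityMeasure P] {M : ℕ} {X : Ω → Fin (M + 1) → ℝ} (hX : Measurable X) {r C : ℝ}
    (hr : 0 ≤ r) (hC : 0 < C)
    (h : ∀ i : Fin M, P {ω | X ω i.castSucc * X ω i.succ ≤ 0} ≤ ENNReal.ofReal r) :
    ENNReal.ofReal (1 - M * r / C) ≤ P {ω | (signChanges (X ω) : ℝ) ≤ C} := by
  have hms : ∀ i : Fin M, MeasurableSet {ω | X ω i.castSucc * X ω i.succ ≤ 0} := fun i =>
    measurableSet_le (by fun_prop) measurable_const
  have hmean : ∫⁻ ω, (signChanges (X ω) : ℝ≥0∞) ∂P ≤ ENNReal.ofReal (M * r) := by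
    have hsum : ∀ ω, (signChanges (X ω) : ℝ≥0∞) =
        ∑ i : Fin M, {ω | X ω i.castSucc * X ω i.succ ≤ 0}.indicator 1 ω := by
      intro ω
      rw [signChanges, Finset.card_filter]
      push_cast
      refine Finset.sum_congr rfl fun i _ => ?_
      simp [Set.indicator_apply]
    simp_rw [hsum]
    rw [lintegral_finsetSum _ fun i _ => measurable_one.indicator (hms i)]
    simp_rw [lintegral_indicator_one (hms _)]
    refine (Finset.sum_le_sum fun i _ => h i).trans_eq ?_
    rw [Finset.sum_const, Finset.card_univ, Fintype.card_fin, nsmul_eq_mul,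
      ENNReal.ofReal_mul (by positivity), ENNReal.ofReal_natCast]
  have hmeas : Measurable fun ω => (signChanges (X ω) : ℝ) := measurable_signChanges.comp hX
  have hset : MeasurableSet {ω | (signChanges (X ω) : ℝ) ≤ C} :=
    measurableSet_le hmeas measurable_const
  have hmarkov : P {ω | (signChanges (X ω) : ℝ) ≤ C}ᶜ ≤ ENNReal.ofReal (M * r / C) := by
    have hsub : {ω | (signChanges (X ω) : ℝ) ≤ C}ᶜ ⊆
        {ω | ENNReal.ofReal C ≤ (signChanges (X ω) : ℝ≥0∞)} := by
      intro ω hω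
      have hω' : C < (signChanges (X ω) : ℝ) := not_le.1 hω
      change ENNReal.ofReal C ≤ (signChanges (X ω) : ℝ≥0∞)
      rw [← ENNReal.ofReal_natCast]
      exact ENNReal.ofReal_le_ofReal hω'.le
    refine (measure_mono hsub).trans ?_
    have hmE : AEMeasurable (fun ω => (signChanges (X ω) : ℝ≥0∞)) P := by
      have : (fun ω => (signChanges (X ω) : ℝ≥0∞)) =
          fun ω => ENNReal.ofReal (signChanges (X ω) : ℝ) := by
        ext ω; rw [ENNReal.ofReal_natCast]
      rw [this]
      exact hmeas.ennreal_ofReal.aemeasurable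
    refine (meas_ge_le_lintegral_div hmE (by simpa using hC) ENNReal.ofReal_ne_top).trans ?_
    rw [ENNReal.ofReal_div_of_pos hC]
    gcongr
  rw [ENNReal.ofReal_sub _ (by positivity), ENNReal.ofReal_one, ← compl_compl {ω | _},
    prob_compl_eq_one_sub hset.compl]
  exact tsub_le_tsub_left hmarkov 1

lemma ext_of_map_sum {ι : Type*} [Fintype ι] {ρ ν : Measure (ι → ℝ)} [IsFiniteMeasure ρ]
    [IsFiniteMeasure ν]
    (h : ∀ c : ι → ℝ, ρ.map (fun x => ∑ i, c i * x i) = ν.map (fun x => ∑ i, c i * x i)) :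
    ρ = ν := by
  classical
  refine Measure.ext_of_charFunDual ?_
  ext L
  have hL : (L : (ι → ℝ) → ℝ) = fun x => ∑ i, L (Pi.single i 1) * x i := by
    ext x
    conv_lhs => rw [pi_eq_sum_univ' x]
    simp [map_sum, mul_comm]
  rw [charFunDual_eq_charFun_map_one, charFunDual_eq_charFun_map_one, hL, h]

variable {E : Type*} [NormedAddCommGroup E] [InnerProductSpace ℝ E] [FiniteDimensional ℝ E]

lemma norm_contract_sq (S : Submodule ℝ E) (η : ℝ) (x : E) :
    ‖x - S.starProjection x + η • S.starProjection x‖ ^ 2 =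
      ‖x - S.starProjection x‖ ^ 2 + η ^ 2 * ‖S.starProjection x‖ ^ 2 := by
  rw [norm_add_sq_real, norm_smul, mul_pow, Real.norm_eq_abs, sq_abs, real_inner_smul_right,
    S.starProjection_inner_eq_zero x _ (S.starProjection_apply_mem x)]
  ring

lemma inner_contract_left (S : Submodule ℝ E) (η : ℝ) (x y : E) :
    inner ℝ (x - S.starProjection x + η • S.starProjection x) y =
      inner ℝ x (y - S.starProjection y + η • S.starProjection y) := by
  rw [inner_add_left, inner_sub_left, inner_add_right, inner_sub_right, real_inner_smul_left,
    real_inner_smul_right, S.inner_starProjection_left_eq_right]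

lemma norm_sub_starProjection_le (S : Submodule ℝ E) (x : E) {s : E} (hs : s ∈ S) :
    ‖x - S.starProjection x‖ ≤ ‖x - s‖ := by
  rw [S.starProjection_minimal]
  exact ciInf_le ⟨0, by rintro _ ⟨y, rfl⟩; exact norm_nonneg _⟩ (⟨s, hs⟩ : S)

variable [MeasurableSpace E] [BorelSpace E]

/-- A Gaussian vector whose covariance vectors stay away from a subspace `S`, and whose increments
are close to `S`, has few sign changes with probability at least exponentially small in
`dim S`. -/
lemma le_stdGaussian_signChanges (S : Submodule ℝ E) {M : ℕ} (u : Fin (M + 1) → E)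
    {η p L C : ℝ} (h0 : 0 < η) (h1 : η ≤ 1) (hL : 0 ≤ L) (hLp : L < p) (hC : 0 < C)
    (hlow : ∀ i, ∀ s ∈ S, p ≤ ‖u i - s‖)
    (hup : ∀ i : Fin M, ∃ s ∈ S, ‖u i.castSucc - u i.succ - s‖ ^ 2 +
      η ^ 2 * ‖u i.castSucc - u i.succ‖ ^ 2 ≤ L ^ 2) :
    ENNReal.ofReal η ^ Module.finrank ℝ S *
      ENNReal.ofReal (1 - M * (L / (Real.pi * (p - L))) / C) ≤
      stdGaussian E {x | (signChanges fun i => inner ℝ x (u i) : ℝ) ≤ C} := by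
  set A : E → E := fun x => x - S.starProjection x + η • S.starProjection x with hA
  have hAsub : ∀ x y, A x - A y = A (x - y) := by
    intro x y; simp only [hA, map_sub, smul_sub]; abel
  have hlowA : ∀ i, p ≤ ‖A (u i)‖ := by
    intro i
    refine (hlow i _ (S.starProjection_apply_mem (u i))).trans ?_
    refine le_of_sq_le_sq ?_ (norm_nonneg _)
    rw [norm_contract_sq]
    have : 0 ≤ η ^ 2 * ‖S.starProjection (u i)‖ ^ 2 := by positivity
    linarith
  have hupA : ∀ i : Fin M, ‖A (u i.castSucc) - A (u i.succ)‖ ≤ L := by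
    intro i
    obtain ⟨s, hs, h⟩ := hup i
    refine le_of_sq_le_sq ?_ hL
    rw [hAsub, norm_contract_sq]
    refine le_trans (add_le_add ?_ ?_) h
    · exact pow_le_pow_left₀ (norm_nonneg _) (norm_sub_starProjection_le S _ hs) 2
    · have := S.norm_starProjection_apply_le (u i.castSucc - u i.succ)
      gcongr
  have hpi := Real.pi_pos
  have hmark := one_sub_le_measure_signChanges (P := stdGaussian E)
    (X := fun x i => inner ℝ x (A (u i))) (by fun_prop) (r := L / (Real.pi * (p - L)))
    (div_nonneg hL (mul_nonneg hpi.le (by linarith))) hC (fun i => by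
      have h2 := hupA i
      have h3 := hlowA i.castSucc
      refine (stdGaussian_mul_nonpos_le (by linarith)).trans (ENNReal.ofReal_le_ofReal ?_)
      have : 0 < p - L := by linarith
      gcongr)
  have hmA : Measurable A := by fun_prop
  have hset : MeasurableSet {x : E | (signChanges fun i => inner ℝ x (u i) : ℝ) ≤ C} :=
    measurableSet_le (measurable_signChanges.comp (by fun_prop)) measurable_const
  have hle := smul_map_contract_stdGaussian_le S h0 h1
    {x : E | (signChanges fun i => inner ℝ x (u i) : ℝ) ≤ C}
  refine le_trans ?_ hle
  rw [Measure.smul_apply, smul_eq_mul, Measure.map_apply hmA hset]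
  gcongr
  refine hmark.trans_eq ?_
  congr 1
  ext x
  change (signChanges (fun i => inner ℝ x (A (u i))) : ℝ) ≤ C ↔
    (signChanges (fun i => inner ℝ (A x) (u i)) : ℝ) ≤ C
  simp_rw [hA, inner_contract_left]

end GaussianSignChanges

section Transfer

variable {Ω : Type*} [MeasurableSpace Ω] {P : Measure Ω} {μ : Measure ℝ} {F : ℝ → Ω → ℝ}

lemma IsSGP.map_eq_map_stdGaussian [IsProbabilityMeasure P] [IsProbabilityMeasure μ]
    (hF : IsSGP P μ F) {E : Type*}
    [NormedAddCommGroup E] [InnerProductSpace ℝ E] [FiniteDimensional ℝ E]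
    [MeasurableSpace E] [BorelSpace E] {ι : Type*} [Fintype ι] (t : ι → ℝ) (w : ι → E)
    (hw : ∀ i j, inner ℝ (w i) (w j) = covKernel μ (t i - t j)) :
    P.map (fun ω i => F (t i) ω) = (stdGaussian E).map (fun x i => inner ℝ x (w i)) := by
  have hm : AEMeasurable (fun ω i => F (t i) ω) P :=
    aemeasurable_pi_lambda _ fun i => hF.aemeasurable _
  have hm' : Measurable (fun (x : E) i => inner ℝ x (w i)) := by fun_prop
  have := Measure.isProbabilityMeasure_map hm
  have := Measure.isProbabilityMeasure_map (μ := stdGaussian E) hm'.aemeasurable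
  refine ext_of_map_sum fun c => ?_
  have hsum : Measurable fun x : ι → ℝ => ∑ i, c i * x i := by fun_prop
  rw [AEMeasurable.map_map_of_aemeasurable hsum.aemeasurable hm, Measure.map_map hsum hm']
  change P.map (fun ω => ∑ i, c i * F (t i) ω) =
    (stdGaussian E).map (fun x => ∑ i, c i * inner ℝ x (w i))
  rw [hF.map_sum]
  have hm2 : Measurable fun x : E => ∑ i, c i * inner ℝ x (w i) := by fun_prop
  have := Measure.isProbabilityMeasure_map (μ := stdGaussian E) hm2.aemeasurable
  have hn : ‖∑ i, c i • w i‖ ^ 2 = ∑ i, ∑ j, c i * c j * covKernel μ (t i - t j) := by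
    rw [← real_inner_self_eq_norm_sq, sum_inner]
    simp_rw [inner_sum, real_inner_smul_left, real_inner_smul_right, hw, mul_assoc]
  refine Measure.ext_of_charFun ?_
  ext r
  rw [charFun_gaussianReal, charFun_apply_real, integral_map hm2.aemeasurable
    (Measurable.aestronglyMeasurable (by fun_prop))]
  have hin : ∀ x : E, (r : ℂ) * ((∑ i, c i * inner ℝ x (w i) : ℝ) : ℂ) * Complex.I =
      (inner ℝ x (r • ∑ i, c i • w i) : ℝ) * Complex.I := by
    intro x
    rw [real_inner_smul_right, inner_sum]
    simp_rw [real_inner_smul_right]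
    push_cast; ring
  simp_rw [hin]
  rw [← charFun_apply, charFun_stdGaussian, Real.coe_toNNReal _ (by rw [← hn]; positivity), ← hn, norm_smul, Real.norm_eq_abs,
    ← Complex.ofReal_pow (|r| * _), mul_pow, sq_abs]
  congr 1
  push_cast
  ring

lemma IsSGP.le_measure_signChanges [IsProbabilityMeasure P] [IsProbabilityMeasure μ]
    (hF : IsSGP P μ F) {H : Type*} [NormedAddCommGroup H] [InnerProductSpace ℝ H] {n M : ℕ}
    (t : Fin (M + 1) → ℝ) (w : Fin (M + 1) → H) (v : Fin n → H)
    (hw : ∀ i j, inner ℝ (w i) (w j) = covKernel μ (t i - t j))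
    {η p L C : ℝ} (h0 : 0 < η) (h1 : η ≤ 1) (hL : 0 ≤ L) (hLp : L < p) (hC : 0 < C)
    (hlow : ∀ i, ∀ s ∈ Submodule.span ℝ (Set.range v), p ≤ ‖w i - s‖)
    (hup : ∀ i : Fin M, ∃ s ∈ Submodule.span ℝ (Set.range v),
      ‖w i.castSucc - w i.succ - s‖ ^ 2 + η ^ 2 * ‖w i.castSucc - w i.succ‖ ^ 2 ≤ L ^ 2) :
    ENNReal.ofReal η ^ n * ENNReal.ofReal (1 - M * (L / (Real.pi * (p - L))) / C) ≤
      P {ω | (signChanges fun i => F (t i) ω : ℝ) ≤ C} := by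
  let E := Submodule.span ℝ (Set.range v ∪ Set.range w)
  have : FiniteDimensional ℝ E := FiniteDimensional.span_of_finite ℝ
    ((Set.finite_range v).union (Set.finite_range w))
  let : MeasurableSpace E := borel E
  have : BorelSpace E := ⟨rfl⟩
  let v' : Fin n → E := fun i => ⟨v i, Submodule.subset_span (Or.inl ⟨i, rfl⟩)⟩
  let w' : Fin (M + 1) → E := fun i => ⟨w i, Submodule.subset_span (Or.inr ⟨i, rfl⟩)⟩
  have hmap : (Submodule.span ℝ (Set.range v')).map E.subtype = Submodule.span ℝ (Set.range v) := by
    rw [Submodule.map_span, ← Set.range_comp]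
    rfl
  have hle := le_stdGaussian_signChanges (Submodule.span ℝ (Set.range v')) w' h0 h1 hL hLp hC
    (fun i s hs => hlow i s (by rw [← hmap]; exact Submodule.mem_map_of_mem hs))
    (fun i => by
      obtain ⟨s, hs, h⟩ := hup i
      rw [← hmap] at hs
      obtain ⟨s', hs', rfl⟩ := hs
      exact ⟨s', hs', h⟩)
  have hset : MeasurableSet {x : Fin (M + 1) → ℝ | (signChanges x : ℝ) ≤ C} :=
    measurableSet_le measurable_signChanges measurable_const
  have hlaw := congrArg (fun ν : Measure (Fin (M + 1) → ℝ) => ν {x | (signChanges x : ℝ) ≤ C})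
    (hF.map_eq_map_stdGaussian t w' hw)
  beta_reduce at hlaw
  rw [Measure.map_apply_of_aemeasurable (aemeasurable_pi_lambda _ fun i => hF.aemeasurable _) hset,
    Measure.map_apply (by fun_prop) hset] at hlaw
  refine le_trans ?_ (hle.trans_eq hlaw.symm)
  gcongr ?_ * _
  refine pow_le_pow_right_of_le_one' (ENNReal.ofReal_le_one.2 h1) ?_
  exact (finrank_range_le_card (R := ℝ) v').trans_eq (Fintype.card_fin n)

end Transfer

section SpectralSpace

/-- The character `l ↦ exp (i l t)`. -/
noncomputable def expChar (t l : ℝ) : ℂ := Complex.exp ((l * t : ℝ) * Complex.I)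

lemma continuous_expChar (t : ℝ) : Continuous (expChar t) := by
  unfold expChar; fun_prop

lemma norm_expChar (t l : ℝ) : ‖expChar t l‖ = 1 := Complex.norm_exp_ofReal_mul_I _

lemma inner_expChar (s t l : ℝ) : inner ℝ (expChar s l) (expChar t l) = Real.cos (l * (s - t)) := by
  have : inner ℝ (expChar s l) (expChar t l) =
      ((starRingEnd ℂ) (expChar s l) * expChar t l).re := by
    rw [Complex.inner, mul_comm]
  rw [this, expChar, expChar, ← Complex.exp_conj, ← Complex.exp_add]
  simp only [map_mul, Complex.conj_ofReal, Complex.conj_I]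
  rw [show ((l * s : ℝ) : ℂ) * -Complex.I + ((l * t : ℝ) : ℂ) * Complex.I =
    ((-(l * (s - t)) : ℝ) : ℂ) * Complex.I by push_cast; ring, Complex.exp_ofReal_mul_I_re,
    Real.cos_neg]

lemma hasDerivAt_expChar (l t : ℝ) :
    HasDerivAt (fun x => expChar x l) (l * Complex.I * expChar t l) t := by
  have h1 : HasDerivAt (fun x : ℝ => ((l * x : ℝ) : ℂ) * Complex.I) (l * Complex.I) t := by
    have := ((hasDerivAt_id t).const_mul l).ofReal_comp.mul_const Complex.I
    simpa using this
  simpa [expChar, mul_comm] using h1.cexp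

lemma norm_expChar_sub_le (l s t : ℝ) : ‖expChar t l - expChar s l‖ ≤ |l| * |t - s| := by
  refine convex_univ.norm_image_sub_le_of_norm_hasDerivWithin_le (f := fun x => expChar x l)
    (fun x _ => (hasDerivAt_expChar l x).hasDerivWithinAt) (fun x _ => ?_) trivial trivial
  simp [norm_expChar]

lemma norm_expChar_sub_sub_le {l s t τ r : ℝ} (hr : ∀ x ∈ Set.Icc s t, |x - τ| ≤ r)
    (hst : s ≤ t) :
    ‖expChar t l - expChar s l - (t - s : ℝ) • (l * Complex.I * expChar τ l)‖ ≤
      l ^ 2 * r * (t - s) := by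
  have h := (convex_Icc s t).norm_image_sub_le_of_norm_hasDerivWithin_le
    (f := fun x => expChar x l - x • (l * Complex.I * expChar τ l)) (C := l ^ 2 * r)
    (f' := fun x => l * Complex.I * expChar x l - (1 : ℝ) • (l * Complex.I * expChar τ l))
    (fun x _ => ((hasDerivAt_expChar l x).sub
      ((hasDerivAt_id x).smul_const _)).hasDerivWithinAt) (fun x hx => ?_)
    (Set.left_mem_Icc.2 hst) (Set.right_mem_Icc.2 hst)
  · rw [Real.norm_eq_abs, abs_of_nonneg (sub_nonneg.2 hst)] at h
    refine le_trans (le_of_eq ?_) h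
    congr 1
    rw [sub_smul]; abel
  · rw [one_smul, ← mul_sub, norm_mul, norm_mul, Complex.norm_I, mul_one, Complex.norm_real,
      Real.norm_eq_abs, ← sq_abs l, sq, mul_assoc]
    gcongr
    exact (norm_expChar_sub_le l τ x).trans (by gcongr; exact hr x hx)

variable (μ : Measure ℝ)

lemma norm_sq_eq_integral (f : Lp ℂ 2 μ) : ‖f‖ ^ 2 = ∫ l, ‖f l‖ ^ 2 ∂μ := by
  rw [← real_inner_self_eq_norm_sq, L2.inner_def]
  simp_rw [real_inner_self_eq_norm_sq]

lemma integrable_norm_sq (f : Lp ℂ 2 μ) : Integrable (fun l => ‖f l‖ ^ 2) μ :=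
  (Lp.memLp f).integrable_norm_pow two_ne_zero

variable [IsFiniteMeasure μ]

lemma memLp_expChar (t : ℝ) : MemLp (expChar t) 2 μ :=
  MemLp.of_bound (continuous_expChar t).aestronglyMeasurable 1
    (Filter.Eventually.of_forall fun l => (norm_expChar t l).le)

/-- The derivative in `t` of `exp (i l t)`, cut off to the frequencies `b < |l| ≤ Λ`. -/
noncomputable def highFreqDeriv (b Λ t : ℝ) : ℝ → ℂ :=
  {l : ℝ | b < |l| ∧ |l| ≤ Λ}.indicator fun l => l * Complex.I * expChar t l

lemma memLp_highFreqDeriv (b Λ t : ℝ) : MemLp (highFreqDeriv b Λ t) 2 μ := by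
  have hs : MeasurableSet {l : ℝ | b < |l| ∧ |l| ≤ Λ} :=
    (measurableSet_lt measurable_const continuous_abs.measurable).inter
      (measurableSet_le continuous_abs.measurable measurable_const)
  have hc : Continuous fun l : ℝ => l * Complex.I * expChar t l :=
    (Complex.continuous_ofReal.mul continuous_const).mul (continuous_expChar t)
  refine MemLp.of_bound (hc.aestronglyMeasurable.indicator hs) |Λ|
    (Filter.Eventually.of_forall fun l => ?_)
  rw [highFreqDeriv, Set.indicator_apply]
  split_ifs with h
  · simpa [norm_expChar] using h.2.trans (le_abs_self Λ)
  · simp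

lemma inner_toLp_expChar (s t : ℝ) :
    inner ℝ ((memLp_expChar μ s).toLp _) ((memLp_expChar μ t).toLp _) = covKernel μ (s - t) := by
  rw [L2.inner_def, covKernel]
  refine integral_congr_ae ?_
  filter_upwards [(memLp_expChar μ s).coeFn_toLp, (memLp_expChar μ t).coeFn_toLp] with l h1 h2
  rw [h1, h2, inner_expChar]

variable {μ}

lemma ae_eq_zero_of_mem_span {n : ℕ} {b Λ : ℝ} {τ : Fin n → ℝ} {f : Lp ℂ 2 μ}
    (hf : f ∈ Submodule.span ℝ (Set.range fun j => (memLp_highFreqDeriv μ b Λ (τ j)).toLp _)) :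
    ∀ᵐ l ∂μ, |l| ≤ b → f l = 0 := by
  induction hf using Submodule.span_induction with
  | mem x hx =>
    obtain ⟨j, rfl⟩ := hx
    filter_upwards [(memLp_highFreqDeriv μ b Λ (τ j)).coeFn_toLp] with l h hl
    rw [h, highFreqDeriv, Set.indicator_of_notMem fun h => absurd h.1 (not_lt.2 hl)]
  | zero => filter_upwards [Lp.coeFn_zero ℂ 2 μ] with l h _ using h
  | add x y _ _ hx hy =>
    filter_upwards [hx, hy, Lp.coeFn_add x y] with l h1 h2 h3 hl
    rw [h3, Pi.add_apply, h1 hl, h2 hl, add_zero]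
  | smul a x _ hx =>
    filter_upwards [hx, Lp.coeFn_smul a x] with l h1 h2 hl
    rw [h2, Pi.smul_apply, h1 hl, smul_zero]

lemma measureReal_le_norm_sub_sq {n : ℕ} {b Λ : ℝ} {τ : Fin n → ℝ} (t : ℝ) {f : Lp ℂ 2 μ}
    (hf : f ∈ Submodule.span ℝ (Set.range fun j => (memLp_highFreqDeriv μ b Λ (τ j)).toLp _)) :
    μ.real {l | |l| ≤ b} ≤ ‖(memLp_expChar μ t).toLp _ - f‖ ^ 2 := by
  have hs : MeasurableSet {l : ℝ | |l| ≤ b} := measurableSet_le (by fun_prop) measurable_const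
  rw [norm_sq_eq_integral, ← integral_indicator_one hs]
  refine integral_mono_ae ((integrable_const (1 : ℝ)).indicator hs) (integrable_norm_sq μ _) ?_
  filter_upwards [ae_eq_zero_of_mem_span hf, Lp.coeFn_sub ((memLp_expChar μ t).toLp _) f,
    (memLp_expChar μ t).coeFn_toLp] with l h1 h2 h3
  rw [Set.indicator_apply]
  split_ifs with h
  · rw [h2, Pi.sub_apply, h3, h1 h, sub_zero, norm_expChar]; simp
  · positivity

lemma norm_toLp_expChar_sub_sq_le [IsProbabilityMeasure μ] {Λ : ℝ} (hΛ : ∀ᵐ l ∂μ, |l| ≤ Λ)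
    (s t : ℝ) :
    ‖(memLp_expChar μ t).toLp _ - (memLp_expChar μ s).toLp _‖ ^ 2 ≤ Λ ^ 2 * (t - s) ^ 2 := by
  rw [norm_sq_eq_integral]
  refine (integral_mono_ae (integrable_norm_sq μ _)
    (integrable_const (Λ ^ 2 * (t - s) ^ 2)) ?_).trans_eq (by simp)
  filter_upwards [hΛ, (memLp_expChar μ t).coeFn_toLp, (memLp_expChar μ s).coeFn_toLp,
    Lp.coeFn_sub ((memLp_expChar μ t).toLp _) ((memLp_expChar μ s).toLp _)] with l hl h1 h2 h3
  rw [h3, Pi.sub_apply, h1, h2, ← mul_pow, ← sq_abs (Λ * _), abs_mul]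
  refine pow_le_pow_left₀ (norm_nonneg _) ((norm_expChar_sub_le l s t).trans ?_) 2
  exact mul_le_mul_of_nonneg_right (hl.trans (le_abs_self _)) (abs_nonneg _)

lemma norm_increment_sub_highFreqDeriv_sq_le [IsProbabilityMeasure μ] {b Λ r s t τ : ℝ}
    (hΛ : ∀ᵐ l ∂μ, |l| ≤ Λ) (hr : ∀ x ∈ Set.Icc s t, |x - τ| ≤ r) (hst : s ≤ t) :
    ‖(memLp_expChar μ t).toLp _ - (memLp_expChar μ s).toLp _ -
      (t - s) • (memLp_highFreqDeriv μ b Λ τ).toLp _‖ ^ 2 ≤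
      (t - s) ^ 2 * (b ^ 2 * μ.real {l | |l| ≤ b} + (Λ ^ 2 * r) ^ 2) := by
  have hs : MeasurableSet {l : ℝ | |l| ≤ b} := measurableSet_le (by fun_prop) measurable_const
  have hr0 : 0 ≤ r := (abs_nonneg _).trans (hr s (Set.left_mem_Icc.2 hst))
  rw [norm_sq_eq_integral]
  have hint : Integrable (fun l => (t - s) ^ 2 *
      ({l : ℝ | |l| ≤ b}.indicator (fun _ => b ^ 2) l + (Λ ^ 2 * r) ^ 2)) μ :=
    (((integrable_const _).indicator hs).add (integrable_const _)).const_mul _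
  refine (integral_mono_ae (integrable_norm_sq μ _) hint ?_).trans_eq ?_
  · filter_upwards [hΛ, (memLp_expChar μ t).coeFn_toLp, (memLp_expChar μ s).coeFn_toLp,
      (memLp_highFreqDeriv μ b Λ τ).coeFn_toLp,
      Lp.coeFn_sub ((memLp_expChar μ t).toLp _) ((memLp_expChar μ s).toLp _),
      Lp.coeFn_smul (t - s) ((memLp_highFreqDeriv μ b Λ τ).toLp _),
      Lp.coeFn_sub ((memLp_expChar μ t).toLp _ - (memLp_expChar μ s).toLp _)
        ((t - s) • (memLp_highFreqDeriv μ b Λ τ).toLp _)] with l hl h1 h2 h3 h4 h5 h6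
    rw [h6, Pi.sub_apply, h4, Pi.sub_apply, h5, Pi.smul_apply, h1, h2, h3, highFreqDeriv,
      Set.indicator_apply, Set.indicator_apply]
    by_cases hlb : |l| ≤ b
    · rw [if_neg fun h => absurd h.1 (not_lt.2 hlb), smul_zero, sub_zero,
        if_pos (show l ∈ {l : ℝ | |l| ≤ b} from hlb)]
      have h7 := norm_expChar_sub_le l s t
      have h8 : ‖expChar t l - expChar s l‖ ^ 2 ≤ (b * (t - s)) ^ 2 := by
        refine pow_le_pow_left₀ (norm_nonneg _) (h7.trans ?_) 2
        rw [abs_of_nonneg (sub_nonneg.2 hst)]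
        exact mul_le_mul_of_nonneg_right hlb (sub_nonneg.2 hst)
      nlinarith [sq_nonneg ((t - s) * (Λ ^ 2 * r))]
    · rw [if_pos ⟨not_le.1 hlb, hl⟩, if_neg (show l ∉ {l : ℝ | |l| ≤ b} from hlb), zero_add, ← mul_pow]
      refine pow_le_pow_left₀ (norm_nonneg _) ((norm_expChar_sub_sub_le hr hst).trans ?_) 2
      have h9 : l ^ 2 ≤ Λ ^ 2 := sq_le_sq' (by linarith [neg_abs_le l]) ((le_abs_self l).trans hl)
      rw [mul_comm (t - s)]
      have := sub_nonneg.2 hst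
      gcongr
  · rw [integral_const_mul, integral_add ((integrable_const _).indicator hs) (integrable_const _),
      integral_indicator_const _ hs]
    simp [mul_comm]

end SpectralSpace

section ZeroCount

lemma le_measure_frequently {Ω : Type*} [MeasurableSpace Ω] {P : Measure Ω} [IsFiniteMeasure P]
    {G : ℕ → Set Ω} (hG : ∀ n, NullMeasurableSet (G n) P) {a : ℝ≥0∞}
    (ha : ∀ᶠ n in Filter.atTop, a ≤ P (G n)) :
    a ≤ P {ω | ∃ᶠ n in Filter.atTop, ω ∈ G n} := by
  have hset : {ω | ∃ᶠ n in Filter.atTop, ω ∈ G n} = ⋂ N, ⋃ n, ⋃ (_ : N ≤ n), G n := by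
    ext ω
    simp [Filter.frequently_atTop]
  rw [hset]
  refine ge_of_tendsto (tendsto_measure_iInter_atTop (μ := P)
    (fun N => NullMeasurableSet.iUnion fun n => NullMeasurableSet.iUnion fun _ => hG n) ?_
    ⟨0, measure_ne_top _ _⟩) ?_
  · intro N N' hN
    exact iUnion_mono fun n => iUnion_subset fun h => subset_iUnion_of_subset (hN.trans h) le_rfl
  · obtain ⟨N₀, h₀⟩ := Filter.eventually_atTop.1 ha
    filter_upwards with N
    refine (h₀ (max N N₀) (le_max_right _ _)).trans (measure_mono ?_)
    exact subset_iUnion_of_subset _ (subset_iUnion_of_subset (le_max_left N N₀) le_rfl)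

variable {Ω : Type*} [MeasurableSpace Ω] {P : Measure Ω} [IsProbabilityMeasure P]
  {μ : Measure ℝ} [IsProbabilityMeasure μ] {F : ℝ → Ω → ℝ}

/-- On a grid of mesh `T / M ≤ r`, conditioning on smallness of the high-frequency derivative at
the multiples of `r` bounds the number of sign changes. -/
lemma IsSGP.le_measure_signChanges_gridPoint (hF : IsSGP P μ F) {b Λ p η r D T C : ℝ} {M : ℕ}
    (hΛ : ∀ᵐ l ∂μ, |l| ≤ Λ) (hp : 0 < p) (hμ : μ.real {l | |l| ≤ b} = p ^ 2)
    (h0 : 0 < η) (h1 : η ≤ 1) (hr : 0 < r) (hD : 0 ≤ D)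
    (hbound : b ^ 2 * p ^ 2 + (Λ ^ 2 * (2 * r)) ^ 2 + η ^ 2 * Λ ^ 2 ≤ (p * D) ^ 2)
    (hT : 0 < T) (hM : 0 < M) (hMr : T / M ≤ r) (hMD : T / M * D < 1) (hC : 0 < C) :
    ENNReal.ofReal η ^ (⌊T / r⌋₊ + 1) *
        ENNReal.ofReal (1 - M * (T / M * (p * D) / (Real.pi * (p - T / M * (p * D)))) / C) ≤
      P {ω | (signChanges fun i => F (gridPoint T M i) ω : ℝ) ≤ C} := by
  have hM' : (0 : ℝ) < M := Nat.cast_pos.2 hM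
  have hh : 0 ≤ T / M := by positivity
  refine hF.le_measure_signChanges (gridPoint T M)
    (fun i => (memLp_expChar μ (gridPoint T M i)).toLp _)
    (fun j : Fin (⌊T / r⌋₊ + 1) => (memLp_highFreqDeriv μ b Λ (j * r)).toLp _)
    (fun i j => inner_toLp_expChar μ _ _) h0 h1 (by positivity) ?_ hC ?_ ?_
  · nlinarith
  · intro i s hs
    refine (sq_le_sq₀ hp.le (norm_nonneg _)).1 ?_
    rw [← hμ]
    exact measureReal_le_norm_sub_sq _ hs
  · intro i
    have hstep : gridPoint T M i.succ - gridPoint T M i.castSucc = T / M := by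
      simp only [gridPoint, Fin.val_succ, Fin.val_castSucc]
      push_cast; ring
    have hs0 : 0 ≤ gridPoint T M i.castSucc := by unfold gridPoint; positivity
    have hsT : gridPoint T M i.castSucc ≤ T := by
      have hi : ((i.castSucc : ℕ) : ℝ) ≤ M := Nat.cast_le.2 (by simp [i.2.le])
      rw [gridPoint, div_le_iff₀ hM', mul_comm]
      gcongr
    set s := gridPoint T M i.castSucc with hs
    set t := gridPoint T M i.succ with ht
    let j : Fin (⌊T / r⌋₊ + 1) :=
      ⟨⌊s / r⌋₊, Nat.lt_succ_of_le (Nat.floor_mono (by gcongr))⟩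
    have hj1 : (j : ℝ) * r ≤ s := by
      have := Nat.floor_le (div_nonneg hs0 hr.le)
      rwa [le_div_iff₀ hr] at this
    have hj2 : s ≤ (j : ℝ) * r + r := by
      have := (Nat.lt_floor_add_one (s / r)).le
      rw [div_le_iff₀ hr] at this
      simpa [j, add_mul] using this
    have hmain := norm_increment_sub_highFreqDeriv_sq_le (b := b) (τ := j * r) (r := 2 * r) hΛ
      (s := s) (t := t)
      (fun x hx => abs_le.2 ⟨by linarith [hx.1], by linarith [hx.2]⟩) (by linarith)
    have hinc := norm_toLp_expChar_sub_sq_le hΛ s t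
    refine ⟨-((t - s) • (memLp_highFreqDeriv μ b Λ (j * r)).toLp _),
      Submodule.neg_mem _ (Submodule.smul_mem _ _ (Submodule.subset_span ⟨j, rfl⟩)), ?_⟩
    rw [← norm_neg, ← norm_sub_rev ((memLp_expChar μ t).toLp _)]
    rw [show -((memLp_expChar μ s).toLp _ - (memLp_expChar μ t).toLp _ -
      -((t - s) • (memLp_highFreqDeriv μ b Λ (j * r)).toLp _)) =
      (memLp_expChar μ t).toLp _ - (memLp_expChar μ s).toLp _ -
      (t - s) • (memLp_highFreqDeriv μ b Λ (j * r)).toLp _ by abel]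
    rw [hμ] at hmain
    rw [hstep] at hmain hinc ⊢
    calc _ ≤ (T / M) ^ 2 * (b ^ 2 * p ^ 2 + (Λ ^ 2 * (2 * r)) ^ 2) +
          η ^ 2 * (Λ ^ 2 * (T / M) ^ 2) := by gcongr
      _ = (T / M) ^ 2 *
          (b ^ 2 * p ^ 2 + (Λ ^ 2 * (2 * r)) ^ 2 + η ^ 2 * Λ ^ 2) := by ring
      _ ≤ (T / M) ^ 2 * (p * D) ^ 2 := by gcongr
      _ = _ := by ring

lemma IsSGP.le_measure_zeroCount (hF : IsSGP P μ F) {b Λ p η r D T C q : ℝ}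
    (hΛ : ∀ᵐ l ∂μ, |l| ≤ Λ) (hp : 0 < p) (hμ : μ.real {l | |l| ≤ b} = p ^ 2)
    (h0 : 0 < η) (h1 : η ≤ 1) (hr : 0 < r) (hD : 0 ≤ D)
    (hbound : b ^ 2 * p ^ 2 + (Λ ^ 2 * (2 * r)) ^ 2 + η ^ 2 * Λ ^ 2 ≤ (p * D) ^ 2)
    (hT : 0 < T) (hC : 0 < C) (hq : T * D / Real.pi / C < 1 - q) :
    ENNReal.ofReal η ^ (⌊T / r⌋₊ + 1) * ENNReal.ofReal q ≤
      P {ω | ∃ n : ℕ, zeroCount F T ω = n ∧ (n : ℝ) ≤ C} := by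
  have hmesh : Filter.Tendsto (fun M : ℕ => T / (M : ℝ)) Filter.atTop (nhds 0) :=
    tendsto_const_div_atTop_nhds_zero_nat T
  have hlim : Filter.Tendsto (fun M : ℕ => T * D / (Real.pi * (1 - T / M * D)) / C)
      Filter.atTop (nhds (T * D / Real.pi / C)) := by
    have h : Filter.Tendsto (fun M : ℕ => Real.pi * (1 - T / M * D)) Filter.atTop
        (nhds Real.pi) := by
      simpa using (((hmesh.mul_const D).const_sub 1).const_mul Real.pi)
    exact (tendsto_const_nhds.div h Real.pi_ne_zero).div_const C
  have hev : ∀ᶠ M : ℕ in Filter.atTop, ENNReal.ofReal η ^ (⌊T / r⌋₊ + 1) * ENNReal.ofReal q ≤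
      P {ω | (signChanges fun i => F (gridPoint T M i) ω : ℝ) ≤ C} := by
    have hmeshD : ∀ᶠ M : ℕ in Filter.atTop, T / (M : ℝ) * D < 1 := by
      have := hmesh.mul_const D
      rw [zero_mul] at this
      exact this.eventually_lt_const one_pos
    filter_upwards [hlim.eventually_lt_const hq, hmesh.eventually_le_const hr, hmeshD,
      Filter.eventually_gt_atTop 0] with M hM1 hM2 hM3 hM4
    refine le_trans ?_ (hF.le_measure_signChanges_gridPoint hΛ hp hμ h0 h1 hr hD hbound hT hM4 hM2
      hM3 hC)
    gcongr
    have hM' : (M : ℝ) ≠ 0 := Nat.cast_ne_zero.2 hM4.ne'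
    have heq : M * (T / M * (p * D) / (Real.pi * (p - T / M * (p * D)))) =
        T * D / (Real.pi * (1 - T / M * D)) := by
      have h2 : p - T / M * (p * D) = p * (1 - T / M * D) := by ring
      have h3 : (1 - T / M * D) ≠ 0 := (sub_pos.2 hM3).ne'
      rw [h2]
      generalize 1 - T / M * D = z at h3
      have := Real.pi_ne_zero
      field_simp
    rw [heq]
    linarith
  have hnull : ∀ M : ℕ, NullMeasurableSet
      {ω | (signChanges fun i => F (gridPoint T M i) ω : ℝ) ≤ C} P := fun M =>
    nullMeasurableSet_le (measurable_signChanges.comp_aemeasurable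
      (aemeasurable_pi_lambda _ fun i => hF.aemeasurable _)) aemeasurable_const
  refine (le_measure_frequently hnull hev).trans (measure_mono_ae ?_)
  filter_upwards [hF.ae_crossesAt, hF.ae_ne_zero 0, hF.ae_ne_zero T] with ω hω1 hω2 hω3 hω4
  exact exists_encard_zeros_le (hF.1 ω) hT hω2 hω3 (fun z _ hz => hω1 z hz) hω4

end ZeroCount

section Support

variable {μ : Measure ℝ}

lemma msupport_eq_support (μ : Measure ℝ) : msupport μ = μ.support := by
  ext x
  rw [Measure.mem_support_iff_forall]
  rfl

lemma exists_ae_abs_le_of_isBounded_msupport (h : Bornology.IsBounded (msupport μ)) :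
    ∃ Λ : ℝ, 1 ≤ Λ ∧ ∀ᵐ l ∂μ, |l| ≤ Λ := by
  obtain ⟨R, hR⟩ := isBounded_iff_forall_norm_le.1 h
  rw [msupport_eq_support] at hR
  refine ⟨max R 1, le_max_right _ _, ?_⟩
  filter_upwards [Measure.support_mem_ae (μ := μ)] with l hl
  exact (hR l hl).trans (le_max_left _ _)

lemma sInf_abs_msupport_nonneg (μ : Measure ℝ) : 0 ≤ sInf ((fun x : ℝ => |x|) '' msupport μ) :=
  Real.sInf_nonneg (by rintro _ ⟨x, _, rfl⟩; exact abs_nonneg x)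

lemma measure_abs_le_pos [NeZero μ] {b : ℝ}
    (hb : sInf ((fun x : ℝ => |x|) '' msupport μ) < b) : 0 < μ {l | |l| ≤ b} := by
  have hne : (msupport μ).Nonempty := by
    rw [msupport_eq_support]
    exact Measure.nonempty_support (NeZero.ne μ)
  obtain ⟨_, ⟨x, hx, rfl⟩, hxb⟩ := exists_lt_of_csInf_lt (hne.image _) hb
  refine hx _ (Filter.mem_of_superset ((isOpen_lt continuous_abs continuous_const).mem_nhds hxb) ?_)
  exact fun l (hl : |l| < b) => hl.le

end Support

lemma exp_neg_mul_le_pow_mul {η r q T : ℝ} (h0 : 0 < η) (h1 : η ≤ 1) (hr : 0 < r) (hq0 : 0 < q)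
    (hq1 : q ≤ 1) (hT : 1 ≤ T) :
    Real.exp (-((1 / r + 1) * -Real.log η - Real.log q + 1) * T) ≤ η ^ (⌊T / r⌋₊ + 1) * q := by
  have hη := Real.log_nonpos h0.le h1
  have hq := Real.log_nonpos hq0.le hq1
  have hfl : (⌊T / r⌋₊ : ℝ) ≤ T / r := Nat.floor_le (by positivity)
  have hn : ((⌊T / r⌋₊ + 1 : ℕ) : ℝ) ≤ (1 / r + 1) * T := by
    push_cast
    rw [add_mul, one_div_mul_eq_div]
    linarith
  rw [← Real.exp_log (mul_pos (pow_pos h0 _) hq0), Real.log_mul (pow_pos h0 _).ne' hq0.ne',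
    Real.log_pow]
  refine Real.exp_le_exp.2 ?_
  nlinarith [mul_le_mul_of_nonneg_right hn (neg_nonneg.2 hη),
    mul_nonneg (neg_nonneg.2 hq) (sub_nonneg.2 hT)]

theorem undercrowding_lower
    {Ω : Type*} [MeasurableSpace Ω] (P : Measure Ω) [IsProbabilityMeasure P]
    (μ : Measure ℝ) [IsProbabilityMeasure μ]
    (hsymm : μ.map (fun x => -x) = μ)
    (hcpt : Bornology.IsBounded (msupport μ))
    (hac : MeasureTheory.volume.withDensity (μ.rnDeriv MeasureTheory.volume) ≠ 0)
    (B : ℝ) (hB : B = sInf ((fun x : ℝ => abs x) '' msupport μ))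
    (F : ℝ → Ω → ℝ) (hF : IsSGP P μ F) :
    ∀ ε > (0:ℝ), ∃ c > (0:ℝ), ∀ T ≥ (1:ℝ),
      ENNReal.ofReal (Real.exp (-c * T)) ≤
        P {ω | ∃ n : ℕ, zeroCount F T ω = n ∧ (n : ℝ) ≤ B / Real.pi * T + ε * T} := by
  intro ε hε
  have hπ := Real.pi_pos
  obtain ⟨Λ, hΛ1, hΛ⟩ := exists_ae_abs_le_of_isBounded_msupport hcpt
  have hB0 : 0 ≤ B := hB ▸ sInf_abs_msupport_nonneg μ
  obtain ⟨δ, hδ0, hδ⟩ : ∃ δ : ℝ, 0 < δ ∧ Real.pi * ε = 4 * δ :=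
    ⟨Real.pi * ε / 4, by positivity, by ring⟩
  have hpos : 0 < μ.real {l | |l| ≤ B + δ} :=
    ENNReal.toReal_pos (measure_abs_le_pos (by rw [← hB]; linarith)).ne' (measure_ne_top _ _)
  obtain ⟨p, hp, hμ⟩ : ∃ p : ℝ, 0 < p ∧ μ.real {l | |l| ≤ B + δ} = p ^ 2 :=
    ⟨_, Real.sqrt_pos.2 hpos, (Real.sq_sqrt hpos.le).symm⟩
  have hΛ0 : 0 < Λ := by linarith
  set η := min 1 (p * δ / (2 * Λ)) with hη
  set r := p * δ / (4 * Λ ^ 2) with hr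
  have hη0 : 0 < η := lt_min one_pos (by positivity)
  have hr0 : 0 < r := by positivity
  have hη1 : η ≤ 1 := min_le_left _ _
  have hηΛ : η * Λ ≤ p * δ / 2 := by
    calc η * Λ ≤ p * δ / (2 * Λ) * Λ := by gcongr; exact min_le_right _ _
      _ = p * δ / 2 := by field_simp
  have hrΛ : Λ ^ 2 * (2 * r) = p * δ / 2 := by rw [hr]; field_simp; norm_num
  have hbound : (B + δ) ^ 2 * p ^ 2 + (Λ ^ 2 * (2 * r)) ^ 2 + η ^ 2 * Λ ^ 2 ≤
      (p * (B + 2 * δ)) ^ 2 := by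
    rw [hrΛ, ← mul_pow η]
    have h1 : (η * Λ) ^ 2 ≤ (p * δ / 2) ^ 2 := by gcongr
    have h2 : 0 ≤ p ^ 2 * (B * δ) := by positivity
    have h3 : 0 ≤ p ^ 2 * δ ^ 2 := by positivity
    nlinarith
  set q := δ / (B + 4 * δ) with hq
  have hq0 : 0 < q := by positivity
  have hq1 : q ≤ 1 := by rw [hq, div_le_one (by positivity)]; linarith
  refine ⟨(1 / r + 1) * -Real.log η - Real.log q + 1, ?_, fun T hT => ?_⟩
  · have h1 := Real.log_nonpos hη0.le hη1
    have h2 := Real.log_nonpos hq0.le hq1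
    have h3 : 0 ≤ (1 / r + 1) * -Real.log η := mul_nonneg (by positivity) (by linarith)
    linarith
  have hT0 : 0 < T := by linarith
  have hC : B / Real.pi * T + ε * T = T * (B + 4 * δ) / Real.pi := by
    rw [← hδ]; field_simp
  rw [hC]
  refine le_trans ?_ (hF.le_measure_zeroCount (q := q) hΛ hp hμ hη0 hη1 hr0 (by positivity) hbound
    hT0 (by positivity) ?_)
  · rw [← ENNReal.ofReal_pow hη0.le, ← ENNReal.ofReal_mul (by positivity)]
    exact ENNReal.ofReal_le_ofReal (exp_neg_mul_le_pow_mul hη0 hη1 hr0 hq0 hq1 hT)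
  · have h1 : T * (B + 2 * δ) / Real.pi / (T * (B + 4 * δ) / Real.pi) =
        (B + 2 * δ) / (B + 4 * δ) := by field_simp
    have h2 : 1 - q = (B + 3 * δ) / (B + 4 * δ) := by rw [hq]; field_simp; ring
    rw [h1, h2]
    gcongr
    norm_num
end

section
/- Let μ be a symmetric Borel probability measure on ℝ with ∫_ℝ λ²·(log|λ|)² dμ(λ) < ∞ (the integrand taken to be 0 at λ = 0), and suppose μ([X−ε, X+ε]) > 0 for some X ∈ (0,∞) and ε > 0. Let F be a continuous centered stationary Gaussian process with spectral measure μ. Then there exist c > 0 and T₀ > 0 such that for all T ≥ T₀, P( (X−2ε)/π ≤ N_F(T)/T ≤ (X+2ε)/π ) ≥ exp(−c·T). -/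
open MeasureTheory ProbabilityTheory Set ENNReal NNReal

theorem gaussianReal_shift_add_shift_ge (s : ℝ) {C : Set ℝ} (hC : MeasurableSet C) :
    2 * ENNReal.ofReal (Real.exp (-(s ^ 2 / 2))) * gaussianReal 0 1 C ≤
      gaussianReal 0 1 {z | z - s ∈ C} + gaussianReal 0 1 {z | z + s ∈ C} := by
  have h1 : gaussianReal 0 1 {z | z - s ∈ C} = gaussianReal (-s) 1 C := by
    have h := gaussianReal_map_sub_const (μ := 0) (v := 1) s
    rw [zero_sub] at h
    rw [← h, Measure.map_apply (by fun_prop) hC]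
    rfl
  have h2 : gaussianReal 0 1 {z | z + s ∈ C} = gaussianReal s 1 C := by
    have h := gaussianReal_map_add_const (μ := 0) (v := 1) s
    rw [zero_add] at h
    rw [← h, Measure.map_apply (by fun_prop) hC]
    rfl
  rw [h1, h2, gaussianReal_apply _ one_ne_zero, gaussianReal_apply _ one_ne_zero,
    gaussianReal_apply _ one_ne_zero, ← lintegral_const_mul _ (measurable_gaussianPDF 0 1),
    ← lintegral_add_left (measurable_gaussianPDF _ 1)]
  refine lintegral_mono fun x => ?_
  simp only [gaussianPDF]
  have h2 : (2 : ℝ≥0∞) = ENNReal.ofReal 2 := by simp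
  rw [h2, ← ENNReal.ofReal_mul (by norm_num), ← ENNReal.ofReal_mul (by positivity),
    ← ENNReal.ofReal_add (gaussianPDFReal_nonneg _ _ _) (gaussianPDFReal_nonneg _ _ _)]
  refine ENNReal.ofReal_le_ofReal ?_
  simp only [gaussianPDFReal, NNReal.coe_one, mul_one]
  have hc : 0 ≤ (√(2 * Real.pi))⁻¹ := by positivity
  have e1 : Real.exp (-(x - -s) ^ 2 / 2) =
      Real.exp (-(s ^ 2 / 2)) * Real.exp (-(x - 0) ^ 2 / 2) * Real.exp (-(x * s)) := by
    rw [← Real.exp_add, ← Real.exp_add]; congr 1; ring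
  have e2 : Real.exp (-(x - s) ^ 2 / 2) =
      Real.exp (-(s ^ 2 / 2)) * Real.exp (-(x - 0) ^ 2 / 2) * Real.exp (x * s) := by
    rw [← Real.exp_add, ← Real.exp_add]; congr 1; ring
  rw [e1, e2]
  have h3 := Real.add_one_le_exp (x * s)
  have h4 := Real.add_one_le_exp (-(x * s))
  have h5 : 0 ≤ (√(2 * Real.pi))⁻¹ * (Real.exp (-(s ^ 2 / 2)) * Real.exp (-(x - 0) ^ 2 / 2)) := by
    positivity
  nlinarith [mul_le_mul_of_nonneg_left (by linarith :
    2 ≤ Real.exp (x * s) + Real.exp (-(x * s))) h5]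

section Gaussian

variable {ι : Type*} [Fintype ι] [DecidableEq ι]

open Matrix in
theorem charFun_multivariateGaussian_zero {S : Matrix ι ι ℝ} (hS : S.PosSemidef)
    (x : EuclideanSpace ℝ ι) :
    charFun (multivariateGaussian 0 S) x = Complex.exp (-((x ⬝ᵥ S *ᵥ x : ℝ) : ℂ) / 2) := by
  rw [charFun_multivariateGaussian hS]
  congr 1
  simp
  ring

open Matrix in
theorem multivariateGaussian_neg {S : Matrix ι ι ℝ} (hS : S.PosSemidef) :
    (multivariateGaussian 0 S).map (fun x => -x) = multivariateGaussian 0 S := by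
  refine Measure.ext_of_charFun ?_
  ext x
  have h := charFun_map_smul (μ := multivariateGaussian 0 S) (-1) x
  simp only [neg_smul, one_smul] at h
  rw [h, charFun_multivariateGaussian_zero hS, charFun_multivariateGaussian_zero hS]
  simp [Matrix.mulVec_neg]

theorem multivariateGaussian_conv_self {S : Matrix ι ι ℝ} (hS : S.PosSemidef) :
    (multivariateGaussian 0 S).conv (multivariateGaussian 0 S) =
      (multivariateGaussian 0 S).map (fun x => √2 • x) := by
  refine Measure.ext_of_charFun ?_
  ext x
  rw [charFun_conv, charFun_map_smul, charFun_multivariateGaussian_zero hS,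
    charFun_multivariateGaussian_zero hS, ← Complex.exp_add]
  congr 1
  simp only [WithLp.ofLp_smul, Matrix.mulVec_smul, smul_dotProduct, dotProduct_smul, smul_eq_mul,
    ← mul_assoc, Real.mul_self_sqrt zero_le_two]
  push_cast
  ring

theorem multivariateGaussian_prod_sub {S : Matrix ι ι ℝ} (hS : S.PosSemidef) :
    ((multivariateGaussian 0 S).prod (multivariateGaussian 0 S)).map (fun p => p.1 - p.2) =
      (multivariateGaussian 0 S).map (fun x => √2 • x) := by
  have key : (multivariateGaussian 0 S).conv ((multivariateGaussian 0 S).map (fun x => -x)) =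
      ((multivariateGaussian 0 S).prod (multivariateGaussian 0 S)).map (fun p => p.1 - p.2) := by
    rw [Measure.conv]
    nth_rewrite 1 [← Measure.map_id (μ := multivariateGaussian 0 S)]
    rw [Measure.map_prod_map _ _ measurable_id measurable_neg,
      Measure.map_map (by fun_prop) (by fun_prop)]
    simp [Function.comp_def, sub_eq_add_neg]
  rw [← key, multivariateGaussian_neg hS, multivariateGaussian_conv_self hS]

open Matrix in
theorem multivariateGaussian_eq_conv {S : Matrix ι ι ℝ} (hS : S.PosSemidef)
    {h : EuclideanSpace ℝ ι} {s : ℝ} (hs : 0 < s)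
    (hS' : (S - (s ^ 2)⁻¹ • vecMulVec h h).PosSemidef) :
    multivariateGaussian 0 S =
      ((multivariateGaussian 0 (S - (s ^ 2)⁻¹ • vecMulVec h h)).prod (gaussianReal 0 1)).map
        (fun p => p.1 + (p.2 / s) • h) := by
  have key : (multivariateGaussian 0 (S - (s ^ 2)⁻¹ • vecMulVec h h)).conv
      ((gaussianReal 0 1).map (fun z => (z / s) • h)) =
      ((multivariateGaussian 0 (S - (s ^ 2)⁻¹ • vecMulVec h h)).prod (gaussianReal 0 1)).map
        (fun p => p.1 + (p.2 / s) • h) := by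
    rw [Measure.conv]
    nth_rewrite 1 [← Measure.map_id
      (μ := multivariateGaussian 0 (S - (s ^ 2)⁻¹ • vecMulVec h h))]
    rw [Measure.map_prod_map _ _ measurable_id (by fun_prop),
      Measure.map_map (by fun_prop) (by fun_prop)]
    rfl
  rw [← key]
  have : IsProbabilityMeasure ((gaussianReal 0 1).map (fun z => (z / s) • h)) :=
    Measure.isProbabilityMeasure_map (by fun_prop)
  refine Measure.ext_of_charFun ?_
  ext x
  have h1 : charFun ((gaussianReal 0 1).map (fun z => (z / s) • h)) x =
      charFun (gaussianReal 0 1) ((h ⬝ᵥ x) / s) := by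
    rw [charFun_apply, integral_map (by fun_prop) (by fun_prop), charFun_apply]
    congr 1
    ext z
    congr 2
    simp [EuclideanSpace.inner_eq_star_dotProduct, dotProduct_comm]
    ring
  rw [charFun_conv, h1, charFun_multivariateGaussian_zero hS, charFun_multivariateGaussian_zero hS',
    charFun_gaussianReal, ← Complex.exp_add]
  congr 1
  have h2 : vecMulVec h.ofLp h.ofLp *ᵥ x.ofLp = (h ⬝ᵥ x) • h.ofLp := by
    ext i
    simp [vecMulVec, mulVec, dotProduct, Finset.sum_mul]
    exact Finset.sum_congr rfl fun j _ => by ring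
  have h3 : x.ofLp ⬝ᵥ (S - (s ^ 2)⁻¹ • vecMulVec h h) *ᵥ x =
      x.ofLp ⬝ᵥ S *ᵥ x.ofLp - (s ^ 2)⁻¹ * (h ⬝ᵥ x) ^ 2 := by
    rw [sub_mulVec, smul_mulVec, h2, dotProduct_sub, dotProduct_smul, dotProduct_smul,
      dotProduct_comm x.ofLp h.ofLp]
    simp only [smul_eq_mul]; ring
  rw [h3]
  push_cast
  have : (s : ℂ) ≠ 0 := by exact_mod_cast hs.ne'
  field_simp
  ring

open Matrix in
theorem multivariateGaussian_shift_ge {S : Matrix ι ι ℝ} (hS : S.PosSemidef)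
    (h : EuclideanSpace ℝ ι) {s : ℝ} (hs : 0 < s)
    (hh : ∀ x : ι → ℝ, (h.ofLp ⬝ᵥ x) ^ 2 ≤ s ^ 2 * (x ⬝ᵥ S *ᵥ x))
    {B : Set (EuclideanSpace ℝ ι)} (hB : MeasurableSet B) (hsymm : ∀ x, -x ∈ B ↔ x ∈ B) :
    ENNReal.ofReal (Real.exp (-(s ^ 2 / 2))) * multivariateGaussian 0 S B ≤
      multivariateGaussian 0 S {x | x - h ∈ B} := by
  have hS' : (S - (s ^ 2)⁻¹ • vecMulVec h.ofLp h.ofLp).PosSemidef := by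
    refine PosSemidef.of_dotProduct_mulVec_nonneg ?_ fun x => ?_
    · refine hS.1.sub ?_
      ext i j
      simp [vecMulVec, mul_comm]
    · have h2 : vecMulVec h.ofLp h.ofLp *ᵥ x = (h.ofLp ⬝ᵥ x) • h.ofLp := by
        ext i
        simp [vecMulVec, mulVec, dotProduct, Finset.sum_mul]
        exact Finset.sum_congr rfl fun j _ => by ring
      rw [star_trivial, sub_mulVec, smul_mulVec, h2, dotProduct_sub, dotProduct_smul,
        dotProduct_smul, dotProduct_comm x h.ofLp, smul_eq_mul, smul_eq_mul, ← pow_two, sub_nonneg,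
        inv_mul_le_iff₀ (by positivity)]
      exact hh x
  set ν := multivariateGaussian 0 S with hν
  set ν' := multivariateGaussian 0 (S - (s ^ 2)⁻¹ • vecMulVec h.ofLp h.ofLp)
  have hconv : ν = (ν'.prod (gaussianReal 0 1)).map (fun p => p.1 + (p.2 / s) • h) :=
    multivariateGaussian_eq_conv hS hs hS'
  have hBm : MeasurableSet {x | x - h ∈ B} := (measurable_id.sub_const h) hB
  have hBp : MeasurableSet {x | x + h ∈ B} := (measurable_id.add_const h) hB
  have hpm : ν {x | x - h ∈ B} = ν {x | x + h ∈ B} := by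
    conv_lhs => rw [hν, ← multivariateGaussian_neg hS, Measure.map_apply measurable_neg hBm]
    congr 1
    ext x
    simp only [mem_preimage, mem_ofPred_eq]
    rw [← hsymm]
    simp [add_comm]
  have hm : Measurable fun p : EuclideanSpace ℝ ι × ℝ => p.1 + (p.2 / s) • h := by fun_prop
  have fub : ∀ D : Set (EuclideanSpace ℝ ι), MeasurableSet D →
      ν D = ∫⁻ g, gaussianReal 0 1 {z | g + (z / s) • h ∈ D} ∂ν' := by
    intro D hD
    rw [hconv, Measure.map_apply hm hD, Measure.prod_apply (hm hD)]
    rfl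
  have e1 : 2 * ν {x | x - h ∈ B} = ν {x | x - h ∈ B} + ν {x | x + h ∈ B} := by
    rw [← hpm, two_mul]
  have key : 2 * (ENNReal.ofReal (Real.exp (-(s ^ 2 / 2))) * ν B) ≤ 2 * ν {x | x - h ∈ B} := by
    rw [e1, fub _ hB, fub _ hBm, fub _ hBp, ← mul_assoc]
    have hmeas : ∀ D : Set (EuclideanSpace ℝ ι), MeasurableSet D →
        Measurable fun g => gaussianReal 0 1 {z | g + (z / s) • h ∈ D} := fun D hD =>
      measurable_measure_prodMk_left (hm hD)
    rw [← lintegral_const_mul _ (hmeas _ hB), ← lintegral_add_left (hmeas _ hBm)]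
    refine lintegral_mono fun g => ?_
    have hC : MeasurableSet {z : ℝ | g + (z / s) • h ∈ B} :=
      (by fun_prop : Measurable fun z : ℝ => g + (z / s) • h) hB
    have em : ∀ z : ℝ, g + (z / s) • h - h = g + ((z - s) / s) • h := fun z => by
      rw [_root_.sub_div, sub_smul, div_self hs.ne', one_smul, add_sub_assoc]
    have ep : ∀ z : ℝ, g + (z / s) • h + h = g + ((z + s) / s) • h := fun z => by
      rw [_root_.add_div, add_smul, div_self hs.ne', one_smul, add_assoc]
    simp only [mem_ofPred_eq, em, ep]
    exact gaussianReal_shift_add_shift_ge s hC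
  exact (ENNReal.mul_le_mul_iff_right (by norm_num) (by norm_num)).1 key

end Gaussian

section Entropy

/-- Among two independent samples of a discrete law, the collision probability is at least
`exp (-∫ c)`, for every code length `c` satisfying the Kraft inequality. -/
theorem exp_neg_integral_le_collision {K : Type*} [MeasurableSpace K] [Countable K]
    [MeasurableSingletonClass K] (ρ W : Measure K) [IsProbabilityMeasure ρ]
    [IsProbabilityMeasure W] {c : K → ℝ} (hc : Integrable c ρ)
    (hWc : ∀ n, Real.exp (-c n) ≤ W.real {n}) :
    Real.exp (-∫ n, c n ∂ρ) ≤ ∫ n, ρ.real {n} ∂ρ := by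
  set m := ∫ n, c n ∂ρ with hm
  have hρm : Measurable fun n => ρ.real {n} := measurable_of_countable _
  have hρi : Integrable (fun n => ρ.real {n}) ρ := by
    refine Integrable.of_bound hρm.aestronglyMeasurable 1 (ae_of_all _ fun n => ?_)
    rw [Real.norm_eq_abs, abs_of_nonneg measureReal_nonneg]
    exact measureReal_le_one
  have hlin : ∫⁻ n, ENNReal.ofReal (W.real {n} / ρ.real {n}) ∂ρ ≤ 1 := by
    rw [lintegral_countable']
    calc ∑' n, ENNReal.ofReal (W.real {n} / ρ.real {n}) * ρ {n} ≤ ∑' n, W {n} := by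
          refine ENNReal.tsum_le_tsum fun n => ?_
          rw [← ofReal_measureReal (μ := ρ), ← ofReal_measureReal (μ := W),
            ← ENNReal.ofReal_mul (by positivity)]
          refine ENNReal.ofReal_le_ofReal ?_
          rcases eq_or_ne (ρ.real {n}) 0 with h | h
          · simp [h]
          · rw [div_mul_cancel₀ _ h]
      _ = ∫⁻ n, 1 ∂W := by rw [lintegral_countable']; simp
      _ = 1 := by simp
  have hWm : Measurable fun n => W.real {n} / ρ.real {n} := measurable_of_countable _
  have hWi : Integrable (fun n => W.real {n} / ρ.real {n}) ρ := by
    refine ⟨hWm.aestronglyMeasurable, ?_⟩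
    rw [hasFiniteIntegral_iff_ofReal (ae_of_all _ fun n => by positivity)]
    exact hlin.trans_lt ENNReal.one_lt_top
  have hWle : ∫ n, W.real {n} / ρ.real {n} ∂ρ ≤ 1 := by
    rw [integral_eq_lintegral_of_nonneg_ae (ae_of_all _ fun n => by positivity)
      hWm.aestronglyMeasurable]
    exact ENNReal.toReal_le_of_le_ofReal zero_le_one (by simpa using hlin)
  have hae : ∀ᵐ n ∂ρ, ρ {n} ≠ 0 := by
    rw [ae_iff_of_countable]
    exact fun n hn => hn
  have hpt : ∀ᵐ n ∂ρ, Real.exp (-m / 2) * (1 - (c n - m) / 2) ≤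
      (Real.exp (m / 2) * ρ.real {n} + Real.exp (-m / 2) * (W.real {n} / ρ.real {n})) / 2 := by
    filter_upwards [hae] with n hn
    have hn' : 0 < ρ.real {n} := by
      rw [measureReal_def]
      exact ENNReal.toReal_pos hn (measure_ne_top _ _)
    have h1 : Real.exp (-m / 2) * (1 - (c n - m) / 2) ≤ Real.exp (-c n / 2) := by
      have : Real.exp (-c n / 2) = Real.exp (-m / 2) * Real.exp (-(c n - m) / 2) := by
        rw [← Real.exp_add]; congr 1; ring
      rw [this]
      refine mul_le_mul_of_nonneg_left ?_ (Real.exp_pos _).le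
      linarith [Real.add_one_le_exp (-(c n - m) / 2)]
    refine h1.trans ?_
    refine abs_le_of_sq_le_sq' ?_ (by positivity) |>.2
    have h2 : Real.exp (-c n / 2) ^ 2 = Real.exp (-c n) := by
      rw [← Real.exp_nat_mul]; congr 1; push_cast; ring
    have h3 : (Real.exp (m / 2) * ρ.real {n}) * (Real.exp (-m / 2) * (W.real {n} / ρ.real {n})) =
        W.real {n} := by
      have : Real.exp (m / 2) * Real.exp (-m / 2) = 1 := by
        rw [← Real.exp_add, ← Real.exp_zero]; congr 1; ring
      calc _ = (Real.exp (m / 2) * Real.exp (-m / 2)) *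
          (ρ.real {n} * (W.real {n} / ρ.real {n})) := by
            ring
        _ = _ := by rw [this, one_mul, mul_div_cancel₀ _ hn'.ne']
    rw [h2]
    nlinarith [hWc n, sq_nonneg (Real.exp (m / 2) * ρ.real {n} -
      Real.exp (-m / 2) * (W.real {n} / ρ.real {n}))]
  have hcm : Integrable (fun n => (c n - m) / 2) ρ := (hc.sub (integrable_const m)).div_const 2
  have hl : Integrable (fun n => Real.exp (-m / 2) * (1 - (c n - m) / 2)) ρ :=
    ((integrable_const 1).sub hcm).const_mul _
  have h_int := integral_mono_ae hl
    (((hρi.const_mul _).add (hWi.const_mul _)).div_const 2) hpt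
  have e1 : ∫ n, Real.exp (-m / 2) * (1 - (c n - m) / 2) ∂ρ = Real.exp (-m / 2) := by
    rw [integral_const_mul, integral_sub (integrable_const _) hcm, integral_div,
      integral_sub hc (integrable_const _), ← hm]
    simp
  rw [e1] at h_int
  simp only [Pi.add_apply] at h_int
  rw [integral_div, integral_add (hρi.const_mul _) (hWi.const_mul _), integral_const_mul,
    integral_const_mul] at h_int
  have h4 : Real.exp (-m / 2) ≤ Real.exp (m / 2) * ∫ n, ρ.real {n} ∂ρ := by
    nlinarith [Real.exp_pos (-m / 2)]
  have h5 := mul_le_mul_of_nonneg_left h4 (Real.exp_pos (-m / 2)).le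
  rw [← mul_assoc, ← Real.exp_add, ← Real.exp_add] at h5
  have h6 : -m / 2 + m / 2 = 0 := by ring
  have h7 : -m / 2 + -m / 2 = -m := by ring
  rwa [h6, h7, Real.exp_zero, one_mul] at h5

/-- A code length on `ℤ` concentrating on `0`. -/
noncomputable def intCode (u : ℝ) (k : ℤ) : ℝ :=
  if k = 0 then 4 * Real.exp (-u) else (u + 1) * |(k : ℝ)|

/-- A probability weight on `ℤ` dominating `exp (-intCode u)`. -/
noncomputable def intWeight (u : ℝ) (k : ℤ) : ℝ :=
  if k = 0 then 1 - 2 * Real.exp (-u) else Real.exp (-u) * (1 / 2) ^ k.natAbs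

theorem exp_neg_le_quarter {u : ℝ} (hu : 2 ≤ u) : Real.exp (-u) ≤ 1 / 4 := by
  have h1 : Real.exp (-u) ≤ Real.exp (-1) * Real.exp (-1) := by
    rw [← Real.exp_add]; exact Real.exp_le_exp.2 (by linarith)
  have h2 : Real.exp (-1) ≤ 1 / 2 := by linarith [Real.exp_neg_one_lt_half]
  nlinarith [Real.exp_pos (-1)]

theorem hasSum_intWeight (u : ℝ) : HasSum (intWeight u) 1 := by
  have h1 : HasSum (fun n : ℕ => intWeight u n) (1 - Real.exp (-u)) := by
    have h := (hasSum_geometric_two.mul_left (Real.exp (-u))).add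
      (hasSum_ite_eq (0 : ℕ) (1 - 3 * Real.exp (-u)))
    have e : (fun n : ℕ => intWeight u n) = fun n : ℕ => Real.exp (-u) * (1 / 2) ^ n +
        if n = 0 then 1 - 3 * Real.exp (-u) else 0 := by
      funext n
      rcases n with _ | n
      · simp only [intWeight, Nat.cast_zero, if_true, pow_zero]; ring
      · simp [intWeight]
        norm_cast
    rw [e]
    rwa [show Real.exp (-u) * 2 + (1 - 3 * Real.exp (-u)) = 1 - Real.exp (-u) by ring] at h
  have h2 : HasSum (fun n : ℕ => intWeight u (-((n : ℤ) + 1))) (Real.exp (-u)) := by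
    have h := hasSum_geometric_two.mul_left (Real.exp (-u) / 2)
    have e : (fun n : ℕ => intWeight u (-((n : ℤ) + 1))) =
        fun n : ℕ => Real.exp (-u) / 2 * (1 / 2) ^ n := by
      funext n
      have h0 : -((n : ℤ) + 1) ≠ 0 := by omega
      have h3 : (-((n : ℤ) + 1)).natAbs = n + 1 := by omega
      rw [intWeight, if_neg h0, h3, pow_succ]
      ring
    rw [e]
    rwa [show Real.exp (-u) / 2 * 2 = Real.exp (-u) by ring] at h
  have h := HasSum.of_nat_of_neg_add_one h1 h2
  rwa [sub_add_cancel] at h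

theorem exp_neg_intCode_le {u : ℝ} (hu : 2 ≤ u) (k : ℤ) :
    Real.exp (-intCode u k) ≤ intWeight u k := by
  have hq := exp_neg_le_quarter hu
  have hp := Real.exp_pos (-u)
  unfold intCode intWeight
  split_ifs with h
  · rw [Real.exp_neg, inv_le_comm₀ (Real.exp_pos _) (by linarith)]
    refine le_trans ?_ (Real.add_one_le_exp _)
    rw [inv_le_iff_one_le_mul₀ (by linarith)]
    nlinarith
  · have hk : (1 : ℝ) ≤ |(k : ℝ)| := by
      have : 1 ≤ |k| := Int.one_le_abs h
      exact_mod_cast this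
    have h2 : Real.exp (-|(k : ℝ)|) ≤ (1 / 2) ^ k.natAbs := by
      have : -|(k : ℝ)| = (k.natAbs : ℕ) * (-1 : ℝ) := by
        rw [Nat.cast_natAbs]; push_cast; ring
      rw [this, Real.exp_nat_mul]
      exact pow_le_pow_left₀ (Real.exp_pos _).le (by linarith [Real.exp_neg_one_lt_half]) _
    calc Real.exp (-((u + 1) * |(k : ℝ)|)) ≤ Real.exp (-u) * Real.exp (-|(k : ℝ)|) := by
          rw [← Real.exp_add]
          refine Real.exp_le_exp.2 ?_
          nlinarith
      _ ≤ _ := mul_le_mul_of_nonneg_left h2 hp.le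

/-- The probability measure on `ℤ` with weights `intWeight u`. -/
noncomputable def intLaw (u : ℝ) : Measure ℤ :=
  Measure.sum fun k : ℤ => ENNReal.ofReal (intWeight u k) • Measure.dirac k

theorem intLaw_singleton (u : ℝ) (k : ℤ) : intLaw u {k} = ENNReal.ofReal (intWeight u k) := by
  rw [intLaw, Measure.sum_apply _ (measurableSet_singleton k), tsum_eq_single k]
  · simp
  · intro b hb
    simp [hb]

theorem intLaw_univ {u : ℝ} (hu : 2 ≤ u) : intLaw u univ = 1 := by
  rw [intLaw, Measure.sum_apply _ MeasurableSet.univ]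
  simp only [Measure.smul_apply, measure_univ, smul_eq_mul, mul_one]
  rw [← ENNReal.ofReal_tsum_of_nonneg
    (fun k => (Real.exp_pos _).le.trans (exp_neg_intCode_le hu k)) (hasSum_intWeight u).summable,
    (hasSum_intWeight u).tsum_eq, ENNReal.ofReal_one]

theorem intCode_round_le {u : ℝ} (hu : 2 ≤ u) (z : ℝ) :
    intCode u (round z) ≤ 4 * Real.exp (-u) +
      2 * (u + 1) * Real.exp (-(4 * u)) * (Real.exp (8 * u * z) + Real.exp (-(8 * u) * z)) := by
  unfold intCode
  split_ifs with h
  · have : 0 ≤ 2 * (u + 1) * Real.exp (-(4 * u)) *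
      (Real.exp (8 * u * z) + Real.exp (-(8 * u) * z)) := by positivity
    linarith
  · have hk : (1 : ℝ) ≤ |((round z : ℤ) : ℝ)| := by
      have : 1 ≤ |round z| := Int.one_le_abs h
      exact_mod_cast this
    have hr := abs_sub_round z
    have h1 : |((round z : ℤ) : ℝ)| ≤ |z| + 1 / 2 := by
      have := abs_sub_abs_le_abs_sub ((round z : ℤ) : ℝ) z
      rw [abs_sub_comm] at this
      linarith
    have hz : 1 / 2 ≤ |z| := by linarith
    have h2 : |z| ≤ Real.exp (8 * u * (|z| - 1 / 2)) := by
      nlinarith [Real.add_one_le_exp (8 * u * (|z| - 1 / 2))]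
    have h3 : Real.exp (8 * u * (|z| - 1 / 2)) ≤
        Real.exp (-(4 * u)) * (Real.exp (8 * u * z) + Real.exp (-(8 * u) * z)) := by
      have : 8 * u * (|z| - 1 / 2) = -(4 * u) + 8 * u * |z| := by ring
      rw [this, Real.exp_add]
      refine mul_le_mul_of_nonneg_left ?_ (Real.exp_pos _).le
      rcases abs_cases z with ⟨h, -⟩ | ⟨h, -⟩ <;> rw [h]
      · linarith [Real.exp_pos (-(8 * u) * z)]
      · have : 8 * u * -z = -(8 * u) * z := by ring
        rw [this]
        linarith [Real.exp_pos (8 * u * z)]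
    calc (u + 1) * |((round z : ℤ) : ℝ)| ≤ (u + 1) * (2 * |z|) :=
          mul_le_mul_of_nonneg_left (by linarith) (by linarith)
      _ ≤ (u + 1) * (2 * (Real.exp (-(4 * u)) *
            (Real.exp (8 * u * z) + Real.exp (-(8 * u) * z)))) :=
          mul_le_mul_of_nonneg_left (by linarith) (by linarith)
      _ ≤ _ := by linarith [Real.exp_pos (-u)]

theorem intCode_nonneg {u : ℝ} (hu : 2 ≤ u) (k : ℤ) : 0 ≤ intCode u k := by
  unfold intCode
  split_ifs <;> positivity

theorem measurable_intCode_round (u : ℝ) : Measurable fun z : ℝ => intCode u (round z) := by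
  have h : Measurable fun z : ℝ => ⌊z + 1 / 2⌋ := Int.measurable_floor.comp (by fun_prop)
  have : Measurable fun z : ℝ => round z := by simpa only [round_eq] using h
  exact (measurable_from_top (f := intCode u)).comp this

theorem integrable_intCode_round {u : ℝ} (hu : 2 ≤ u) (v : ℝ≥0) :
    Integrable (fun z => intCode u (round z)) (gaussianReal 0 v) := by
  refine Integrable.mono' (((integrable_const (4 * Real.exp (-u))).add
    (((integrable_exp_mul_gaussianReal (8 * u)).add
      (integrable_exp_mul_gaussianReal (-(8 * u)))).const_mul
        (2 * (u + 1) * Real.exp (-(4 * u)))))) (measurable_intCode_round u).aestronglyMeasurable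
    (ae_of_all _ fun z => ?_)
  rw [Real.norm_eq_abs, abs_of_nonneg (intCode_nonneg hu _)]
  exact intCode_round_le hu z

theorem integral_intCode_round_le {u : ℝ} (hu : 2 ≤ u) {v : ℝ≥0} (hv : 16 * u * v ≤ 1) :
    ∫ z, intCode u (round z) ∂(gaussianReal 0 v) ≤ 8 * Real.exp (-u) := by
  have hi : ∀ s : ℝ, ∫ z, Real.exp (s * z) ∂(gaussianReal 0 v) = Real.exp (v * s ^ 2 / 2) := by
    intro s
    have := congrFun (mgf_fun_id_gaussianReal (μ := 0) (v := v)) s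
    simpa [mgf] using this
  have h1 := integrable_exp_mul_gaussianReal (μ := 0) (v := v) (8 * u)
  have h2 := integrable_exp_mul_gaussianReal (μ := 0) (v := v) (-(8 * u))
  have h12 : Integrable (fun z => 2 * (u + 1) * Real.exp (-(4 * u)) *
      (Real.exp (8 * u * z) + Real.exp (-(8 * u) * z))) (gaussianReal 0 v) :=
    (h1.add h2).const_mul _
  have h3 := integral_mono (integrable_intCode_round hu v)
    ((integrable_const (4 * Real.exp (-u))).add h12) (intCode_round_le hu)
  rw [integral_add' (integrable_const _) h12, integral_const, probReal_univ, one_smul,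
    integral_const_mul, integral_add h1 h2, hi, hi] at h3
  refine h3.trans ?_
  have h4 : Real.exp (v * (8 * u) ^ 2 / 2) ≤ Real.exp (2 * u) := by
    refine Real.exp_le_exp.2 ?_
    nlinarith
  have h5 : Real.exp (v * (-(8 * u)) ^ 2 / 2) ≤ Real.exp (2 * u) := by
    rw [neg_sq]; exact h4
  have h6 : 2 * (u + 1) * Real.exp (-(4 * u)) *
      (Real.exp (v * (8 * u) ^ 2 / 2) + Real.exp (v * (-(8 * u)) ^ 2 / 2)) ≤
      2 * Real.exp u * Real.exp (-(4 * u)) * (Real.exp (2 * u) + Real.exp (2 * u)) := by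
    gcongr
    exact Real.add_one_le_exp u
  have h7 : Real.exp u * Real.exp (-(4 * u)) * Real.exp (2 * u) = Real.exp (-u) := by
    rw [← Real.exp_add, ← Real.exp_add]; congr 1; ring
  linarith

end Entropy

section SmallBall

variable {ι : Type*} [Fintype ι]

theorem measurable_roundInt : Measurable fun z : ℝ => round z := by
  have h : Measurable fun z : ℝ => ⌊z + 1 / 2⌋ := Int.measurable_floor.comp (by fun_prop)
  simpa only [round_eq] using h

theorem abs_sub_le_of_round_div_eq {a x y : ℝ} (ha : 0 < a) (h : round (x / a) = round (y / a)) :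
    |x - y| ≤ a := by
  have h1 := abs_sub_round (x / a)
  have h2 := abs_sub_round (y / a)
  rw [h] at h1
  rw [abs_le] at h1 h2
  have h3 : |x / a - y / a| ≤ 1 := by rw [abs_le]; constructor <;> linarith
  rwa [← _root_.sub_div, abs_div, abs_of_pos ha, div_le_one ha] at h3

theorem integral_intCode_multivariateGaussian [DecidableEq ι] {S : Matrix ι ι ℝ}
    (hS : S.PosSemidef) {i : ι} {u a : ℝ}
    (hu : 2 ≤ u) (h : 16 * u * S i i ≤ a ^ 2) :
    Integrable (fun x : EuclideanSpace ℝ ι => intCode u (round (x i / a)))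
      (multivariateGaussian 0 S) ∧
    ∫ x : EuclideanSpace ℝ ι, intCode u (round (x i / a)) ∂(multivariateGaussian 0 S) ≤
      8 * Real.exp (-u) := by
  have h1 := measurePreserving_eval_multivariateGaussian (μ := 0) hS (i := i)
  have h2 : (multivariateGaussian 0 S).map (fun x => x i / a) =
      gaussianReal 0 ((S i i).toNNReal / NNReal.mk (a ^ 2) (sq_nonneg a)) := by
    have h3 := gaussianReal_map_div_const (μ := 0) (v := (S i i).toNNReal) a
    have h4 : gaussianReal 0 (S i i).toNNReal = (multivariateGaussian 0 S).map (fun x => x i) := by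
      rw [h1.map_eq]; simp
    rw [h4, Measure.map_map (by fun_prop) h1.measurable] at h3
    simpa [Function.comp_def] using h3
  have hm : Measurable fun x : EuclideanSpace ℝ ι => x i / a := by fun_prop
  have h0 : 0 ≤ S i i := hS.diag_nonneg
  constructor
  · have := integrable_intCode_round hu ((S i i).toNNReal / NNReal.mk (a ^ 2) (sq_nonneg a))
    rw [← h2] at this
    exact this.comp_measurable hm
  · have := integral_intCode_round_le
      (v := (S i i).toNNReal / NNReal.mk (a ^ 2) (sq_nonneg a)) hu (by
      rw [NNReal.coe_div, Real.coe_toNNReal _ h0, NNReal.coe_mk, ← mul_div_assoc]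
      exact div_le_one_of_le₀ h (sq_nonneg a))
    rw [← h2, integral_map hm.aemeasurable
      (measurable_intCode_round u).aestronglyMeasurable] at this
    exact this

theorem multivariateGaussian_box_ge [DecidableEq ι] {S : Matrix ι ι ℝ}
    (hS : S.PosSemidef) {u a : ι → ℝ}
    (ha : ∀ i, 0 < a i) (hu : ∀ i, 2 ≤ u i) (h : ∀ i, 16 * u i * S i i ≤ a i ^ 2) :
    ENNReal.ofReal (Real.exp (-(8 * ∑ i, Real.exp (-u i)))) ≤
      multivariateGaussian 0 S {x | ∀ i, |x i| ≤ a i} := by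
  set ν := multivariateGaussian 0 S with hν
  let q : EuclideanSpace ℝ ι → ι → ℤ := fun x i => round (x i / a i)
  have hq : Measurable q := by
    refine measurable_pi_lambda _ fun i => measurable_roundInt.comp ?_
    fun_prop
  let W : Measure (ι → ℤ) := Measure.pi fun i => intLaw (u i)
  have hlaw : ∀ i, IsProbabilityMeasure (intLaw (u i)) := fun i => ⟨intLaw_univ (hu i)⟩
  let c : (ι → ℤ) → ℝ := fun n => ∑ i, intCode (u i) (n i)
  have hcq : Integrable (fun x => c (q x)) ν :=
    integrable_finsetSum _ fun i _ =>
      (integral_intCode_multivariateGaussian hS (hu i) (h i)).1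
  have : IsProbabilityMeasure (ν.map q) := Measure.isProbabilityMeasure_map hq.aemeasurable
  have hW : ∀ n, Real.exp (-c n) ≤ W.real {n} := by
    intro n
    rw [Measure.real, Measure.pi_singleton, ENNReal.toReal_prod]
    simp only [c, intLaw_singleton]
    rw [← Finset.sum_neg_distrib, Real.exp_sum]
    refine Finset.prod_le_prod (fun i _ => (Real.exp_pos _).le) fun i _ => ?_
    have := exp_neg_intCode_le (hu i) (n i)
    rwa [ENNReal.toReal_ofReal ((Real.exp_pos _).le.trans this)]
  have hc : Measurable c := measurable_of_countable c
  have hcm : Integrable c (ν.map q) :=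
    (integrable_map_measure hc.aestronglyMeasurable hq.aemeasurable).2 hcq
  have h1 := exp_neg_integral_le_collision (ν.map q) W hcm hW
  have h2 : ∫ n, c n ∂(ν.map q) ≤ 8 * ∑ i, Real.exp (-u i) := by
    rw [integral_map hq.aemeasurable hc.aestronglyMeasurable, integral_finsetSum _ fun i _ =>
      (integral_intCode_multivariateGaussian hS (hu i) (h i)).1, Finset.mul_sum]
    exact Finset.sum_le_sum fun i _ =>
      (integral_intCode_multivariateGaussian hS (hu i) (h i)).2
  have hB : MeasurableSet {x : EuclideanSpace ℝ ι | ∀ i, |x i| ≤ a i} := by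
    simp only [Set.ofPred_forall]
    exact MeasurableSet.iInter fun i => measurableSet_le (by fun_prop) (by fun_prop)
  calc ENNReal.ofReal (Real.exp (-(8 * ∑ i, Real.exp (-u i))))
      ≤ ENNReal.ofReal (∫ n, (ν.map q).real {n} ∂(ν.map q)) :=
        ENNReal.ofReal_le_ofReal (le_trans (Real.exp_le_exp.2 (by linarith)) h1)
    _ ≤ ∫⁻ n, (ν.map q) {n} ∂(ν.map q) := by
        refine (ENNReal.ofReal_le_ofReal ?_).trans ENNReal.ofReal_toReal_le
        rw [integral_eq_lintegral_of_nonneg_ae (ae_of_all _ fun _ => measureReal_nonneg)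
          (measurable_of_countable _).aestronglyMeasurable]
        simp
    _ = ∫⁻ x, ν {y | q y = q x} ∂ν := by
        rw [lintegral_map (measurable_of_countable _) hq]
        refine lintegral_congr fun x => ?_
        rw [Measure.map_apply hq (measurableSet_singleton _)]
        rfl
    _ = (ν.prod ν) {p | q p.2 = q p.1} := by
        have hm : MeasurableSet {p : EuclideanSpace ℝ ι × EuclideanSpace ℝ ι | q p.2 = q p.1} :=
          measurableSet_eq_fun (hq.comp measurable_snd) (hq.comp measurable_fst)
        rw [Measure.prod_apply hm]
        rfl
    _ ≤ (ν.prod ν) ((fun p => p.1 - p.2) ⁻¹' {x | ∀ i, |x i| ≤ a i}) := by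
        refine measure_mono fun p hp i => ?_
        exact abs_sub_le_of_round_div_eq (ha i) (congrFun hp i).symm
    _ = ν ((fun x => √2 • x) ⁻¹' {x | ∀ i, |x i| ≤ a i}) := by
        rw [← Measure.map_apply (by fun_prop) hB, multivariateGaussian_prod_sub hS,
          Measure.map_apply (by fun_prop) hB]
    _ ≤ ν {x | ∀ i, |x i| ≤ a i} := by
        refine measure_mono fun x hx i => ?_
        have h3 := hx i
        simp only [PiLp.smul_apply, smul_eq_mul, abs_mul] at h3
        have h4 : 1 ≤ |√2| := by
          rw [abs_of_nonneg (Real.sqrt_nonneg 2)]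
          exact Real.one_le_sqrt.2 (by norm_num)
        nlinarith [abs_nonneg (x i)]

open Matrix in
/-- A joint small-ball estimate for a Gaussian vector around a point of its Cameron-Martin
space. -/
theorem gaussian_box_ge {Ω : Type*} [MeasurableSpace Ω] (P : Measure Ω) [IsProbabilityMeasure P]
    {Y : ι → Ω → ℝ} {S : Matrix ι ι ℝ} (hS : S.PosSemidef)
    (hY : ∀ d : ι → ℝ, P.map (fun ω => ∑ i, d i * Y i ω) = gaussianReal 0 (d ⬝ᵥ S *ᵥ d).toNNReal)
    {u a : ι → ℝ} (ha : ∀ i, 0 < a i) (hu : ∀ i, 2 ≤ u i) (h : ∀ i, 16 * u i * S i i ≤ a i ^ 2)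
    {b : ι → ℝ} {s : ℝ} (hs : 0 < s) (hb : ∀ d : ι → ℝ, (b ⬝ᵥ d) ^ 2 ≤ s ^ 2 * (d ⬝ᵥ S *ᵥ d)) :
    NullMeasurableSet {ω | ∀ i, |Y i ω - b i| ≤ a i} P ∧
    ENNReal.ofReal (Real.exp (-(8 * ∑ i, Real.exp (-u i) + s ^ 2 / 2))) ≤
      P {ω | ∀ i, |Y i ω - b i| ≤ a i} := by
  classical
  have hYm : ∀ i, AEMeasurable (Y i) P := by
    intro i
    have h1 := hY (Pi.single i 1)
    have h2 : (fun ω => ∑ j, (Pi.single i (1 : ℝ) : ι → ℝ) j * Y j ω) = Y i := by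
      ext ω
      rw [Finset.sum_eq_single i] <;> simp +contextual
    rw [h2] at h1
    by_contra hn
    rw [Measure.map_of_not_aemeasurable hn] at h1
    exact IsProbabilityMeasure.ne_zero _ h1.symm
  let Z : Ω → EuclideanSpace ℝ ι := fun ω => WithLp.toLp 2 fun i => Y i ω
  have hZ : AEMeasurable Z P := by
    have : AEMeasurable (fun ω i => Y i ω) P := aemeasurable_pi_lambda _ hYm
    exact (by fun_prop : Measurable (WithLp.toLp 2 : (ι → ℝ) →
      EuclideanSpace ℝ ι)).comp_aemeasurable this
  have hmap : P.map Z = multivariateGaussian 0 S := by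
    have : IsProbabilityMeasure (P.map Z) := Measure.isProbabilityMeasure_map hZ
    refine Measure.ext_of_charFun ?_
    ext x
    rw [charFun_multivariateGaussian_zero hS]
    have h3 : charFun (P.map Z) x = charFun (P.map (fun ω => ∑ i, x i * Y i ω)) 1 := by
      rw [charFun_apply, charFun_apply, integral_map hZ (by fun_prop),
        integral_map (Finset.aemeasurable_fun_sum _ fun i _ => (hYm i).const_mul _) (by fun_prop)]
      refine integral_congr_ae (ae_of_all _ fun ω => ?_)
      simp [Z, PiLp.inner_apply]
    rw [h3, hY, charFun_gaussianReal]
    have h0 : 0 ≤ x.ofLp ⬝ᵥ S *ᵥ x.ofLp := by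
      simpa using hS.dotProduct_mulVec_nonneg x.ofLp
    congr 1
    simp [h0, neg_div]
  set B : Set (EuclideanSpace ℝ ι) := {x | ∀ i, |x i| ≤ a i} with hBdef
  have hB : MeasurableSet B := by
    simp only [hBdef, Set.ofPred_forall]
    exact MeasurableSet.iInter fun i => measurableSet_le (by fun_prop) (by fun_prop)
  have hB' : MeasurableSet {x | x - WithLp.toLp 2 b ∈ B} :=
    hB.preimage (by fun_prop : Measurable fun x : EuclideanSpace ℝ ι => x - WithLp.toLp 2 b)
  have hset : {ω | ∀ i, |Y i ω - b i| ≤ a i} = Z ⁻¹' {x | x - WithLp.toLp 2 b ∈ B} := by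
    ext ω
    simp [Z, B]
  rw [hset]
  refine ⟨hZ.nullMeasurableSet_preimage hB', ?_⟩
  rw [← Measure.map_apply_of_aemeasurable hZ hB', hmap]
  refine le_trans ?_ (multivariateGaussian_shift_ge hS (WithLp.toLp 2 b) hs hb hB
    (fun x => by simp [B]))
  rw [neg_add, add_comm, Real.exp_add, ENNReal.ofReal_mul (Real.exp_pos _).le]
  gcongr
  exact multivariateGaussian_box_ge hS ha hu h

end SmallBall

section Stationary

variable {Ω : Type*} [MeasurableSpace Ω] {P : Measure Ω} {μ : Measure ℝ} [IsProbabilityMeasure μ]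
  {F : ℝ → Ω → ℝ} {κ ι : Type*} [Fintype κ] [Fintype ι]

theorem continuous_sum_cos (c t : κ → ℝ) :
    Continuous fun l : ℝ => ∑ i, c i * Real.cos (l * t i) := by
  fun_prop

theorem continuous_sum_sin (c t : κ → ℝ) :
    Continuous fun l : ℝ => ∑ i, c i * Real.sin (l * t i) := by
  fun_prop

theorem abs_sum_cos_le (c t : κ → ℝ) (l : ℝ) : |∑ i, c i * Real.cos (l * t i)| ≤ ∑ i, |c i| := by
  refine (Finset.abs_sum_le_sum_abs _ _).trans (Finset.sum_le_sum fun i _ => ?_)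
  rw [abs_mul]
  exact mul_le_of_le_one_right (abs_nonneg _) (Real.abs_cos_le_one _)

theorem abs_sum_sin_le (c t : κ → ℝ) (l : ℝ) : |∑ i, c i * Real.sin (l * t i)| ≤ ∑ i, |c i| := by
  refine (Finset.abs_sum_le_sum_abs _ _).trans (Finset.sum_le_sum fun i _ => ?_)
  rw [abs_mul]
  exact mul_le_of_le_one_right (abs_nonneg _) (Real.abs_sin_le_one _)

theorem integrable_of_continuous_of_bounded {ν : Measure ℝ} [IsFiniteMeasure ν] {f : ℝ → ℝ}
    (hf : Continuous f) {C : ℝ} (hC : ∀ x, |f x| ≤ C) : Integrable f ν :=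
  Integrable.of_bound hf.aestronglyMeasurable C (ae_of_all _ hC)

theorem sum_covKernel_eq_integral (c t : κ → ℝ) :
    ∑ i, ∑ j, c i * c j * covKernel μ (t i - t j) =
      ∫ l, ((∑ i, c i * Real.cos (l * t i)) ^ 2 + (∑ i, c i * Real.sin (l * t i)) ^ 2) ∂μ := by
  have hi : ∀ s : ℝ, Integrable (fun l : ℝ => Real.cos (l * s)) μ := fun s =>
    integrable_of_continuous_of_bounded (by fun_prop) fun l => Real.abs_cos_le_one _
  simp only [covKernel, ← integral_const_mul]
  have h1 : ∀ i, ∑ j, ∫ l, c i * c j * Real.cos (l * (t i - t j)) ∂μ =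
      ∫ l, ∑ j, c i * c j * Real.cos (l * (t i - t j)) ∂μ := fun i =>
    (integral_finsetSum _ fun j _ => (hi _).const_mul _).symm
  simp only [h1]
  rw [← integral_finsetSum _ fun i _ => integrable_finsetSum _ fun j _ => (hi _).const_mul _]
  refine integral_congr_ae (ae_of_all _ fun l => ?_)
  simp only [sq, Finset.sum_mul_sum, ← Finset.sum_add_distrib]
  refine Finset.sum_congr rfl fun i _ => Finset.sum_congr rfl fun j _ => ?_
  rw [mul_sub, Real.cos_sub]
  ring

theorem IsSGP.map_sum_s4 (hF : IsSGP P μ F) (c t : κ → ℝ) :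
    P.map (fun ω => ∑ i, c i * F (t i) ω) =
      gaussianReal 0 (∫ l, ((∑ i, c i * Real.cos (l * t i)) ^ 2 +
        (∑ i, c i * Real.sin (l * t i)) ^ 2) ∂μ).toNNReal := by
  have e := (Fintype.equivFin κ).symm
  have h := hF.2 (Fintype.card κ) (t ∘ e) (c ∘ e)
  rw [sum_covKernel_eq_integral] at h
  simp only [Function.comp_apply] at h
  rw [← integral_congr_ae (ae_of_all μ fun l => ?_)] at h
  · have h1 : (fun ω => ∑ i, c i * F (t i) ω) = fun ω => ∑ i, c (e i) * F (t (e i)) ω := by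
      ext ω
      exact (e.sum_comp fun i => c i * F (t i) ω).symm
    rw [h1, h]
  · rw [← e.sum_comp fun i => c i * Real.cos (l * t i),
      ← e.sum_comp fun i => c i * Real.sin (l * t i)]

theorem sq_integral_le_mul_integral_sq {ν : Measure ℝ} [IsFiniteMeasure ν] {f : ℝ → ℝ}
    (hm : 0 < ν.real univ) (hf : Integrable f ν) (hf2 : Integrable (fun x => f x ^ 2) ν) :
    (∫ x, f x ∂ν) ^ 2 ≤ ν.real univ * ∫ x, f x ^ 2 ∂ν := by
  set m := ν.real univ
  set G := ∫ x, f x ∂ν with hG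
  have h0 : 0 ≤ ∫ x, (m * f x - G) ^ 2 ∂ν := integral_nonneg fun x => sq_nonneg _
  have h1 : ∫ x, (m * f x - G) ^ 2 ∂ν = m ^ 2 * ∫ x, f x ^ 2 ∂ν - 2 * m * G * G + m * G ^ 2 := by
    have : (fun x => (m * f x - G) ^ 2) =
        fun x => m ^ 2 * f x ^ 2 - 2 * m * G * f x + G ^ 2 := by ext x; ring
    rw [this, integral_add (f := fun x => m ^ 2 * f x ^ 2 - 2 * m * G * f x)
        ((hf2.const_mul _).sub (hf.const_mul _)) (integrable_const _),
      integral_sub (hf2.const_mul _) (hf.const_mul _), integral_const_mul, integral_const_mul,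
      integral_const, ← hG, smul_eq_mul]
  rw [h1] at h0
  have h2 : 0 ≤ m * (m * (∫ x, f x ^ 2 ∂ν) - G ^ 2) := by linarith
  linarith [nonneg_of_mul_nonneg_right h2 hm]

/-- The element of the Cameron-Martin space given by the normalized restriction of the spectral
measure to `I`, with amplitude `A`. -/
noncomputable def spectralShift (μ : Measure ℝ) (A : ℝ) (I : Set ℝ) (t : ℝ) : ℝ :=
  A / μ.real I * ∫ l in I, Real.cos (l * t) ∂μ

theorem sum_spectralShift (A : ℝ) (I : Set ℝ) (c t : κ → ℝ) :
    ∑ i, c i * spectralShift μ A I (t i) =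
      A / μ.real I * ∫ l in I, ∑ i, c i * Real.cos (l * t i) ∂μ := by
  rw [integral_finsetSum _ fun i _ => Integrable.const_mul
    (integrable_of_continuous_of_bounded (by fun_prop) fun l => Real.abs_cos_le_one _) _]
  simp only [spectralShift, integral_const_mul, Finset.mul_sum]
  exact Finset.sum_congr rfl fun i _ => by ring

open Matrix in
theorem dotProduct_integral_gram {ν : Measure ℝ} {U V : ι → ℝ → ℝ}
    (h_int : ∀ i k, Integrable (fun l => U i l * U k l + V i l * V k l) ν) (d : ι → ℝ) :
    d ⬝ᵥ (Matrix.of fun i k => ∫ l, (U i l * U k l + V i l * V k l) ∂ν) *ᵥ d =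
      ∫ l, ((∑ i, d i * U i l) ^ 2 + (∑ i, d i * V i l) ^ 2) ∂ν := by
  have h2 : ∀ l, (∑ i, d i * U i l) ^ 2 + (∑ i, d i * V i l) ^ 2 =
      ∑ i, ∑ j, d i * ((U i l * U j l + V i l * V j l) * d j) := by
    intro l
    simp only [sq, Finset.sum_mul_sum, ← Finset.sum_add_distrib]
    exact Finset.sum_congr rfl fun i _ => Finset.sum_congr rfl fun j _ => by ring
  have hint2 : ∀ i j, Integrable (fun l => d i * ((U i l * U j l + V i l * V j l) * d j)) ν :=
    fun i j => ((h_int i j).mul_const _).const_mul _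
  simp only [h2]
  rw [integral_finsetSum _ fun i _ => integrable_finsetSum _ fun j _ => hint2 i j]
  simp only [dotProduct, mulVec, Matrix.of_apply, Finset.mul_sum]
  refine Finset.sum_congr rfl fun i _ => ?_
  rw [integral_finsetSum _ fun j _ => hint2 i j]
  exact Finset.sum_congr rfl fun j _ => by rw [integral_const_mul, integral_mul_const]

open Matrix in
theorem IsSGP.box_ge [IsProbabilityMeasure P] (hF : IsSGP P μ F) (c t : ι → κ → ℝ) {u a : ι → ℝ}
    (ha : ∀ i, 0 < a i) (hu : ∀ i, 2 ≤ u i)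
    (h : ∀ i, 16 * u i * ∫ l, ((∑ p, c i p * Real.cos (l * t i p)) ^ 2
      + (∑ p, c i p * Real.sin (l * t i p)) ^ 2) ∂μ ≤ a i ^ 2)
    {I : Set ℝ} (hI : 0 < μ.real I) {A : ℝ} (hA : 0 < A) :
    NullMeasurableSet
      {ω | ∀ i, |∑ p, c i p * (F (t i p) ω - spectralShift μ A I (t i p))| ≤ a i} P ∧
    ENNReal.ofReal (Real.exp (-(8 * ∑ i, Real.exp (-u i) + A ^ 2 / (2 * μ.real I)))) ≤
      P {ω | ∀ i, |∑ p, c i p * (F (t i p) ω - spectralShift μ A I (t i p))| ≤ a i} := by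
  set U : ι → ℝ → ℝ := fun i l => ∑ p, c i p * Real.cos (l * t i p) with hU
  set V : ι → ℝ → ℝ := fun i l => ∑ p, c i p * Real.sin (l * t i p) with hV
  have hUc : ∀ i, Continuous (U i) := fun i => continuous_sum_cos _ _
  have hVc : ∀ i, Continuous (V i) := fun i => continuous_sum_sin _ _
  have hUb : ∀ i l, |U i l| ≤ ∑ p, |c i p| := fun i => abs_sum_cos_le _ _
  have hVb : ∀ i l, |V i l| ≤ ∑ p, |c i p| := fun i => abs_sum_sin_le _ _
  have h_int : ∀ i k, Integrable (fun l => U i l * U k l + V i l * V k l) μ := fun i k =>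
    integrable_of_continuous_of_bounded (by fun_prop) (C := (∑ p, |c i p|) * (∑ p, |c k p|) +
      (∑ p, |c i p|) * (∑ p, |c k p|)) fun l => by
      refine (abs_add_le _ _).trans ?_
      rw [abs_mul, abs_mul]
      exact add_le_add
        (mul_le_mul (hUb i l) (hUb k l) (abs_nonneg _) ((abs_nonneg _).trans (hUb i l)))
        (mul_le_mul (hVb i l) (hVb k l) (abs_nonneg _) ((abs_nonneg _).trans (hVb i l)))
  let S : Matrix ι ι ℝ := Matrix.of fun i k => ∫ l, (U i l * U k l + V i l * V k l) ∂μ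
  have hquad : ∀ d : ι → ℝ, d ⬝ᵥ S *ᵥ d =
      ∫ l, ((∑ i, d i * U i l) ^ 2 + (∑ i, d i * V i l) ^ 2) ∂μ :=
    fun d => dotProduct_integral_gram h_int d
  have hS : S.PosSemidef := by
    refine PosSemidef.of_dotProduct_mulVec_nonneg ?_ fun x => ?_
    · ext i k
      simp [S, mul_comm]
    · rw [star_trivial, hquad]
      exact integral_nonneg fun l => by positivity
  have hflat : ∀ (d : ι → ℝ) (f : ι → κ → ℝ), ∑ i, d i * ∑ p, c i p * f i p =
      ∑ x : ι × κ, (d x.1 * c x.1 x.2) * f x.1 x.2 := by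
    intro d f
    rw [Fintype.sum_prod_type]
    simp only [Finset.mul_sum, mul_assoc]
  have hY : ∀ d : ι → ℝ, P.map (fun ω => ∑ i, d i * ∑ p, c i p * F (t i p) ω) =
      gaussianReal 0 (d ⬝ᵥ S *ᵥ d).toNNReal := by
    intro d
    rw [hquad]
    simp only [hU, hV, hflat d fun i p => F (t i p) _, hflat d fun i p => Real.cos (_ * t i p),
      hflat d fun i p => Real.sin (_ * t i p)]
    exact hF.map_sum_s4 (fun x : ι × κ => d x.1 * c x.1 x.2) (fun x => t x.1 x.2)
  have hdiag : ∀ i, 16 * u i * S i i ≤ a i ^ 2 := by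
    intro i
    simpa only [S, Matrix.of_apply, sq] using h i
  have hs : 0 < A / √(μ.real I) := by positivity
  have hs2 : (A / √(μ.real I)) ^ 2 = A ^ 2 / μ.real I := by rw [div_pow, Real.sq_sqrt hI.le]
  have hb : ∀ d : ι → ℝ, ((fun i => ∑ p, c i p * spectralShift μ A I (t i p)) ⬝ᵥ d) ^ 2 ≤
      (A / √(μ.real I)) ^ 2 * (d ⬝ᵥ S *ᵥ d) := by
    intro d
    have h1 : (fun i => ∑ p, c i p * spectralShift μ A I (t i p)) ⬝ᵥ d =
        A / μ.real I * ∫ l in I, ∑ i, d i * U i l ∂μ := by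
      simp only [dotProduct, mul_comm _ (d _)]
      simp only [hU, hflat d fun i p => spectralShift μ A I (t i p),
        hflat d fun i p => Real.cos (_ * t i p)]
      exact sum_spectralShift A I (fun x : ι × κ => d x.1 * c x.1 x.2) (fun x => t x.1 x.2)
    have hmass : (μ.restrict I).real univ = μ.real I := by simp [Measure.real]
    have hb1 : ∀ l, |∑ i, d i * U i l| ≤ ∑ i, |d i| * ∑ p, |c i p| := fun l => by
      refine (Finset.abs_sum_le_sum_abs _ _).trans (Finset.sum_le_sum fun i _ => ?_)
      rw [abs_mul]
      exact mul_le_mul_of_nonneg_left (hUb i l) (abs_nonneg _)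
    have hb2 : ∀ l, |∑ i, d i * V i l| ≤ ∑ i, |d i| * ∑ p, |c i p| := fun l => by
      refine (Finset.abs_sum_le_sum_abs _ _).trans (Finset.sum_le_sum fun i _ => ?_)
      rw [abs_mul]
      exact mul_le_mul_of_nonneg_left (hVb i l) (abs_nonneg _)
    have hsqU : ∀ ν : Measure ℝ, IsFiniteMeasure ν →
        Integrable (fun l => (∑ i, d i * U i l) ^ 2) ν :=
      fun ν _ => integrable_of_continuous_of_bounded (by fun_prop) fun l => by
        rw [abs_pow]
        exact pow_le_pow_left₀ (abs_nonneg _) (hb1 l) 2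
    have hsqV : Integrable (fun l => (∑ i, d i * V i l) ^ 2) μ :=
      integrable_of_continuous_of_bounded (by fun_prop) fun l => by
        rw [abs_pow]
        exact pow_le_pow_left₀ (abs_nonneg _) (hb2 l) 2
    have h2 := sq_integral_le_mul_integral_sq (ν := μ.restrict I) (f := fun l => ∑ i, d i * U i l)
      (by rwa [hmass]) (integrable_of_continuous_of_bounded (by fun_prop) hb1)
      (hsqU _ inferInstance)
    have h3 : ∫ l in I, (∑ i, d i * U i l) ^ 2 ∂μ ≤ d ⬝ᵥ S *ᵥ d := by
      rw [hquad]
      refine (setIntegral_le_integral (hsqU μ inferInstance)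
        (ae_of_all _ fun l => sq_nonneg _)).trans ?_
      exact integral_mono (hsqU μ inferInstance) ((hsqU μ inferInstance).add hsqV)
        fun l => le_add_of_nonneg_right (sq_nonneg _)
    rw [hmass] at h2
    rw [h1, mul_pow, hs2]
    calc (A / μ.real I) ^ 2 * (∫ l in I, ∑ i, d i * U i l ∂μ) ^ 2
        ≤ (A / μ.real I) ^ 2 * (μ.real I * (d ⬝ᵥ S *ᵥ d)) :=
          mul_le_mul_of_nonneg_left (h2.trans (mul_le_mul_of_nonneg_left h3 hI.le)) (sq_nonneg _)
      _ = A ^ 2 / μ.real I * (d ⬝ᵥ S *ᵥ d) := by field_simp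
  have key := gaussian_box_ge P hS hY ha hu hdiag hs hb
  rw [hs2, div_div, mul_comm (μ.real I) 2] at key
  simpa only [mul_sub, Finset.sum_sub_distrib] using key

end Stationary

section Chaining

theorem abs_slope_sub_slope_le {φ φ' : ℝ → ℝ} (hφ : ∀ x, HasDerivAt φ (φ' x) x) {B K : ℝ}
    (hB : ∀ x, |φ' x| ≤ B) (hK : ∀ x y, |φ' x - φ' y| ≤ K * |x - y|) (hK0 : 0 ≤ K)
    {a b x y : ℝ} (hxy : x < y) (hax : a ≤ x) (hyb : y ≤ b) :
    |(φ y - φ x) / (y - x) - (φ b - φ a) / (b - a)| ≤ min (2 * B) (K * (b - a)) := by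
  have hc : Continuous φ := continuous_iff_continuousAt.2 fun x => (hφ x).continuousAt
  obtain ⟨ξ, hξ, h1⟩ := exists_hasDerivAt_eq_slope φ φ' hxy hc.continuousOn fun x _ => hφ x
  obtain ⟨η, hη, h2⟩ := exists_hasDerivAt_eq_slope φ φ' (hax.trans_lt (hxy.trans_le hyb))
    hc.continuousOn fun x _ => hφ x
  rw [← h1, ← h2, le_min_iff]
  constructor
  · calc |φ' ξ - φ' η| ≤ |φ' ξ| + |φ' η| := abs_sub _ _
      _ ≤ 2 * B := by linarith [hB ξ, hB η]
  · refine (hK ξ η).trans (mul_le_mul_of_nonneg_left ?_ hK0)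
    rw [abs_le]
    constructor <;> linarith [hξ.1, hξ.2, hη.1, hη.2]

theorem sq_min_le (l N : ℝ) (hN : 0 < N) :
    (min (2 * |l|) (l ^ 2 * (1 / N))) ^ 2 = l ^ 2 * min 4 (l ^ 2 / N ^ 2) := by
  rcases le_total (2 * |l|) (l ^ 2 * (1 / N)) with h | h
  · rw [min_eq_left h]
    have h1 : (2 * |l|) ^ 2 ≤ (l ^ 2 * (1 / N)) ^ 2 := pow_le_pow_left₀ (by positivity) h 2
    have h2 : (l ^ 2 * (1 / N)) ^ 2 = l ^ 2 * (l ^ 2 / N ^ 2) := by field_simp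
    rw [mul_pow, sq_abs, h2] at h1
    rcases eq_or_ne l 0 with rfl | hl
    · simp
    · have : 4 ≤ l ^ 2 / N ^ 2 := by
        refine le_of_mul_le_mul_left (a := l ^ 2) ?_ (by positivity)
        linarith
      rw [min_eq_left this, mul_pow, sq_abs]
      ring
  · rw [min_eq_right h]
    have h1 : (l ^ 2 * (1 / N)) ^ 2 ≤ (2 * |l|) ^ 2 := pow_le_pow_left₀ (by positivity) h 2
    have h2 : (l ^ 2 * (1 / N)) ^ 2 = l ^ 2 * (l ^ 2 / N ^ 2) := by field_simp
    rw [h2, mul_pow, sq_abs] at h1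
    rcases eq_or_ne l 0 with rfl | hl
    · simp
    · have : l ^ 2 / N ^ 2 ≤ 4 := by
        refine le_of_mul_le_mul_left (a := l ^ 2) ?_ (by positivity)
        linarith
      rw [min_eq_right this, h2]

/-- The number of grid points per unit length at level `j`. -/
def gridSize (j : ℕ) : ℕ := 2 ^ (2 ^ j - 1)

theorem gridSize_pos (j : ℕ) : 0 < gridSize j := by unfold gridSize; positivity

theorem gridSize_zero : gridSize 0 = 1 := rfl

theorem gridSize_succ (j : ℕ) : gridSize (j + 1) = gridSize j * 2 ^ 2 ^ j := by
  unfold gridSize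
  rw [← pow_add]
  congr 1
  have : 1 ≤ 2 ^ j := Nat.one_le_two_pow
  rw [pow_succ]
  omega

theorem two_mul_gridSize (j : ℕ) : 2 * gridSize j = 2 ^ 2 ^ j := by
  unfold gridSize
  rw [← pow_succ']
  congr 1
  have : 1 ≤ 2 ^ j := Nat.one_le_two_pow
  omega

theorem lt_gridSize (j : ℕ) : j ≤ gridSize j := by
  unfold gridSize
  have h1 : 2 ^ j - 1 < 2 ^ (2 ^ j - 1) := Nat.lt_two_pow_self
  have h2 : j < 2 ^ j := Nat.lt_two_pow_self
  omega

theorem min_div_gridSize_le (l : ℝ) (j : ℕ) :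
    min 4 (l ^ 2 / (gridSize j : ℝ) ^ 2) ≤ 256 * (1 / 4) ^ j * (1 + Real.log |l| ^ 2) := by
  have hN : (0 : ℝ) < gridSize j := by exact_mod_cast gridSize_pos j
  rcases le_or_gt (l ^ 2) (gridSize j) with h | h
  · have h1 : l ^ 2 / (gridSize j : ℝ) ^ 2 ≤ 1 / gridSize j := by
      rw [div_le_div_iff₀ (by positivity) hN]
      nlinarith
    have h2 : (1 : ℝ) / gridSize j ≤ 256 * (1 / 4) ^ j := by
      have h3 : (4 : ℝ) ^ j ≤ 256 * gridSize j := by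
        have h4 : ((2 : ℝ) ^ j) ^ 2 ≤ 8 * 2 ^ 2 ^ j := by
          have : ∀ x : ℕ, (x : ℝ) ^ 2 ≤ 8 * 2 ^ x ∧ (2 * x + 1 : ℝ) ≤ 8 * 2 ^ x := by
            intro x
            induction x with
            | zero => norm_num
            | succ x ih =>
              obtain ⟨i1, i2⟩ := ih
              have : (1 : ℝ) ≤ 2 ^ x := one_le_pow₀ (by norm_num)
              push_cast
              rw [pow_succ (2 : ℝ) x]
              constructor <;> nlinarith
          simpa using (this (2 ^ j)).1
        have h5 : (2 : ℝ) * gridSize j = 2 ^ 2 ^ j := by exact_mod_cast two_mul_gridSize j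
        rw [← h5, ← pow_mul, mul_comm j 2, pow_mul] at h4
        norm_num at h4
        linarith
      rw [one_div_pow, mul_one_div, div_le_div_iff₀ hN (by positivity), one_mul]
      exact h3
    calc _ ≤ 1 / (gridSize j : ℝ) := (min_le_right _ _).trans h1
      _ ≤ 256 * (1 / 4) ^ j * 1 := by linarith
      _ ≤ _ := by gcongr; nlinarith [sq_nonneg (Real.log |l|)]
  · refine (min_le_left _ _).trans ?_
    have h1 : Real.log (gridSize j) ≤ 2 * Real.log |l| := by
      have := Real.log_le_log hN h.le
      rwa [← sq_abs, Real.log_pow, Nat.cast_ofNat] at this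
    have h2 : Real.log 2 + Real.log (gridSize j) = 2 ^ j * Real.log 2 := by
      rw [← Real.log_mul (by norm_num) hN.ne']
      have h5 : (2 : ℝ) * gridSize j = 2 ^ 2 ^ j := by exact_mod_cast two_mul_gridSize j
      rw [h5, Real.log_pow]
      norm_num
    have h3 := Real.log_two_gt_d9
    have h4 : (4 : ℝ) ^ j ≤ 64 * (1 + Real.log |l| ^ 2) := by
      rcases Nat.eq_zero_or_pos j with rfl | hj
      · norm_num
        nlinarith [sq_nonneg (Real.log |l|)]
      · have h6 : (2 : ℝ) ≤ 2 ^ j := by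
          calc (2 : ℝ) = 2 ^ 1 := by norm_num
            _ ≤ 2 ^ j := pow_le_pow_right₀ (by norm_num) hj
        have h7 : (4 : ℝ) ^ j = (2 ^ j) ^ 2 := by rw [← pow_mul, mul_comm, pow_mul]; norm_num
        have h8 : (2 : ℝ) ^ j / 8 ≤ Real.log |l| := by nlinarith
        rw [h7]
        nlinarith [mul_self_le_mul_self (by positivity) h8]
    have h5 : (0 : ℝ) < (1 / 4) ^ j := by positivity
    have h6 : (1 / 4 : ℝ) ^ j * 4 ^ j = 1 := by rw [← mul_pow]; norm_num
    nlinarith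

/-- The difference quotient of `g` over the `m`-th cell of the grid of mesh `1 / N`. -/
noncomputable def gridSlope (N : ℕ) (g : ℝ → ℝ) (m : ℕ) : ℝ :=
  N * (g ((m + 1) / N) - g (m / N))

theorem gridSlope_sub_sq_le {φ φ' : ℝ → ℝ} (hφ : ∀ x, HasDerivAt φ (φ' x) x) {l : ℝ}
    (hB : ∀ x, |φ' x| ≤ |l|) (hK : ∀ x y, |φ' x - φ' y| ≤ l ^ 2 * |x - y|) {N k : ℕ} (hN : 0 < N)
    (hk : 0 < k) (m : ℕ) :
    (gridSlope (N * k) φ m - gridSlope N φ (m / k)) ^ 2 ≤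
      l ^ 2 * min 4 (l ^ 2 / (N : ℝ) ^ 2) := by
  have hN' : (0 : ℝ) < N := by exact_mod_cast hN
  have hk' : (0 : ℝ) < k := by exact_mod_cast hk
  have h1 : ((m / k : ℕ) : ℝ) * k ≤ m := by exact_mod_cast Nat.div_mul_le_self m k
  have h2 : (m : ℝ) + 1 ≤ ((m / k : ℕ) + 1) * k := by
    have : m + 1 ≤ (m / k + 1) * k := by
      have := Nat.lt_div_mul_add hk (a := m)
      linarith
    exact_mod_cast this
  have key := abs_slope_sub_slope_le hφ hB hK (sq_nonneg l)
    (a := (m / k : ℕ) / (N : ℝ)) (b := ((m / k : ℕ) + 1) / (N : ℝ))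
    (x := m / ((N * k : ℕ) : ℝ)) (y := (m + 1) / ((N * k : ℕ) : ℝ)) (by
      push_cast
      gcongr
      linarith) (by
      push_cast
      rw [div_le_div_iff₀ (by positivity) (by positivity)]
      nlinarith) (by
      push_cast
      rw [div_le_div_iff₀ (by positivity) (by positivity)]
      nlinarith)
  have e1 : ∀ (M : ℕ) (x : ℝ), 0 < M → (x + 1) / (M : ℝ) - x / M = 1 / M := by
    intro M x hM
    field_simp
    ring
  rw [e1 _ _ hN, e1 _ _ (Nat.mul_pos hN hk)] at key
  rw [← sq_min_le l N hN', ← sq_abs]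
  refine pow_le_pow_left₀ (abs_nonneg _) ?_ 2
  simp only [div_div_eq_mul_div, div_one, mul_comm _ (N : ℝ), mul_comm _ ((N * k : ℕ) : ℝ)] at key
  exact key

theorem gridSlope_cos_sin_le (l : ℝ) {N k : ℕ} (hN : 0 < N) (hk : 0 < k) (m : ℕ) :
    (gridSlope (N * k) (fun t => Real.cos (l * t)) m -
      gridSlope N (fun t => Real.cos (l * t)) (m / k)) ^ 2 +
    (gridSlope (N * k) (fun t => Real.sin (l * t)) m -
      gridSlope N (fun t => Real.sin (l * t)) (m / k)) ^ 2 ≤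
      2 * (l ^ 2 * min 4 (l ^ 2 / (N : ℝ) ^ 2)) := by
  have hcos : ∀ x, HasDerivAt (fun t => Real.cos (l * t)) (-Real.sin (l * x) * l) x := fun x => by
    simpa using ((hasDerivAt_id x).const_mul l).cos
  have hsin : ∀ x, HasDerivAt (fun t => Real.sin (l * t)) (Real.cos (l * x) * l) x := fun x => by
    simpa using ((hasDerivAt_id x).const_mul l).sin
  have h1 := gridSlope_sub_sq_le hcos (l := l) (fun x => by
    rw [abs_mul, abs_neg]
    exact mul_le_of_le_one_left (abs_nonneg _) (Real.abs_sin_le_one _)) (fun x y => by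
    rw [← sub_mul, abs_mul, neg_sub_neg, ← sq_abs l, sq]
    have := Real.abs_sin_sub_sin_le (l * y) (l * x)
    rw [← mul_sub, abs_mul, abs_sub_comm y x] at this
    nlinarith [abs_nonneg l]) hN hk m
  have h2 := gridSlope_sub_sq_le hsin (l := l) (fun x => by
    rw [abs_mul]
    exact mul_le_of_le_one_left (abs_nonneg _) (Real.abs_cos_le_one _)) (fun x y => by
    rw [← sub_mul, abs_mul, ← sq_abs l, sq]
    have := Real.abs_cos_sub_cos_le (l * x) (l * y)
    rw [← mul_sub, abs_mul] at this
    nlinarith [abs_nonneg l]) hN hk m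
  linarith

/-- Control of the increments of difference quotients along the grids gives a Lipschitz bound. -/
theorem lipschitz_of_gridSlope {g : ℝ → ℝ} (hg : Continuous g) {n : ℕ} {M α : ℝ} (hα : 0 ≤ α)
    (h0 : ∀ i ≤ n, |g i| ≤ M)
    (h : ∀ j, ∀ m < gridSize (j + 1) * n, |gridSlope (gridSize (j + 1)) g m -
      gridSlope (gridSize j) g (m / 2 ^ 2 ^ j)| ≤ α * (3 / 4) ^ j) :
    (∀ x ∈ Icc (0 : ℝ) n, |g x| ≤ 3 * M + 4 * α) ∧
    ∀ x ∈ Icc (0 : ℝ) n, ∀ y ∈ Icc (0 : ℝ) n, |g x - g y| ≤ (3 * M + 4 * α) * |x - y| := by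
  have hM : 0 ≤ M := (abs_nonneg _).trans (h0 0 (Nat.zero_le n))
  have hslope : ∀ j, ∀ m < gridSize j * n,
      |gridSlope (gridSize j) g m| ≤ 2 * M + 4 * α * (1 - (3 / 4) ^ j) := by
    intro j
    induction j with
    | zero =>
      intro m hm
      rw [gridSize_zero, one_mul] at hm
      have h1 := h0 m hm.le
      have h2 := h0 (m + 1) hm
      have h3 := abs_sub (g ((m + 1 : ℕ) : ℝ)) (g m)
      simp only [gridSlope, gridSize_zero, Nat.cast_one, div_one, one_mul, pow_zero, sub_self,
        mul_zero, add_zero]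
      push_cast at h2 h3
      linarith
    | succ j ih =>
      intro m hm
      have h1 : m / 2 ^ 2 ^ j < gridSize j * n := by
        rw [Nat.div_lt_iff_lt_mul (by positivity)]
        calc m < gridSize (j + 1) * n := hm
          _ = _ := by rw [gridSize_succ]; ring
      have h2 := ih _ h1
      have h3 := h j m hm
      have h4 := abs_sub_abs_le_abs_sub (gridSlope (gridSize (j + 1)) g m)
        (gridSlope (gridSize j) g (m / 2 ^ 2 ^ j))
      rw [pow_succ]
      linarith
  have hslope' : ∀ j, ∀ m < gridSize j * n,
      |g ((m + 1 : ℕ) / (gridSize j : ℝ)) - g (m / (gridSize j : ℝ))| ≤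
        (2 * M + 4 * α) / gridSize j := by
    intro j m hm
    have hN : (0 : ℝ) < gridSize j := by exact_mod_cast gridSize_pos j
    have h1 := hslope j m hm
    rw [gridSlope, abs_mul, Nat.abs_cast] at h1
    rw [le_div_iff₀ hN, mul_comm]
    push_cast
    refine h1.trans ?_
    have : (0 : ℝ) < (3 / 4) ^ j := by positivity
    nlinarith
  have hgrid : ∀ j, ∀ a d : ℕ, a + d ≤ gridSize j * n →
      |g ((a + d : ℕ) / (gridSize j : ℝ)) - g (a / (gridSize j : ℝ))| ≤
        (2 * M + 4 * α) * (d / gridSize j) := by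
    intro j a d
    induction d with
    | zero => simp
    | succ d ih =>
      intro hd
      have h1 := ih (by omega)
      have h2 := hslope' j (a + d) (by omega)
      have h3 := abs_sub_le (g ((a + (d + 1) : ℕ) / (gridSize j : ℝ)))
        (g ((a + d : ℕ) / (gridSize j : ℝ))) (g (a / (gridSize j : ℝ)))
      rw [← add_assoc] at h3 ⊢
      refine h3.trans ((add_le_add h2 h1).trans (le_of_eq ?_))
      push_cast
      ring
  have hNlim : Filter.Tendsto (fun j => (gridSize j : ℝ)) Filter.atTop Filter.atTop :=
    tendsto_natCast_atTop_atTop.comp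
      (Filter.tendsto_atTop_mono lt_gridSize Filter.tendsto_id)
  have hfl : ∀ x : ℝ, 0 ≤ x → Filter.Tendsto (fun j => (⌊x * gridSize j⌋₊ : ℝ) / gridSize j)
      Filter.atTop (nhds x) := fun x hx => (tendsto_nat_floor_mul_div_atTop hx).comp hNlim
  have hmono : ∀ x ∈ Icc (0 : ℝ) n, ∀ y ∈ Icc (0 : ℝ) n, y ≤ x →
      |g x - g y| ≤ (2 * M + 4 * α) * (x - y) := by
    intro x hx y hy hyx
    have l1 := ((hg.tendsto x).comp (hfl x hx.1)).sub ((hg.tendsto y).comp (hfl y hy.1))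
    have l2 := ((hfl x hx.1).sub (hfl y hy.1)).const_mul (2 * M + 4 * α)
    refine le_of_tendsto_of_tendsto' l1.abs l2 fun j => ?_
    have h1 : ⌊y * gridSize j⌋₊ ≤ ⌊x * gridSize j⌋₊ := Nat.floor_le_floor (by gcongr)
    have h2 : ⌊x * gridSize j⌋₊ ≤ gridSize j * n := by
      refine Nat.floor_le_of_le ?_
      push_cast
      nlinarith [hx.2, (Nat.cast_nonneg (gridSize j) : (0 : ℝ) ≤ gridSize j)]
    obtain ⟨d, hd⟩ := Nat.exists_eq_add_of_le h1
    have h3 := hgrid j ⌊y * gridSize j⌋₊ d (by omega)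
    rw [← hd] at h3
    refine h3.trans (le_of_eq ?_)
    rw [hd]
    push_cast
    ring
  constructor
  · intro x hx
    have h1 : ⌊x⌋₊ ≤ n := Nat.floor_le_of_le hx.2
    have h2 : (⌊x⌋₊ : ℝ) ≤ x := Nat.floor_le hx.1
    have h3 := Nat.lt_floor_add_one x
    have h4 := hmono x hx ⌊x⌋₊ ⟨Nat.cast_nonneg _, by exact_mod_cast h1⟩ h2
    have h5 := h0 _ h1
    have h6 := abs_sub_abs_le_abs_sub (g x) (g ⌊x⌋₊)
    nlinarith
  · intro x hx y hy
    rcases le_total y x with hyx | hxy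
    · rw [abs_of_nonneg (sub_nonneg.2 hyx)]
      nlinarith [hmono x hx y hy hyx]
    · rw [abs_sub_comm (g x), abs_sub_comm x, abs_of_nonneg (sub_nonneg.2 hxy)]
      nlinarith [hmono y hy x hx hxy]

end Chaining

section Lipschitz

theorem integrable_sq_mul_one_add_log_sq {μ : Measure ℝ} [IsFiniteMeasure μ]
    (hmom : Integrable (fun l : ℝ => l ^ 2 * (Real.log |l|) ^ 2) μ) :
    Integrable (fun l : ℝ => l ^ 2 * (1 + (Real.log |l|) ^ 2)) μ := by
  have h1 : Integrable (fun l : ℝ => 9 + l ^ 2 * (Real.log |l|) ^ 2) μ :=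
    (integrable_const 9).add hmom
  have h2 : Integrable (fun l : ℝ => l ^ 2) μ := by
    refine h1.mono' (by fun_prop) (ae_of_all _ fun l => ?_)
    rw [Real.norm_eq_abs, abs_of_nonneg (sq_nonneg l)]
    rcases le_total |l| 3 with h | h
    · have h3 : |l| ^ 2 ≤ 3 ^ 2 := pow_le_pow_left₀ (abs_nonneg l) h 2
      rw [sq_abs] at h3
      have : 0 ≤ l ^ 2 * (Real.log |l|) ^ 2 := by positivity
      linarith
    · have h3 : 1 ≤ Real.log |l| := by
        rw [Real.le_log_iff_exp_le (by linarith)]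
        linarith [Real.exp_one_lt_d9]
      have h4 : 1 ≤ (Real.log |l|) ^ 2 := one_le_pow₀ h3
      nlinarith [sq_nonneg l]
  have h3 : (fun l : ℝ => l ^ 2 * (1 + (Real.log |l|) ^ 2)) =
      fun l => l ^ 2 + l ^ 2 * (Real.log |l|) ^ 2 := by ext l; ring
  rw [h3]
  exact h2.add hmom

theorem gridSize_mul_exp_le (j : ℕ) :
    (gridSize (j + 1) : ℝ) * Real.exp (-(4 * 2 ^ j)) ≤ (1 / 2) ^ (j + 1) := by
  have h1 : (gridSize (j + 1) : ℝ) ≤ Real.exp (2 * 2 ^ j) := by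
    have h2 : (gridSize (j + 1) : ℝ) ≤ 2 ^ 2 ^ (j + 1) := by
      exact_mod_cast (by rw [← two_mul_gridSize]; omega : gridSize (j + 1) ≤ 2 ^ 2 ^ (j + 1))
    refine h2.trans ?_
    have h3 : Real.exp (2 * 2 ^ j) = Real.exp 1 ^ 2 ^ (j + 1) := by
      rw [← Real.exp_nat_mul]
      congr 1
      push_cast
      ring
    rw [h3]
    exact pow_le_pow_left₀ (by norm_num) (by linarith [Real.exp_one_gt_d9]) _
  have h4 : (2 : ℝ) ^ (j + 1) ≤ Real.exp (2 * 2 ^ j) := by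
    have := Real.add_one_le_exp ((2 : ℝ) * 2 ^ j)
    rw [pow_succ]
    linarith
  calc (gridSize (j + 1) : ℝ) * Real.exp (-(4 * 2 ^ j))
      ≤ Real.exp (2 * 2 ^ j) * Real.exp (-(4 * 2 ^ j)) := by gcongr
    _ = (Real.exp (2 * 2 ^ j))⁻¹ := by
        rw [← Real.exp_add, ← Real.exp_neg]
        congr 1
        ring
    _ ≤ (2 ^ (j + 1))⁻¹ := by gcongr
    _ = (1 / 2) ^ (j + 1) := by simp

theorem continuous_spectralShift (μ : Measure ℝ) [IsFiniteMeasure μ] (A : ℝ) (I : Set ℝ) :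
    Continuous (spectralShift μ A I) := by
  refine continuous_const.mul (continuous_of_dominated (bound := fun _ => 1) (fun t => ?_)
    (fun t => ae_of_all _ fun l => ?_) (integrable_const _) (ae_of_all _ fun l => ?_))
  · exact (by fun_prop : Continuous fun l : ℝ => Real.cos (l * t)).aestronglyMeasurable
  · exact Real.abs_cos_le_one _
  · fun_prop

variable {Ω : Type*} [MeasurableSpace Ω] {P : Measure Ω} [IsProbabilityMeasure P]
  {μ : Measure ℝ} [IsProbabilityMeasure μ] {F : ℝ → Ω → ℝ}

theorem IsSGP.grid_ge (hF : IsSGP P μ F)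
    (hmom : Integrable (fun l : ℝ => l ^ 2 * (Real.log |l|) ^ 2) μ) :
    ∃ α > (0 : ℝ), ∀ (n J : ℕ) {I : Set ℝ}, 0 < μ.real I → ∀ {A : ℝ}, 0 < A →
      ∃ E : Set Ω, NullMeasurableSet E P ∧
        ENNReal.ofReal (Real.exp (-(16 * (n + 1) + A ^ 2 / (2 * μ.real I)))) ≤ P E ∧
        E = {ω | (∀ i ≤ n, |F i ω - spectralShift μ A I i| ≤ 6) ∧
          ∀ j < J, ∀ m < gridSize (j + 1) * n,
            |gridSlope (gridSize (j + 1)) (fun t => F t ω - spectralShift μ A I t) m -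
              gridSlope (gridSize j) (fun t => F t ω - spectralShift μ A I t) (m / 2 ^ 2 ^ j)| ≤
              α * (3 / 4) ^ j} := by
  set V := ∫ l, l ^ 2 * (1 + (Real.log |l|) ^ 2) ∂μ with hV
  have hV0 : 0 ≤ V := integral_nonneg fun l => by positivity
  refine ⟨32768 * V + 1, by positivity, fun n J I hI A hA => ?_⟩
  let ι := Fin (n + 1) ⊕ (Σ j : Fin J, Fin (gridSize (j + 1) * n))
  let c : ι → Fin 4 → ℝ := Sum.elim (fun _ => ![1, 0, 0, 0]) fun x =>
    ![(gridSize (x.1 + 1) : ℝ), -(gridSize (x.1 + 1) : ℝ), -(gridSize x.1 : ℝ), gridSize x.1]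
  let t : ι → Fin 4 → ℝ := Sum.elim (fun i => ![(i : ℕ), 0, 0, 0]) fun x =>
    ![((x.2 : ℕ) + 1) / (gridSize (x.1 + 1) : ℝ), (x.2 : ℕ) / (gridSize (x.1 + 1) : ℝ),
      (((x.2 : ℕ) / 2 ^ 2 ^ (x.1 : ℕ) : ℕ) + 1) / (gridSize x.1 : ℝ),
      ((x.2 : ℕ) / 2 ^ 2 ^ (x.1 : ℕ) : ℕ) / (gridSize x.1 : ℝ)]
  let u : ι → ℝ := Sum.elim (fun _ => 2) fun x => 4 * 2 ^ (x.1 : ℕ)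
  let a : ι → ℝ := Sum.elim (fun _ => 6) fun x => (32768 * V + 1) * (3 / 4) ^ (x.1 : ℕ)
  have hinl : ∀ (i : Fin (n + 1)) (f : ℝ → ℝ),
      ∑ p, c (Sum.inl i) p * f (t (Sum.inl i) p) = f (i : ℕ) := by
    intro i f
    simp [c, t, Fin.sum_univ_four]
  have hinr : ∀ (x : Σ j : Fin J, Fin (gridSize (j + 1) * n)) (f : ℝ → ℝ),
      ∑ p, c (Sum.inr x) p * f (t (Sum.inr x) p) = gridSlope (gridSize (x.1 + 1)) f x.2 -
        gridSlope (gridSize x.1) f ((x.2 : ℕ) / 2 ^ 2 ^ (x.1 : ℕ)) := by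
    intro x f
    simp only [c, t, Fin.sum_univ_four, gridSlope, Sum.elim_inr, Matrix.cons_val]
    ring
  have ha : ∀ i, 0 < a i := by
    rintro (i | x) <;> simp only [a, Sum.elim_inl, Sum.elim_inr] <;> positivity
  have hu : ∀ i, 2 ≤ u i := by
    rintro (i | x)
    · exact le_rfl
    · have : (1 : ℝ) ≤ 2 ^ (x.1 : ℕ) := one_le_pow₀ (by norm_num)
      simp only [u, Sum.elim_inr]
      linarith
  have hvar : ∀ i, 16 * u i * ∫ l, ((∑ p, c i p * Real.cos (l * t i p)) ^ 2
      + (∑ p, c i p * Real.sin (l * t i p)) ^ 2) ∂μ ≤ a i ^ 2 := by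
    rintro (i | x)
    · have hcos := fun l => hinl i fun s => Real.cos (l * s)
      have hsin := fun l => hinl i fun s => Real.sin (l * s)
      simp only [hcos, hsin,
        Real.cos_sq_add_sin_sq, integral_const, probReal_univ, one_smul]
      norm_num [u, a]
    · have hcos := fun l => hinr x fun s => Real.cos (l * s)
      have hsin := fun l => hinr x fun s => Real.sin (l * s)
      simp only [hcos, hsin]
      set j : ℕ := (x.1 : ℕ) with hj
      have hle : ∀ (l : ℝ) (m : ℕ), (gridSlope (gridSize (j + 1)) (fun s => Real.cos (l * s)) m -
          gridSlope (gridSize j) (fun s => Real.cos (l * s)) (m / 2 ^ 2 ^ j)) ^ 2 +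
          (gridSlope (gridSize (j + 1)) (fun s => Real.sin (l * s)) m -
          gridSlope (gridSize j) (fun s => Real.sin (l * s)) (m / 2 ^ 2 ^ j)) ^ 2 ≤
          512 * (1 / 4) ^ j * (l ^ 2 * (1 + (Real.log |l|) ^ 2)) := by
        intro l m
        rw [gridSize_succ]
        refine (gridSlope_cos_sin_le l (gridSize_pos j) (by positivity) m).trans ?_
        have := mul_le_mul_of_nonneg_left (min_div_gridSize_le l j) (sq_nonneg l)
        linarith
      have h_int := integral_mono_of_nonneg (μ := μ) (ae_of_all _ fun l => by positivity)
        ((integrable_sq_mul_one_add_log_sq hmom).const_mul (512 * (1 / 4) ^ j))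
        (ae_of_all _ fun l => hle l x.2)
      rw [integral_const_mul, ← hV] at h_int
      simp only [u, a, Sum.elim_inr, ← hj]
      have h1 : (2 : ℝ) ^ j * (1 / 4) ^ j = (1 / 2) ^ j := by rw [← mul_pow]; norm_num
      have h2 : (1 / 2 : ℝ) ^ j ≤ (9 / 16) ^ j := pow_le_pow_left₀ (by norm_num) (by norm_num) _
      have h3 : ((3 / 4 : ℝ) ^ j) ^ 2 = (9 / 16) ^ j := by
        rw [← pow_mul, mul_comm, pow_mul]; norm_num
      calc _ ≤ 16 * (4 * 2 ^ j) * (512 * (1 / 4) ^ j * V) := by gcongr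
        _ = 32768 * V * (2 ^ j * (1 / 4) ^ j) := by ring
        _ ≤ 32768 * V * (9 / 16) ^ j := by rw [h1]; gcongr
        _ ≤ (32768 * V + 1) ^ 2 * (9 / 16) ^ j := by gcongr; nlinarith
        _ = _ := by rw [mul_pow, h3]
  obtain ⟨hmeas, hge⟩ := hF.box_ge c t ha hu hvar hI hA
  refine ⟨_, hmeas, le_trans ?_ hge, ?_⟩
  · refine ENNReal.ofReal_le_ofReal (Real.exp_le_exp.2 (neg_le_neg ?_))
    have hcost : ∑ i, Real.exp (-u i) ≤ (n + 1) + n := by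
      rw [Fintype.sum_sum_type, Fintype.sum_sigma]
      simp only [u, Sum.elim_inl, Sum.elim_inr, Finset.sum_const, Finset.card_univ,
        Fintype.card_fin, nsmul_eq_mul]
      refine add_le_add ?_ ?_
      · have := exp_neg_le_quarter le_rfl
        push_cast
        nlinarith [(Nat.cast_nonneg n : (0 : ℝ) ≤ n)]
      · have h1 : ∀ j : Fin J, ((gridSize (j + 1) * n : ℕ) : ℝ) * Real.exp (-(4 * 2 ^ (j : ℕ))) ≤
            n * (1 / 2) ^ ((j : ℕ) + 1) := by
          intro j
          have := mul_le_mul_of_nonneg_left (gridSize_mul_exp_le j)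
            (Nat.cast_nonneg n : (0 : ℝ) ≤ n)
          push_cast
          linarith
        refine (Finset.sum_le_sum fun j _ => h1 j).trans ?_
        rw [← Finset.mul_sum, Fin.sum_univ_eq_sum_range fun j => (1 / 2 : ℝ) ^ (j + 1)]
        refine mul_le_of_le_one_right (Nat.cast_nonneg n) ?_
        have h2 : ∀ K : ℕ, ∑ j ∈ Finset.range K, (1 / 2 : ℝ) ^ (j + 1) = 1 - (1 / 2) ^ K := by
          intro K
          induction K with
          | zero => simp
          | succ K ih => rw [Finset.sum_range_succ, ih, pow_succ]; ring
        rw [h2]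
        have : (0 : ℝ) < (1 / 2) ^ J := by positivity
        linarith
    linarith
  · ext ω
    simp only [Set.mem_ofPred_eq]
    constructor
    · intro h
      constructor
      · intro i hi
        have := h (Sum.inl ⟨i, Nat.lt_succ_of_le hi⟩)
        rwa [hinl ⟨i, _⟩ fun s => F s ω - spectralShift μ A I s] at this
      · intro j hj m hm
        have := h (Sum.inr ⟨⟨j, hj⟩, ⟨m, hm⟩⟩)
        rwa [hinr ⟨⟨j, hj⟩, ⟨m, hm⟩⟩ fun s => F s ω - spectralShift μ A I s] at this
    · rintro ⟨h1, h2⟩ (i | x)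
      · rw [hinl i fun s => F s ω - spectralShift μ A I s]
        exact h1 i (Nat.le_of_lt_succ i.2)
      · rw [hinr x fun s => F s ω - spectralShift μ A I s]
        exact h2 x.1 x.1.2 x.2 x.2.2

theorem IsSGP.lipschitz_ge (hF : IsSGP P μ F)
    (hmom : Integrable (fun l : ℝ => l ^ 2 * (Real.log |l|) ^ 2) μ) :
    ∃ Λ > (0 : ℝ), ∀ (n : ℕ) {I : Set ℝ}, 0 < μ.real I → ∀ {A : ℝ}, 0 < A →
      ENNReal.ofReal (Real.exp (-(16 * (n + 1) + A ^ 2 / (2 * μ.real I)))) ≤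
        P {ω | (∀ x ∈ Icc (0 : ℝ) n, |F x ω - spectralShift μ A I x| ≤ Λ) ∧
          ∀ x ∈ Icc (0 : ℝ) n, ∀ y ∈ Icc (0 : ℝ) n,
            |(F x ω - spectralShift μ A I x) - (F y ω - spectralShift μ A I y)| ≤ Λ * |x - y|} := by
  obtain ⟨α, hα, h⟩ := hF.grid_ge hmom
  refine ⟨3 * 6 + 4 * α, by positivity, fun n I hI A hA => ?_⟩
  choose E hEm hEge hE using fun J => h n J hI hA
  have hanti : Antitone E := by
    intro J K hJK
    rw [hE, hE]
    exact fun ω hω => ⟨hω.1, fun j hj => hω.2 j (hj.trans_le hJK)⟩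
  have hlim := tendsto_measure_iInter_atTop hEm hanti ⟨0, measure_ne_top P _⟩
  refine (ge_of_tendsto' hlim hEge).trans (measure_mono fun ω hω => ?_)
  have hω' : ∀ J, ω ∈ E J := fun J => Set.mem_iInter.1 hω J
  simp only [hE] at hω'
  exact lipschitz_of_gridSlope (g := fun t => F t ω - spectralShift μ A I t)
    ((hF.1 ω).sub (continuous_spectralShift μ A I)) hα.le (hω' 0).1
    fun j => (hω' (j + 1)).2 j (Nat.lt_succ_self j)

end Lipschitz

section Zeros

theorem half_sub_lt_abs_cos_sub_cos {a b : ℝ} (ha : 0 ≤ a) (hab : a < b) (hb : b ≤ Real.pi)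
    (hca : |Real.cos a| ≤ 1 / 2) (hcb : |Real.cos b| ≤ 1 / 2) :
    (b - a) / 2 < |Real.cos b - Real.cos a| := by
  obtain ⟨ξ, hξ, h⟩ := exists_hasDerivAt_eq_slope Real.cos (fun x => -Real.sin x) hab
    Real.continuous_cos.continuousOn fun x _ => Real.hasDerivAt_cos x
  have h1 : Real.cos ξ ≤ Real.cos a :=
    Real.cos_le_cos_of_nonneg_of_le_pi ha (hξ.2.le.trans hb) hξ.1.le
  have h2 : Real.cos b ≤ Real.cos ξ :=
    Real.cos_le_cos_of_nonneg_of_le_pi (ha.trans hξ.1.le) hb hξ.2.le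
  rw [abs_le] at hca hcb
  have h3 : 1 / 2 < Real.sin ξ := by
    have h4 : 0 ≤ Real.sin ξ :=
      Real.sin_nonneg_of_nonneg_of_le_pi (ha.trans hξ.1.le) (hξ.2.le.trans hb)
    nlinarith [Real.sin_sq_add_cos_sq ξ]
  rw [eq_div_iff (sub_pos.2 hab).ne'] at h
  rw [abs_sub_comm]
  refine lt_of_lt_of_le ?_ (le_abs_self _)
  nlinarith

/-- A small Lipschitz perturbation of `cos (w t)` has as many zeros as `cos (w t)`, up to one. -/
theorem encard_zeros_cos_add {w T : ℝ} (hw : 0 < w) (hT : 0 ≤ T) {f : ℝ → ℝ} (hf : Continuous f)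
    (h1 : ∀ t ∈ Icc (0 : ℝ) T, |f t - Real.cos (w * t)| ≤ 1 / 2)
    (h2 : ∀ s ∈ Icc (0 : ℝ) T, ∀ t ∈ Icc (0 : ℝ) T,
      |(f s - Real.cos (w * s)) - (f t - Real.cos (w * t))| ≤ w / 2 * |s - t|) :
    ∃ n : ℕ, {t ∈ Icc (0 : ℝ) T | f t = 0}.encard = n ∧
      w * T / Real.pi - 1 ≤ n ∧ n ≤ w * T / Real.pi + 1 := by
  have hπ := Real.pi_pos
  set Z := {t ∈ Icc (0 : ℝ) T | f t = 0} with hZ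
  let k : ℝ → ℕ := fun t => ⌊w * t / Real.pi⌋₊
  have hk : ∀ t, 0 ≤ t → 0 ≤ w * t - k t * Real.pi ∧ w * t - k t * Real.pi ≤ Real.pi := by
    intro t ht
    have e1 := Nat.floor_le (a := w * t / Real.pi) (by positivity)
    have e2 := Nat.lt_floor_add_one (w * t / Real.pi)
    rw [le_div_iff₀ hπ] at e1
    rw [div_lt_iff₀ hπ] at e2
    constructor <;> simp only [k] <;> linarith
  have habs : ∀ (x : ℝ) (m : ℕ), |Real.cos (x - m * Real.pi)| = |Real.cos x| := by
    intro x m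
    rw [Real.cos_sub_nat_mul_pi, abs_mul, abs_pow, abs_neg, abs_one, one_pow, one_mul]
  have hlt : ∀ s ∈ Z, ∀ t ∈ Z, k s = k t → ¬ s < t := by
    rintro s ⟨hs, hs0⟩ t ⟨ht, ht0⟩ hst hlt
    have c1 := h1 s hs
    have c2 := h1 t ht
    have c3 := h2 s hs t ht
    have b1 := hk s hs.1
    have b2 := hk t ht.1
    rw [← hst] at b2
    rw [hs0, zero_sub, abs_neg, ← habs _ (k s)] at c1
    rw [ht0, zero_sub, abs_neg, ← habs _ (k s)] at c2
    have c4 := half_sub_lt_abs_cos_sub_cos b1.1 (by linarith [mul_lt_mul_of_pos_left hlt hw]) b2.2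
      c1 c2
    rw [Real.cos_sub_nat_mul_pi, Real.cos_sub_nat_mul_pi, ← mul_sub, abs_mul, abs_pow, abs_neg,
      abs_one, one_pow, one_mul] at c4
    rw [hs0, ht0, zero_sub, zero_sub, neg_sub_neg, abs_sub_comm s t,
      abs_of_pos (sub_pos.2 hlt)] at c3
    linarith
  have hinj : InjOn k Z := by
    intro s hs t ht hst
    exact le_antisymm (not_lt.1 (hlt t ht s hs hst.symm)) (not_lt.1 (hlt s hs t ht hst))
  have hsub : k '' Z ⊆ (Finset.range (⌊w * T / Real.pi⌋₊ + 1) : Set ℕ) := by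
    rintro _ ⟨t, ht, rfl⟩
    rw [Finset.coe_range, Set.mem_Iio, Nat.lt_succ_iff]
    exact Nat.floor_le_floor (by gcongr; exact ht.1.2)
  have hsup : (Finset.range ⌊w * T / Real.pi⌋₊ : Set ℕ) ⊆ k '' Z := by
    intro m hm
    rw [Finset.coe_range, Set.mem_Iio] at hm
    have hm' : ((m : ℝ) + 1) * Real.pi ≤ w * T := by
      rw [← le_div_iff₀ hπ]
      calc (m : ℝ) + 1 ≤ (⌊w * T / Real.pi⌋₊ : ℝ) := by exact_mod_cast hm
        _ ≤ _ := Nat.floor_le (by positivity)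
    have e1 : w * (m * Real.pi / w) = m * Real.pi := by field_simp
    have e2 : w * (((m : ℝ) + 1) * Real.pi / w) = ((m + 1 : ℕ) : ℝ) * Real.pi := by
      push_cast
      field_simp
    have hle : m * Real.pi / w ≤ ((m : ℝ) + 1) * Real.pi / w := by gcongr; linarith
    have hmem : ∀ t ∈ Icc (m * Real.pi / w) (((m : ℝ) + 1) * Real.pi / w), t ∈ Icc (0 : ℝ) T := by
      intro t ht
      refine ⟨le_trans (by positivity) ht.1, ht.2.trans ?_⟩
      rw [div_le_iff₀ hw]
      linarith
    have c1 := h1 _ (hmem _ (left_mem_Icc.2 hle))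
    have c2 := h1 _ (hmem _ (right_mem_Icc.2 hle))
    rw [e1, Real.cos_nat_mul_pi, abs_le] at c1
    rw [e2, Real.cos_nat_mul_pi, pow_succ, abs_le] at c2
    have hzero : ∃ t ∈ Icc (m * Real.pi / w) (((m : ℝ) + 1) * Real.pi / w), f t = 0 ∧
        f (((m : ℝ) + 1) * Real.pi / w) ≠ 0 := by
      rcases neg_one_pow_eq_or ℝ m with h | h <;> rw [h] at c1 c2
      · obtain ⟨t, ht, h0⟩ := intermediate_value_Icc' hle hf.continuousOn
          (show (0 : ℝ) ∈ _ from ⟨by linarith, by linarith⟩)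
        exact ⟨t, ht, h0, by intro h; rw [h] at c2; linarith⟩
      · obtain ⟨t, ht, h0⟩ := intermediate_value_Icc hle hf.continuousOn
          (show (0 : ℝ) ∈ _ from ⟨by linarith, by linarith⟩)
        exact ⟨t, ht, h0, by intro h; rw [h] at c2; linarith⟩
    obtain ⟨t, ht, h0, hne⟩ := hzero
    refine ⟨t, ⟨hmem t ht, h0⟩, ?_⟩
    have ht2 : t < ((m : ℝ) + 1) * Real.pi / w := lt_of_le_of_ne ht.2 (by rintro rfl; exact hne h0)
    rw [Nat.floor_eq_iff (by have := (hmem t ht).1; positivity), le_div_iff₀ hπ, div_lt_iff₀ hπ]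
    have ht1 := ht.1
    rw [div_le_iff₀ hw] at ht1
    rw [lt_div_iff₀ hw] at ht2
    constructor <;> linarith
  have hfin : Z.Finite := Set.Finite.of_finite_image ((Finset.finite_toSet _).subset hsub) hinj
  refine ⟨Z.ncard, hfin.cast_ncard_eq.symm, ?_, ?_⟩
  · rw [← hinj.ncard_image]
    have h3 := Set.ncard_le_ncard hsup (hfin.image k)
    rw [Set.ncard_coe_finset, Finset.card_range] at h3
    have h4 : (⌊w * T / Real.pi⌋₊ : ℝ) ≤ ((k '' Z).ncard : ℝ) := by exact_mod_cast h3
    linarith [Nat.lt_floor_add_one (w * T / Real.pi)]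
  · rw [← hinj.ncard_image]
    have h3 := Set.ncard_le_ncard hsub (Finset.finite_toSet _)
    rw [Set.ncard_coe_finset, Finset.card_range] at h3
    have h4 : ((k '' Z).ncard : ℝ) ≤ (⌊w * T / Real.pi⌋₊ : ℝ) + 1 := by exact_mod_cast h3
    linarith [Nat.floor_le (a := w * T / Real.pi) (by positivity)]

end Zeros

section Main

theorem exists_subinterval_measure_ge {μ : Measure ℝ} [IsFiniteMeasure μ] {b d : ℝ} (hbd : b ≤ d)
    {K : ℕ} (hK : 0 < K) :
    ∃ w, b ≤ w ∧ w + (d - b) / K ≤ d ∧ μ.real (Icc b d) / K ≤ μ.real (Icc w (w + (d - b) / K)) := by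
  have hK' : (0 : ℝ) < K := by exact_mod_cast hK
  set L := (d - b) / K with hL
  have hL0 : 0 ≤ L := div_nonneg (sub_nonneg.2 hbd) hK'.le
  have hKL : K * L = d - b := by rw [hL]; field_simp
  by_contra! hcon
  have hlt : ∀ i < K, μ.real (Icc (b + i * L) (b + i * L + L)) < μ.real (Icc b d) / K := by
    intro i hi
    refine hcon _ (by nlinarith [(Nat.cast_nonneg i : (0 : ℝ) ≤ i)]) ?_
    have : (i : ℝ) + 1 ≤ K := by exact_mod_cast hi
    nlinarith
  have hind : ∀ k : ℕ, k + 1 ≤ K →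
      μ.real (Icc b (b + (k + 1 : ℕ) * L)) < (k + 1 : ℕ) * (μ.real (Icc b d) / K) := by
    intro k
    induction k with
    | zero => intro h; simpa using hlt 0 h
    | succ k ih =>
      intro h
      have h1 := ih (by omega)
      have h2 := hlt (k + 1) h
      have h3 : Icc b (b + (k + 1 + 1 : ℕ) * L) ⊆ Icc b (b + (k + 1 : ℕ) * L) ∪
          Icc (b + (k + 1 : ℕ) * L) (b + (k + 1 : ℕ) * L + L) := by
        intro x hx
        rcases le_total x (b + (k + 1 : ℕ) * L) with h | h
        · exact Or.inl ⟨hx.1, h⟩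
        · refine Or.inr ⟨h, hx.2.trans (le_of_eq ?_)⟩
          push_cast
          ring
      calc _ ≤ _ := (measureReal_mono h3).trans (measureReal_union_le _ _)
        _ < _ := add_lt_add h1 h2
        _ = _ := by push_cast; ring
  have h := hind (K - 1) (by omega)
  rw [Nat.sub_add_cancel hK, hKL, add_sub_cancel, mul_div_cancel₀ _ hK'.ne'] at h
  exact lt_irrefl _ h

/-- The mass near `X` is either carried by a compact interval away from the origin or by the
origin. -/
theorem exists_Icc_or_singleton_zero {μ : Measure ℝ} (hsymm : μ.map (fun x => -x) = μ) {X ε : ℝ}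
    (hX : 0 < X) (hpos : 0 < μ (Icc (X - ε) (X + ε))) :
    (∃ b d, 0 < b ∧ X - ε ≤ b ∧ b ≤ d ∧ d ≤ X + ε ∧ 0 < μ (Icc b d)) ∨
      (X ≤ ε ∧ 0 < μ {0}) := by
  have hle : ∀ {b d : ℝ}, 0 < μ (Icc b d) → b ≤ d := fun {b d} h => by
    by_contra hbd
    rw [Icc_eq_empty hbd, measure_empty] at h
    exact lt_irrefl _ h
  rcases lt_or_ge 0 (X - ε) with h0 | h0
  · exact Or.inl ⟨X - ε, X + ε, h0, le_rfl, hle hpos, le_rfl, hpos⟩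
  by_cases h1 : ∃ k : ℕ, 0 < μ (Icc (1 / ((k : ℝ) + 1)) (X + ε))
  · obtain ⟨k, hk⟩ := h1
    exact Or.inl ⟨_, _, by positivity, h0.trans (by positivity), hle hk, le_rfl, hk⟩
  refine Or.inr ⟨by linarith, ?_⟩
  push Not at h1
  have h2 : μ (Ioc 0 (X + ε)) = 0 := by
    refine measure_mono_null (t := ⋃ k : ℕ, Icc (1 / ((k : ℝ) + 1)) (X + ε)) (fun x hx => ?_)
      (measure_iUnion_null fun k => le_antisymm (h1 k) zero_le)
    obtain ⟨k, hk⟩ := exists_nat_one_div_lt hx.1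
    exact mem_iUnion.2 ⟨k, hk.le, hx.2⟩
  have h3 : μ (Ico (-(X + ε)) 0) = 0 := by
    rw [← hsymm, Measure.map_apply measurable_neg measurableSet_Ico]
    refine measure_mono_null (fun x hx => ?_) h2
    exact ⟨by linarith [hx.2], by linarith [hx.1]⟩
  by_contra h4
  refine hpos.ne' (measure_mono_null (t := Ico (-(X + ε)) 0 ∪ {0} ∪ Ioc 0 (X + ε)) (fun x hx => ?_)
    (measure_union_null (measure_union_null h3 (not_lt.1 h4 |>.antisymm zero_le)) h2))
  rcases lt_trichotomy x 0 with h | h | h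
  · exact Or.inl (Or.inl ⟨by linarith [hx.1], h⟩)
  · exact Or.inl (Or.inr h)
  · exact Or.inr ⟨h, hx.2⟩

variable {μ : Measure ℝ} [IsProbabilityMeasure μ]

theorem abs_setAverage_le {I : Set ℝ} (hI : 0 < μ.real I) {φ : ℝ → ℝ} {C : ℝ}
    (hφ : ∀ l ∈ I, |φ l| ≤ C) : |1 / μ.real I * ∫ l in I, φ l ∂μ| ≤ C := by
  have h := norm_setIntegral_le_of_norm_le_const (f := φ) (measure_lt_top μ I) hφ
  rw [abs_mul, abs_of_pos (by positivity), one_div, inv_mul_le_iff₀ hI, mul_comm]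
  exact h

theorem spectralShift_div_sub_cos {I : Set ℝ} (hI : 0 < μ.real I) {A : ℝ} (hA : 0 < A) (w t : ℝ) :
    spectralShift μ A I t / A - Real.cos (w * t) =
      1 / μ.real I * ∫ l in I, (Real.cos (l * t) - Real.cos (w * t)) ∂μ := by
  rw [integral_sub (integrable_of_continuous_of_bounded (by fun_prop)
    fun l => Real.abs_cos_le_one _) (integrable_const _), integral_const, spectralShift]
  have : (μ.restrict I).real univ = μ.real I := by simp [Measure.real]
  rw [this, smul_eq_mul]
  generalize (∫ l in I, Real.cos (l * t) ∂μ) = G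
  field_simp

theorem abs_spectralShift_div_sub_cos_le {I : Set ℝ} (hI : 0 < μ.real I) {A : ℝ} (hA : 0 < A)
    {w δ n : ℝ} (hw : ∀ l ∈ I, |l - w| ≤ δ) (hδ : 0 ≤ δ) {t : ℝ} (ht : t ∈ Icc 0 n) :
    |spectralShift μ A I t / A - Real.cos (w * t)| ≤ δ * n := by
  rw [spectralShift_div_sub_cos hI hA]
  refine abs_setAverage_le hI fun l hl => (Real.abs_cos_sub_cos_le _ _).trans ?_
  rw [← sub_mul, abs_mul, abs_of_nonneg ht.1]
  exact mul_le_mul (hw l hl) ht.2 ht.1 hδ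

theorem abs_spectralShift_div_sub_cos_sub_le {I : Set ℝ} (hI : 0 < μ.real I) {A : ℝ} (hA : 0 < A)
    {w δ n : ℝ} (hw0 : 0 ≤ w) (hw : ∀ l ∈ I, |l - w| ≤ δ) (hδ : 0 ≤ δ) {s t : ℝ}
    (hs : s ∈ Icc 0 n) (ht : t ∈ Icc 0 n) :
    |(spectralShift μ A I s / A - Real.cos (w * s)) -
      (spectralShift μ A I t / A - Real.cos (w * t))| ≤ δ * (1 + w * n) * |s - t| := by
  have h_int : ∀ x : ℝ, Integrable (fun l : ℝ => Real.cos (l * x) - Real.cos (w * x))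
      (μ.restrict I) := fun x => (integrable_of_continuous_of_bounded (by fun_prop)
    fun l => Real.abs_cos_le_one _).sub (integrable_const _)
  rw [spectralShift_div_sub_cos hI hA, spectralShift_div_sub_cos hI hA, ← mul_sub,
    ← integral_sub (h_int s) (h_int t)]
  refine abs_setAverage_le hI fun l hl => ?_
  have hd : ∀ x ∈ Icc 0 n, HasDerivWithinAt (fun x => Real.cos (l * x) - Real.cos (w * x))
      (-Real.sin (l * x) * l - -Real.sin (w * x) * w) (Icc 0 n) x := fun x _ => by
    have h1 : ∀ a : ℝ, HasDerivAt (fun t => Real.cos (a * t)) (-Real.sin (a * x) * a) x :=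
      fun a => by simpa using ((hasDerivAt_id x).const_mul a).cos
    exact ((h1 l).sub (h1 w)).hasDerivWithinAt
  have := (convex_Icc (0 : ℝ) n).norm_image_sub_le_of_norm_hasDerivWithin_le (C := δ * (1 + w * n))
    hd (fun x hx => ?_) ht hs
  · exact this
  · have e : -Real.sin (l * x) * l - -Real.sin (w * x) * w =
        Real.sin (l * x) * (w - l) + w * (Real.sin (w * x) - Real.sin (l * x)) := by ring
    have b1 : |Real.sin (l * x) * (w - l)| ≤ δ := by
      rw [abs_mul, abs_sub_comm]
      exact (mul_le_of_le_one_left (abs_nonneg _) (Real.abs_sin_le_one _)).trans (hw l hl)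
    have b2 : |w * (Real.sin (w * x) - Real.sin (l * x))| ≤ w * (δ * n) := by
      rw [abs_mul, abs_of_nonneg hw0]
      refine mul_le_mul_of_nonneg_left ((Real.abs_sin_sub_sin_le _ _).trans ?_) hw0
      rw [← sub_mul, abs_mul, abs_of_nonneg hx.1, abs_sub_comm]
      exact mul_le_mul (hw l hl) hx.2 hx.1 hδ
    rw [e, Real.norm_eq_abs]
    refine (abs_add_le _ _).trans ((add_le_add b1 b2).trans (le_of_eq ?_))
    ring

variable {Ω : Type*} [MeasurableSpace Ω] {P : Measure Ω} [IsProbabilityMeasure P]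
  {F : ℝ → Ω → ℝ}

theorem ceil_bounds {T : ℝ} (hT : 1 ≤ T) :
    T ≤ ⌈T⌉₊ ∧ (1 : ℝ) ≤ ⌈T⌉₊ ∧ (⌈T⌉₊ : ℝ) ≤ 2 * T ∧ (⌈T⌉₊ : ℝ) + 1 ≤ 3 * T := by
  have h1 := Nat.le_ceil T
  have h2 := Nat.ceil_lt_add_one (zero_le_one.trans hT)
  refine ⟨h1, hT.trans h1, ?_, ?_⟩ <;> linarith

theorem IsSGP.no_zeros_ge (hF : IsSGP P μ F)
    (hmom : Integrable (fun l : ℝ => l ^ 2 * (Real.log |l|) ^ 2) μ) (h0 : 0 < μ {0}) :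
    ∃ c > (0 : ℝ), ∀ T ≥ (1 : ℝ),
      ENNReal.ofReal (Real.exp (-c * T)) ≤ P {ω | zeroCount F T ω = 0} := by
  obtain ⟨Λ, hΛ, h⟩ := hF.lipschitz_ge hmom
  have hI : 0 < μ.real {0} := ENNReal.toReal_pos h0.ne' (measure_ne_top _ _)
  refine ⟨48 + (Λ + 1) ^ 2 / (2 * μ.real {0}), by positivity, fun T hT => ?_⟩
  obtain ⟨n1, -, -, n4⟩ := ceil_bounds hT
  refine le_trans ?_ ((h ⌈T⌉₊ hI (show 0 < Λ + 1 by positivity)).trans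
    (measure_mono fun ω hω => ?_))
  · refine ENNReal.ofReal_le_ofReal (Real.exp_le_exp.2 ?_)
    have : 0 ≤ (Λ + 1) ^ 2 / (2 * μ.real {0}) := by positivity
    nlinarith
  · simp only [Set.mem_ofPred_eq, zeroCount, Set.encard_eq_zero, Set.eq_empty_iff_forall_notMem]
    rintro t ⟨ht, ht0⟩
    have h1 := hω.1 t ⟨ht.1, ht.2.trans n1⟩
    have h2 : spectralShift μ (Λ + 1) {0} t = Λ + 1 := by
      simp only [spectralShift, Measure.restrict_singleton, integral_smul_measure, zero_mul,
        integral_dirac, Real.cos_zero, smul_eq_mul, mul_one]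
      exact div_mul_cancel₀ _ hI.ne'
    rw [ht0, h2, zero_sub, abs_neg, abs_of_pos (by positivity)] at h1
    linarith

theorem IsSGP.zeroCount_ge (hF : IsSGP P μ F)
    (hmom : Integrable (fun l : ℝ => l ^ 2 * (Real.log |l|) ^ 2) μ) {b d : ℝ} (hb : 0 < b)
    (hbd : b ≤ d) (hpos : 0 < μ (Icc b d)) :
    ∃ c > (0 : ℝ), ∀ T ≥ (1 : ℝ),
      ENNReal.ofReal (Real.exp (-c * T)) ≤ P {ω | ∃ n : ℕ, zeroCount F T ω = n ∧
        b * T / Real.pi - 1 ≤ n ∧ n ≤ d * T / Real.pi + 1} := by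
  obtain ⟨Λ, hΛ, h⟩ := hF.lipschitz_ge hmom
  have hm : 0 < μ.real (Icc b d) := ENNReal.toReal_pos hpos.ne' (measure_ne_top _ _)
  set η := b / (4 * (b + 1)) with hη
  have hη0 : 0 < η := by positivity
  have hη1 : η ≤ 1 / 4 := by
    rw [hη, div_le_div_iff₀ (by positivity) (by norm_num)]
    linarith
  have hη2 : η ≤ b / 4 := by
    rw [hη, div_le_div_iff₀ (by positivity) (by norm_num)]
    nlinarith
  obtain ⟨A, hA, hAη⟩ : ∃ A > 0, Λ / A = η := ⟨Λ / η, by positivity, by field_simp⟩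
  obtain ⟨q, hq⟩ := exists_nat_gt ((d - b) * (1 + d) / η)
  have hd : 0 < d := hb.trans_le hbd
  have hq0 : (0 : ℝ) < q :=
    (div_nonneg (mul_nonneg (sub_nonneg.2 hbd) (by positivity)) hη0.le).trans_lt hq
  have hδ : (d - b) / q * (1 + d) ≤ η := by
    rw [div_lt_iff₀ hη0] at hq
    rw [div_mul_eq_mul_div, div_le_iff₀ hq0]
    linarith
  refine ⟨48 + A ^ 2 * q / μ.real (Icc b d), by positivity, fun T hT => ?_⟩
  obtain ⟨n1, n2, n3, n4⟩ := ceil_bounds hT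
  set n := ⌈T⌉₊ with hn
  have hn0 : (0 : ℝ) < n := by linarith
  obtain ⟨w, hbw, hwd, hw⟩ := exists_subinterval_measure_ge (μ := μ) hbd (K := n * q)
    (Nat.mul_pos (by exact_mod_cast hn0) (by exact_mod_cast hq0))
  set δ := (d - b) / (n * q : ℕ) with hδdef
  have hδ0 : 0 ≤ δ := div_nonneg (sub_nonneg.2 hbd) (by positivity)
  have hδn : δ * n = (d - b) / q := by
    rw [hδdef]
    push_cast
    field_simp
  have hI : 0 < μ.real (Icc w (w + δ)) := lt_of_lt_of_le
    (by push_cast; exact div_pos hm (mul_pos hn0 hq0)) hw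
  have hw0 : 0 < w := hb.trans_le hbw
  have hclose : ∀ l ∈ Icc w (w + δ), |l - w| ≤ δ := fun l hl => by
    rw [abs_of_nonneg (sub_nonneg.2 hl.1)]
    linarith [hl.2]
  refine le_trans ?_ ((h n hI hA).trans (measure_mono fun ω hω => ?_))
  · refine ENNReal.ofReal_le_ofReal (Real.exp_le_exp.2 ?_)
    have h1 : A ^ 2 / (2 * μ.real (Icc w (w + δ))) ≤ A ^ 2 * q / μ.real (Icc b d) * T := by
      push_cast at hw
      rw [div_le_iff₀ (mul_pos hn0 hq0)] at hw
      rw [div_mul_eq_mul_div, div_le_div_iff₀ (by positivity) hm]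
      calc A ^ 2 * μ.real (Icc b d) ≤ A ^ 2 * (μ.real (Icc w (w + δ)) * (2 * T * q)) := by
            refine mul_le_mul_of_nonneg_left (hw.trans ?_) (sq_nonneg A)
            gcongr
        _ = _ := by ring
    linarith
  · have hsub : ∀ t ∈ Icc (0 : ℝ) T, t ∈ Icc (0 : ℝ) n := fun t ht => ⟨ht.1, ht.2.trans n1⟩
    have hsplit : ∀ t, F t ω / A - Real.cos (w * t) =
        (F t ω - spectralShift μ A (Icc w (w + δ)) t) / A +
          (spectralShift μ A (Icc w (w + δ)) t / A - Real.cos (w * t)) := fun t => by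
      field_simp
      ring
    obtain ⟨N, hN, hN1, hN2⟩ := encard_zeros_cos_add (w := w) (T := T) hw0 (by linarith)
      (f := fun t => F t ω / A) ((hF.1 ω).div_const A) (fun t ht => by
        have c1 := hω.1 t (hsub t ht)
        have c2 := abs_spectralShift_div_sub_cos_le hI hA hclose hδ0 (hsub t ht)
        rw [hδn] at c2
        have c3 : |(F t ω - spectralShift μ A (Icc w (w + δ)) t) / A| ≤ η := by
          rw [abs_div, abs_of_pos hA, ← hAη]
          gcongr
        rw [hsplit]
        have c4 : (d - b) / q ≤ (d - b) / q * (1 + d) :=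
          le_mul_of_one_le_right (div_nonneg (sub_nonneg.2 hbd) hq0.le) (by linarith)
        exact (abs_add_le _ _).trans (by linarith)) (fun s hs t ht => by
        have c1 := hω.2 s (hsub s hs) t (hsub t ht)
        have c2 := abs_spectralShift_div_sub_cos_sub_le hI hA hw0.le hclose hδ0 (hsub s hs)
          (hsub t ht)
        have c3 : |(F s ω - spectralShift μ A (Icc w (w + δ)) s) / A -
            (F t ω - spectralShift μ A (Icc w (w + δ)) t) / A| ≤ η * |s - t| := by
          rw [← _root_.sub_div, abs_div, abs_of_pos hA, ← hAη, div_mul_eq_mul_div]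
          gcongr
        have c4 : δ * (1 + w * n) ≤ η := by
          refine le_trans ?_ hδ
          rw [← hδn]
          have : w ≤ d := by linarith
          have : δ * n * w ≤ δ * n * d := mul_le_mul_of_nonneg_left this (by positivity)
          nlinarith
        have c5 := mul_le_mul_of_nonneg_right c4 (abs_nonneg (s - t))
        rw [hsplit, hsplit, add_sub_add_comm]
        refine (abs_add_le _ _).trans ?_
        have c6 : 2 * η * |s - t| ≤ w / 2 * |s - t| := by
          gcongr
          linarith
        linarith)
    have hπ := Real.pi_pos
    refine ⟨N, ?_, le_trans ?_ hN1, hN2.trans ?_⟩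
    · rw [← hN, zeroCount]
      simp [hA.ne']
    · gcongr
    · gcongr
      linarith

end Main

theorem prop_lb
    {Ω : Type*} [MeasurableSpace Ω] (P : Measure Ω) [IsProbabilityMeasure P]
    (μ : Measure ℝ) [IsProbabilityMeasure μ]
    (hsymm : μ.map (fun x => -x) = μ)
    (hmom : Integrable (fun l : ℝ => l ^ 2 * (Real.log (abs l)) ^ 2) μ)
    (X : ℝ) (hX : 0 < X) (ε : ℝ) (hε : 0 < ε)
    (hpos : 0 < μ (Set.Icc (X - ε) (X + ε)))
    (F : ℝ → Ω → ℝ) (hF : IsSGP P μ F) :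
    ∃ c > (0:ℝ), ∃ T₀ > (0:ℝ), ∀ T ≥ T₀,
      ENNReal.ofReal (Real.exp (-c * T)) ≤
        P {ω | ∃ n : ℕ, zeroCount F T ω = n ∧
          (X - 2 * ε) / Real.pi ≤ (n : ℝ) / T ∧ (n : ℝ) / T ≤ (X + 2 * ε) / Real.pi} := by
  have hπ := Real.pi_pos
  rcases exists_Icc_or_singleton_zero hsymm hX hpos with ⟨b, d, hb, hXb, hbd, hdX, hm⟩ | ⟨hXε, h0⟩
  · obtain ⟨c, hc, h⟩ := hF.zeroCount_ge hmom hb hbd hm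
    refine ⟨c, hc, max 1 (Real.pi / ε), by positivity, fun T hT => ?_⟩
    have hT1 : 1 ≤ T := (le_max_left _ _).trans hT
    have hT2 : Real.pi ≤ ε * T := by
      have := (le_max_right _ _).trans hT
      rwa [div_le_iff₀ hε, mul_comm] at this
    have hT0 : 0 < T := by linarith
    refine (h T hT1).trans (measure_mono ?_)
    rintro ω ⟨n, hn, hn1, hn2⟩
    refine ⟨n, hn, ?_, ?_⟩
    · rw [div_le_div_iff₀ hπ hT0]
      rw [sub_le_iff_le_add, div_le_iff₀ hπ] at hn1
      have := mul_le_mul_of_nonneg_right hXb hT0.le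
      linarith
    · rw [div_le_div_iff₀ hT0 hπ]
      rw [← sub_le_iff_le_add, le_div_iff₀ hπ] at hn2
      have := mul_le_mul_of_nonneg_right hdX hT0.le
      linarith
  · obtain ⟨c, hc, h⟩ := hF.no_zeros_ge hmom h0
    refine ⟨c, hc, 1, one_pos, fun T hT => (h T hT).trans (measure_mono fun ω hω => ?_)⟩
    refine ⟨0, by simpa using hω, ?_, ?_⟩
    · rw [Nat.cast_zero, zero_div]
      exact div_nonpos_of_nonpos_of_nonneg (by linarith) hπ.le
    · rw [Nat.cast_zero, zero_div]
      positivity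
end
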